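/- arXiv:2506.20565 — 3 statements merged into one kernel-verified Lean document; each statement's English description precedes it below -/
import Mathlib

section
/- Let f, g_1,…,g_r : ℝ^n → ℝ be real-analytic functions on all of ℝ^n, let μ_0 > 0, and let x : (0,μ_0) → ℝ^n be a bounded critical path: x is continuous, its image is bounded, and for every μ ∈ (0,μ_0), x(μ) satisfies g_i(x(μ)) > 0 for all i, ∇f(x(μ)) = μ·Σ_{i=1}^r ∇g_i(x(μ))/g_i(x(μ)), and x(μ) is an isolated point of the set of all such solutions. Then there exists a positive integer ρ such that the reparametrized path μ ↦ x(μ^ρ) is real-analytic at μ = 0: there exist ε > 0 and a map y : (−ε,ε) → ℝ^n, real-analytic on (−ε,ε), with y(μ) = x(μ^ρ) for all μ ∈ (0,ε). (The theorem extending analytic reparametrization of critical paths from polynomial data to real globally analytic data.) -/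
open Filter Topology

section P1
variable {E F : Type*} [NormedAddCommGroup E] [NormedSpace ℝ E]
  [NormedAddCommGroup F] [NormedSpace ℝ F]

/-- telescoping -/
lemma aux_tele {n : ℕ} (p : ContinuousMultilinearMap ℝ (fun _ : Fin (n+1) => E) ℝ) (x y : E) :
    p (fun _ => x) - p (fun _ => y) =
      ∑ i : Fin (n+1), p (i.insertNth (x - y) (fun l : Fin n => if (l : ℕ) < i then x else y)) := by
  set V : ℕ → Fin (n+1) → E := fun k l => if (l : ℕ) < k then x else y with hV
  have h1 : ∀ i : Fin (n+1), p (i.insertNth (x - y) (fun l : Fin n => if (l : ℕ) < i then x else y))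
      = p (V (i+1)) - p (V i) := by
    intro i
    have e1 : V (i+1) = Function.update (V i) i x := by
      ext l
      by_cases h : l = i
      · subst h; simp [hV]
      · have : (l : ℕ) ≠ i := fun h' => h (Fin.ext h')
        simp only [hV, Function.update_of_ne h]
        by_cases h2 : (l : ℕ) < i
        · simp [h2, Nat.lt_succ_of_lt h2]
        · have : ¬ (l : ℕ) < i + 1 := by omega
          simp [h2, this]
    have e2 : V i = Function.update (V i) i y := by
      rw [eq_comm, Function.update_eq_self_iff]
      simp [hV]
    have e3 : (i.insertNth (x - y) (fun l : Fin n => if (l : ℕ) < i then x else y) : Fin (n+1) → E)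
        = Function.update (V i) i (x - y) := by
      rw [eq_comm, Fin.eq_insertNth_iff]
      refine ⟨by simp, ?_⟩
      ext l
      simp only [Fin.removeNth, hV]
      rw [Function.update_of_ne (Fin.succAbove_ne i l)]
      by_cases h : l.castSucc < i
      · rw [Fin.succAbove_of_castSucc_lt _ _ h]
        simp
      · rw [Fin.succAbove_of_le_castSucc _ _ (not_lt.1 h)]
        have h' : ¬ (l : ℕ) < i := fun h3 => h h3
        have : ¬ ((l.succ : Fin (n+1)) : ℕ) < i := by simp; omega
        simp only [this, h', if_false]
    rw [e3, e1]
    conv_rhs => rw [e2]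
    rw [Function.update_idem, p.map_update_sub]
  rw [Finset.sum_congr rfl (fun i _ => h1 i)]
  rw [Fin.sum_univ_eq_sum_range (fun k => p (V (k+1)) - p (V k)), Finset.sum_range_sub (fun k => p (V k))]
  congr 2
  ext l
  simp [hV, l.2]

lemma aux_div (f : E → ℝ) (hf : AnalyticAt ℝ f 0) (ℓ : E →L[ℝ] ℝ) (e : E) :
    ∃ f1 : E → ℝ, AnalyticAt ℝ f1 0 ∧
      ∀ᶠ x in 𝓝 (0:E), f x = f (x - ℓ x • e) + ℓ x * f1 x := by
  obtain ⟨p, hp⟩ := hf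
  let π : E →L[ℝ] E := ContinuousLinearMap.id ℝ E - ℓ.smulRight e
  have hπ : ∀ x, π x = x - ℓ x • e := fun x => by simp [π]
  let q : FormalMultilinearSeries ℝ E ℝ := fun n => ∑ i : Fin (n+1),
    ((p (n+1)).curryMid i e).compContinuousLinearMap
      (fun l => if (l : ℕ) < i then ContinuousLinearMap.id ℝ E else π)
  set C : ℝ := 1 + ‖π‖ with hC
  have hC1 : 1 ≤ C := by simp [hC]
  have hq : ∀ n, ‖q n‖ ≤ (n+1) * (‖p (n+1)‖ * ‖e‖ * C ^ n) := by
    intro n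
    refine (norm_sum_le _ _).trans ?_
    have : ∀ i ∈ (Finset.univ : Finset (Fin (n+1))), ‖((p (n+1)).curryMid i e).compContinuousLinearMap
      (fun l => if (l : ℕ) < i then ContinuousLinearMap.id ℝ E else π)‖ ≤ (‖p (n+1)‖ * ‖e‖ * C ^ n) := by
      intro i _
      refine (ContinuousMultilinearMap.norm_compContinuousLinearMap_le _ _).trans ?_
      have h1 : ‖(p (n+1)).curryMid i e‖ ≤ ‖p (n+1)‖ * ‖e‖ := by
        have := ((p (n+1)).curryMid i).le_opNorm e
        rwa [ContinuousMultilinearMap.norm_curryMid] at this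
      have h2 : ∏ l : Fin n, ‖if (l : ℕ) < i then ContinuousLinearMap.id ℝ E else π‖ ≤ C ^ n := by
        calc _ ≤ ∏ l : Fin n, C := by
              apply Finset.prod_le_prod
              · intros; positivity
              · intro l _
                split_ifs
                · exact ContinuousLinearMap.norm_id_le.trans hC1
                · simp [hC]
          _ = _ := by simp
      gcongr
    refine (Finset.sum_le_sum this).trans ?_
    simp
  have hpr : 0 < p.radius := by
    obtain ⟨r, hr⟩ := hp; exact hr.r_pos.trans_le hr.r_le
  have hqr : 0 < q.radius := by
    obtain ⟨K, ρ, hρ, hK⟩ : ∃ K : ℝ, ∃ ρ : ℝ, 0 < ρ ∧ ∀ n, ‖p n‖ ≤ K * ρ ^ n := by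
      obtain ⟨C1, r1, hC1, hr1, h⟩ := p.le_mul_pow_of_radius_pos hpr
      exact ⟨C1, r1, hr1, h⟩
    have hK0 : 0 ≤ K := by have := (norm_nonneg _).trans (hK 0); simpa using this
    have hpos : 0 < 2 * ρ * C := by positivity
    let R : NNReal := ⟨(2 * ρ * C)⁻¹, by positivity⟩
    have hR : 0 < R := by
      show (0:ℝ) < (2 * ρ * C)⁻¹
      positivity
    have := q.le_radius_of_bound (K * ρ * ‖e‖) (r := R) (fun n => by
      have h1 : ((n:ℝ)+1) ≤ 2 ^ n := by
        have := n.lt_two_pow_self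
        exact_mod_cast this
      calc ‖q n‖ * (R:ℝ) ^ n ≤ (2 ^ n * ((K * ρ ^ (n+1)) * ‖e‖ * C ^ n)) * ((2 * ρ * C)⁻¹) ^ n := by
            have := hq n
            have := hK (n+1)
            have hRR : (R:ℝ) = (2 * ρ * C)⁻¹ := rfl
            rw [hRR]
            gcongr
            refine (hq n).trans ?_
            gcongr
        _ = K * ρ * ‖e‖ * ((2 * ρ * C) ^ n * ((2 * ρ * C)⁻¹) ^ n) := by ring_nf
        _ = K * ρ * ‖e‖ := by rw [← mul_pow, mul_inv_cancel₀ hpos.ne', one_pow, mul_one]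
        _ ≤ _ := le_rfl)
    exact lt_of_lt_of_le (by exact_mod_cast hR) this
  have hqs := q.hasFPowerSeriesOnBall hqr
  refine ⟨q.sum, hqs.analyticAt, ?_⟩
  have hq2 := hqs.hasFPowerSeriesAt.eventually_hasSum
  have hp2 := hp.eventually_hasSum
  have hp3 : ∀ᶠ x in 𝓝 (0:E), HasSum (fun n : ℕ => p n fun _ => π x) (f (0 + π x)) := by
    have : Tendsto π (𝓝 0) (𝓝 0) := by simpa using π.continuous.tendsto 0
    exact this.eventually hp2
  filter_upwards [hq2, hp2, hp3] with x h1 h2 h3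
  rw [zero_add] at h1 h2 h3
  rw [← hπ]
  have h4 := (h2.sub h3)
  have h5 := (hasSum_nat_add_iff' 1).2 h4
  have h6 : (fun n => p (n+1) (fun _ => x) - p (n+1) (fun _ => π x)) = fun n => ℓ x * q n (fun _ => x) := by
    ext n
    rw [aux_tele]
    have : x - π x = ℓ x • e := by simp [π]
    rw [this]
    simp only [q, sum_apply, Finset.mul_sum]
    refine Finset.sum_congr rfl fun i _ => ?_
    rw [ContinuousMultilinearMap.compContinuousLinearMap_apply, ContinuousMultilinearMap.curryMid_apply]
    have := ((p (n+1)).curryMid i).map_smul (ℓ x) e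
    have := congrArg (fun T => T (fun l : Fin n => if (l:ℕ) < i then x else π x)) this
    simp only [ContinuousMultilinearMap.curryMid_apply, smul_apply, smul_eq_mul] at this
    rw [this]
    congr 4
    ext l
    split_ifs <;> simp
  rw [h6] at h5
  have h7 := (h1.mul_left (ℓ x)).unique h5
  simp at h7
  have h8 : p 0 (fun _ => x) = p 0 (fun _ => π x) := by
    congr 1; ext i; exact i.elim0
  have : ((fun n => p n fun x_1 => x) - fun n => p n fun x_1 => π x) 0 = 0 := by simp [h8]
  rw [h7]
  linarith

lemma aux_inv [CompleteSpace E] (Ψ : E → E) (hΨ : AnalyticAt ℝ Ψ 0) (h0 : Ψ 0 = 0)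
    (A : E ≃L[ℝ] E) (hA : HasFDerivAt Ψ (A : E →L[ℝ] E) 0) :
    ∃ χ : E → E, AnalyticAt ℝ χ 0 ∧ χ 0 = 0 ∧ (∀ᶠ x in 𝓝 0, χ (Ψ x) = x) ∧
      (∀ᶠ x in 𝓝 0, Ψ (χ x) = x) := by
  have hs : HasStrictFDerivAt Ψ (A : E →L[ℝ] E) 0 := by
    have := hΨ.hasStrictFDerivAt
    rwa [hA.fderiv] at this
  refine ⟨hs.localInverse Ψ A 0, ?_, ?_, ?_, ?_⟩
  · have := (hs.toOpenPartialHomeomorph Ψ).analyticAt_symm' (a := 0)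
      (hs.mem_toOpenPartialHomeomorph_source) (i := A) hΨ hA.fderiv
    have h2 : (hs.toOpenPartialHomeomorph Ψ) 0 = 0 := h0
    rw [h2] at this
    exact this
  · have := hs.localInverse_apply_image
    rwa [h0] at this
  · exact hs.eventually_left_inverse
  · have := hs.eventually_right_inverse
    rwa [h0] at this

/-- Inverse of a map changing one coordinate. -/
lemma aux_inv1 [CompleteSpace E] (G : E → ℝ) (hG : AnalyticAt ℝ G 0) (h0 : G 0 = 0)
    (ℓ : E →L[ℝ] ℝ) (e : E) (he : ℓ e = 1) (hd : fderiv ℝ G 0 e ≠ 0) :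
    ∃ χ : E → E, AnalyticAt ℝ χ 0 ∧ χ 0 = 0 ∧
      (∀ᶠ x in 𝓝 0, χ (x + (G x - ℓ x) • e) = x) ∧
      (∀ᶠ x in 𝓝 0, χ x + (G (χ x) - ℓ (χ x)) • e = x) := by
  set D := fderiv ℝ G 0 with hD
  let A1 : E →L[ℝ] E := ContinuousLinearMap.id ℝ E + (D - ℓ).smulRight e
  let A2 : E →L[ℝ] E := ContinuousLinearMap.id ℝ E +
    ((D e)⁻¹ • (ℓ - D + (D e) • ℓ) - ℓ).smulRight e
  have l1 : Function.LeftInverse A2 A1 := by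
    intro x
    simp [A1, A2, he]
    rw [add_assoc, ← add_smul]
    convert add_zero x
    convert zero_smul ℝ e
    field_simp
    ring
  have l2 : Function.RightInverse A2 A1 := by
    intro x
    simp [A1, A2, he]
    rw [add_assoc, ← add_smul]
    convert add_zero x
    convert zero_smul ℝ e
    field_simp
    ring
  let A : E ≃L[ℝ] E := ContinuousLinearEquiv.equivOfInverse A1 A2 l1 l2
  refine aux_inv (fun x => x + (G x - ℓ x) • e) ?_ (by simp [h0]) A ?_
  · have := ℓ.analyticAt (0:E)
    exact analyticAt_id.add ((hG.sub this).smul analyticAt_const)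
  · have h1 : HasFDerivAt G D 0 := hG.differentiableAt.hasFDerivAt
    exact (hasFDerivAt_id (0:E)).add ((h1.sub ℓ.hasFDerivAt).smul_const e)

/-- no zero divisors -/
lemma aux_nzd (f h : E → ℝ) (hf : AnalyticAt ℝ f 0) (hh : AnalyticAt ℝ h 0)
    (H : ∀ᶠ x in 𝓝 0, f x * h x = 0) : (∀ᶠ x in 𝓝 0, f x = 0) ∨ (∀ᶠ x in 𝓝 0, h x = 0) := by
  obtain ⟨r, hr, hB⟩ := Metric.eventually_nhds_iff_ball.1
    (H.and (hf.eventually_analyticAt.and hh.eventually_analyticAt))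
  by_cases hz : ∀ x ∈ Metric.ball (0:E) r, f x = 0
  · left; exact Metric.eventually_nhds_iff_ball.2 ⟨r, hr, hz⟩
  · right
    push Not at hz
    obtain ⟨x, hx, hfx⟩ := hz
    have hne : ∀ᶠ y in 𝓝 x, f y ≠ 0 := (hB x hx).2.1.continuousAt.eventually_ne hfx
    have hz : h =ᶠ[𝓝 x] 0 := by
      filter_upwards [hne, Metric.isOpen_ball.mem_nhds hx] with y hy hyb
      exact (mul_eq_zero.1 (hB y hyb).1).resolve_left hy
    have : AnalyticOnNhd ℝ h (Metric.ball 0 r) := fun y hy => (hB y hy).2.2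
    have := this.eqOn_zero_of_preconnected_of_eventuallyEq_zero
      (convex_ball (0:E) r).isPreconnected hx hz
    exact Metric.eventually_nhds_iff_ball.2 ⟨r, hr, this⟩

lemma aux_nzd_prod {κ : Type*} (s : Finset κ) (f : κ → E → ℝ) (hf : ∀ k ∈ s, AnalyticAt ℝ (f k) 0)
    (hn : ∀ k ∈ s, ¬ ∀ᶠ x in 𝓝 0, f k x = 0) : ¬ ∀ᶠ x in 𝓝 (0:E), ∏ k ∈ s, f k x = 0 := by
  classical
  induction s using Finset.induction_on with
  | empty => simpa using (NeBot.ne (inferInstance : NeBot (𝓝 (0:E))))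
  | insert a s ha ih =>
    intro H
    simp only [Finset.prod_insert ha] at H
    rcases aux_nzd _ _ (hf a (by simp)) (Finset.analyticAt_fun_prod s (fun k hk => hf k (by simp [hk]))) H with h | h
    · exact hn a (by simp) h
    · exact ih (fun k hk => hf k (by simp [hk])) (fun k hk => hn k (by simp [hk])) h
end P1

open Filter Topology

section P2
/-- monomial -/
def bmon {m : ℕ} (a : Fin m → ℕ) (w : Fin m → ℝ) : ℝ := ∏ i, w i ^ a i

/-- monomial times unit -/
def BMono {m : ℕ} (f : (Fin m → ℝ) → ℝ) : Prop :=
  ∃ (a : Fin m → ℕ) (u : (Fin m → ℝ) → ℝ), AnalyticAt ℝ u 0 ∧ u 0 ≠ 0 ∧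
    ∀ᶠ w in 𝓝 0, f w = bmon a w * u w

variable {m : ℕ}

lemma bmon_add (a b : Fin m → ℕ) (w) : bmon (a + b) w = bmon a w * bmon b w := by
  simp [bmon, pow_add, Finset.prod_mul_distrib]

lemma bmon_zero (w : Fin m → ℝ) : bmon 0 w = 1 := by simp [bmon]

lemma bmon_smul (k : ℕ) (a : Fin m → ℕ) (w) : bmon (k • a) w = bmon a w ^ k := by
  simp [bmon, ← Finset.prod_pow, ← pow_mul, mul_comm]

lemma bmon_single (i : Fin m) (k : ℕ) (w) : bmon (Pi.single i k) w = w i ^ k := by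
  rw [bmon, Finset.prod_eq_single i]
  · simp
  · intro j _ hj; simp [hj]
  · simp

lemma bmon_ne {a : Fin m → ℕ} {w} (h : ∀ i, 0 < a i → w i ≠ 0) : bmon a w ≠ 0 := by
  rw [bmon, Finset.prod_ne_zero_iff]
  intro i _
  rcases Nat.eq_zero_or_pos (a i) with h0 | h0
  · simp [h0]
  · exact pow_ne_zero _ (h i h0)

lemma bmon_eq_zero {a : Fin m → ℕ} {w} (i) (h : 0 < a i) (hw : w i = 0) : bmon a w = 0 := by
  rw [bmon]; exact Finset.prod_eq_zero (Finset.mem_univ i) (by simp [hw, h.ne'])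

lemma bmon_analytic (a : Fin m → ℕ) (x) : AnalyticAt ℝ (bmon a) x := by
  unfold bmon
  refine Finset.analyticAt_fun_prod _ fun i _ => ?_
  exact ((ContinuousLinearMap.proj (R := ℝ) (φ := fun _ : Fin m => ℝ) i).analyticAt x).pow _

lemma coord_analytic (i : Fin m) (x) : AnalyticAt ℝ (fun w : Fin m → ℝ => w i) x :=
  (ContinuousLinearMap.proj (R := ℝ) (φ := fun _ : Fin m => ℝ) i).analyticAt x

lemma bmon_at_zero {a : Fin m → ℕ} (h : a ≠ 0) : bmon a 0 = 0 := by
  obtain ⟨i, hi⟩ := Function.ne_iff.1 h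
  exact bmon_eq_zero i (Nat.pos_of_ne_zero hi) rfl

/-- test points -/
lemma test_pt {Q : (Fin m → ℝ) → Prop} (h : ∀ᶠ w in 𝓝 0, Q w) (S : Fin m → Prop) :
    ∃ w, Q w ∧ (∀ i, S i → w i = 0) ∧ (∀ i, ¬ S i → w i ≠ 0) := by
  classical
  let c : ℝ → Fin m → ℝ := fun s i => if S i then 0 else s
  have hc : Tendsto c (𝓝[>] 0) (𝓝 0) := by
    rw [tendsto_pi_nhds]
    intro i
    by_cases hi : S i
    · simp [c, hi]
    · simp only [c, hi, if_false]
      exact tendsto_nhdsWithin_of_tendsto_nhds tendsto_id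
  obtain ⟨s, hs, hs0⟩ := ((hc.eventually h).and self_mem_nhdsWithin).exists
  refine ⟨c s, hs, fun i hi => by simp [c, hi], fun i hi => ?_⟩
  simp only [c, hi, if_false]
  exact ne_of_gt hs0

lemma coord_not_zero (i : Fin m) : ¬ ∀ᶠ w in 𝓝 (0 : Fin m → ℝ), w i = 0 := by
  intro h
  obtain ⟨w, hw, _, h2⟩ := test_pt h (fun _ => False)
  exact h2 i (by simp) hw

lemma bdiv1 {f v : (Fin m → ℝ) → ℝ} (hf : AnalyticAt ℝ f 0) (hv : AnalyticAt ℝ v 0) (hv0 : v 0 ≠ 0)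
    {i : Fin m} {b : Fin m → ℕ} (h : ∀ᶠ w in 𝓝 0, w i * f w = bmon b w * v w) :
    ∃ b', b = Pi.single i 1 + b' ∧ ∀ᶠ w in 𝓝 0, f w = bmon b' w * v w := by
  have hb : 0 < b i := by
    by_contra hb
    obtain ⟨w, ⟨hw, hvw⟩, h1, h2⟩ := test_pt (h.and (hv.continuousAt.eventually_ne hv0)) (fun j => j = i)
    rw [h1 i rfl, zero_mul] at hw
    refine (mul_ne_zero (bmon_ne fun j hj => ?_) hvw) hw.symm
    apply h2
    rintro rfl
    exact hb hj
  have hb' : b = Pi.single i 1 + (b - Pi.single i 1) := by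
    ext j
    by_cases hj : j = i
    · subst hj; simp; omega
    · simp [hj]
  refine ⟨_, hb', ?_⟩
  have := aux_nzd (fun w => w i) (fun w => f w - bmon (b - Pi.single i 1) w * v w)
    (coord_analytic i 0) (hf.sub ((bmon_analytic _ 0).mul hv)) (by
      filter_upwards [h] with w hw
      rw [hb', bmon_add, bmon_single] at hw
      simp only [pow_one] at hw
      linear_combination hw)
  rcases this with h | h
  · exact absurd h (coord_not_zero i)
  · filter_upwards [h] with w hw
    linarith

lemma exists_pred {a : Fin m → ℕ} (h : a ≠ 0) : ∃ (i : Fin m) (a' : Fin m → ℕ), a = Pi.single i 1 + a' ∧ ∑ j, a' j < ∑ j, a j := by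
  obtain ⟨i, hi⟩ := Function.ne_iff.1 h
  have hi : a i ≠ 0 := hi
  have hb' : a = Pi.single i 1 + (a - Pi.single i 1) := by
    ext j
    by_cases hj : j = i
    · subst hj; simp; omega
    · simp [hj]
  refine ⟨i, _, hb', ?_⟩
  conv_rhs => rw [hb']
  simp [Finset.sum_add_distrib]

lemma bdiv {f v : (Fin m → ℝ) → ℝ} (hf : AnalyticAt ℝ f 0) (hv : AnalyticAt ℝ v 0) (hv0 : v 0 ≠ 0) :
    ∀ (N : ℕ) {a b : Fin m → ℕ}, ∑ j, a j = N → (∀ᶠ w in 𝓝 0, bmon a w * f w = bmon b w * v w) →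
    ∃ b', b = a + b' ∧ ∀ᶠ w in 𝓝 0, f w = bmon b' w * v w := by
  intro N
  induction N using Nat.strong_induction_on with
  | _ N ih =>
    intro a b hN h
    by_cases ha : a = 0
    · subst ha
      refine ⟨b, by simp, ?_⟩
      simpa [bmon_zero] using h
    · obtain ⟨i, a', ha', hlt⟩ := exists_pred ha
      obtain ⟨b1, hb1, h1⟩ := bdiv1 (f := fun w => bmon a' w * f w) ((bmon_analytic a' 0).mul hf) hv hv0 (i := i) (b := b) (by
        filter_upwards [h] with w hw
        rw [ha', bmon_add, bmon_single] at hw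
        simp only [pow_one] at hw
        linarith)
      obtain ⟨b', hb', h'⟩ := ih _ (hN ▸ hlt) rfl h1
      exact ⟨b', by rw [hb1, hb', ha']; abel, h'⟩

lemma bmono_congr {f h : (Fin m → ℝ) → ℝ} (H : ∀ᶠ w in 𝓝 0, f w = h w) (hh : BMono h) : BMono f := by
  obtain ⟨a, u, h1, h2, h3⟩ := hh
  refine ⟨a, u, h1, h2, ?_⟩
  filter_upwards [H, h3] with w hw hw'
  rw [hw, hw']

lemma bmono_mul {f h : (Fin m → ℝ) → ℝ} (hf : BMono f) (hh : BMono h) : BMono (fun w => f w * h w) := by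
  obtain ⟨a, u, h1, h2, h3⟩ := hf
  obtain ⟨b, v, g1, g2, g3⟩ := hh
  refine ⟨a + b, fun w => u w * v w, h1.mul g1, mul_ne_zero h2 g2, ?_⟩
  filter_upwards [h3, g3] with w hw hw'
  rw [hw, hw', bmon_add]; ring

lemma bmono_unit {u : (Fin m → ℝ) → ℝ} (h1 : AnalyticAt ℝ u 0) (h2 : u 0 ≠ 0) : BMono u :=
  ⟨0, u, h1, h2, by simp [bmon_zero]⟩

lemma bmono_mon (a : Fin m → ℕ) : BMono (bmon a) :=
  ⟨a, fun _ => 1, analyticAt_const, one_ne_zero, by simp⟩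

lemma bmono_coord (i : Fin m) : BMono (fun w : Fin m → ℝ => w i) :=
  ⟨Pi.single i 1, fun _ => 1, analyticAt_const, one_ne_zero, by simp [bmon_single]⟩

lemma bmono_pow {f : (Fin m → ℝ) → ℝ} (hf : BMono f) (k : ℕ) : BMono (fun w => f w ^ k) := by
  induction k with
  | zero => simpa using bmono_unit (m := m) (u := fun _ => 1) analyticAt_const one_ne_zero
  | succ k ih => simp only [pow_succ]; exact bmono_mul ih hf

lemma bmono_prod {κ : Type*} (s : Finset κ) {f : κ → (Fin m → ℝ) → ℝ} (hf : ∀ k ∈ s, BMono (f k)) :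
    BMono (fun w => ∏ k ∈ s, f k w) := by
  classical
  induction s using Finset.induction_on with
  | empty => simpa using bmono_unit (m := m) (u := fun _ => 1) analyticAt_const one_ne_zero
  | insert a s ha ih =>
    simp only [Finset.prod_insert ha]
    exact bmono_mul (hf a (by simp)) (ih fun k hk => hf k (by simp [hk]))

lemma bmono_ne_zero {f : (Fin m → ℝ) → ℝ} (hf : BMono f) : ¬ ∀ᶠ w in 𝓝 0, f w = 0 := by
  obtain ⟨a, u, h1, h2, h3⟩ := hf
  intro h
  obtain ⟨w, ⟨⟨hw1, hw2⟩, hw3⟩, _, h4⟩ := test_pt ((h.and h3).and (h1.continuousAt.eventually_ne h2)) (fun _ => False)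
  rw [hw2] at hw1
  exact mul_ne_zero (bmon_ne fun i _ => h4 i (by simp)) hw3 hw1

lemma bmono_of_mul_aux (N : ℕ) : ∀ {f h v : (Fin m → ℝ) → ℝ} {b : Fin m → ℕ}, ∑ j, b j = N →
    AnalyticAt ℝ f 0 → AnalyticAt ℝ h 0 → AnalyticAt ℝ v 0 → v 0 ≠ 0 →
    (∀ᶠ w in 𝓝 0, f w * h w = bmon b w * v w) → BMono f := by
  induction N using Nat.strong_induction_on with
  | _ N ih =>
    intro f h v b hN hf hh hv hv0 H
    by_cases hb : b = 0
    · subst hb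
      refine bmono_unit hf ?_
      have := H.self_of_nhds
      rw [bmon_zero, one_mul] at this
      intro h0
      rw [h0, zero_mul] at this
      exact hv0 this.symm
    · obtain ⟨i, b', hb', hlt⟩ := exists_pred hb
      let ℓ := ContinuousLinearMap.proj (R := ℝ) (φ := fun _ : Fin m => ℝ) i
      let e : Fin m → ℝ := Pi.single i 1
      let π : (Fin m → ℝ) →L[ℝ] (Fin m → ℝ) := ContinuousLinearMap.id ℝ _ - ℓ.smulRight e
      have hπ : ∀ x, π x = x - ℓ x • e := fun x => by simp [π]
      have hπ0 : Tendsto π (𝓝 0) (𝓝 0) := by simpa using π.continuous.tendsto 0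
      have hπi : ∀ x, π x i = 0 := by intro x; simp [hπ, ℓ, e]
      have key : ∀ {f : (Fin m → ℝ) → ℝ}, AnalyticAt ℝ f 0 → (∀ᶠ w in 𝓝 0, f (π w) = 0) →
          ∃ f1 : (Fin m → ℝ) → ℝ, AnalyticAt ℝ f1 0 ∧ ∀ᶠ w in 𝓝 0, f w = w i * f1 w := by
        intro f hf h0
        obtain ⟨f1, hf1, h1⟩ := aux_div f hf ℓ e
        refine ⟨f1, hf1, ?_⟩
        filter_upwards [h0, h1] with w hw hw1
        rw [hw1, ← hπ, hw, zero_add]; rfl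
      have hA : ∀ {f : (Fin m → ℝ) → ℝ}, AnalyticAt ℝ f 0 → AnalyticAt ℝ (fun w => f (π w)) 0 := by
        intro f hf
        exact AnalyticAt.fun_comp (g := f) (f := π) (by simpa using hf) (π.analyticAt 0)
      have := aux_nzd (fun w => f (π w)) (fun w => h (π w)) (hA hf) (hA hh) (by
        filter_upwards [hπ0.eventually H] with w hw
        rw [hw, bmon_eq_zero i _ (hπi w), zero_mul]
        rw [hb']; simp)
      rcases this with h0 | h0
      · obtain ⟨f1, hf1, h1⟩ := key hf h0
        obtain ⟨b2, hb2, h2⟩ := bdiv1 (f := fun w => f1 w * h w) (hf1.mul hh) hv hv0 (i := i) (b := b) (by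
          filter_upwards [H, h1] with w hw hw1
          rw [← hw, hw1]; ring)
        have : b2 = b' := by
          rw [hb'] at hb2; exact (add_left_cancel hb2).symm
        subst this
        have := ih _ (hN ▸ hlt) rfl hf1 hh hv hv0 h2
        exact bmono_congr h1 (bmono_mul (bmono_coord i) this)
      · obtain ⟨f1, hf1, h1⟩ := key hh h0
        obtain ⟨b2, hb2, h2⟩ := bdiv1 (f := fun w => f w * f1 w) (hf.mul hf1) hv hv0 (i := i) (b := b) (by
          filter_upwards [H, h1] with w hw hw1
          rw [← hw, hw1]; ring)
        have : b2 = b' := by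
          rw [hb'] at hb2; exact (add_left_cancel hb2).symm
        subst this
        exact ih _ (hN ▸ hlt) rfl hf hf1 hv hv0 h2

lemma bmono_of_mul {f h : (Fin m → ℝ) → ℝ} (hf : AnalyticAt ℝ f 0) (hh : AnalyticAt ℝ h 0)
    (H : BMono (fun w => f w * h w)) : BMono f := by
  obtain ⟨b, v, h1, h2, h3⟩ := H
  exact bmono_of_mul_aux _ rfl hf hh h1 h2 h3

lemma bmono_of_prod {κ : Type*} {s : Finset κ} {f : κ → (Fin m → ℝ) → ℝ}
    (hf : ∀ k ∈ s, AnalyticAt ℝ (f k) 0)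
    (H : BMono (fun w => ∏ k ∈ s, f k w)) {k : κ} (hk : k ∈ s) : BMono (f k) := by
  classical
  refine bmono_of_mul (h := fun w => ∏ j ∈ s.erase k, f j w) (hf k hk)
    (Finset.analyticAt_fun_prod _ fun j hj => hf j (Finset.mem_of_mem_erase hj)) ?_
  have : (fun w => f k w * ∏ j ∈ s.erase k, f j w) = fun w => ∏ k ∈ s, f k w := by
    ext w; exact Finset.mul_prod_erase s (fun j => f j w) hk
  rwa [this]

lemma order_lemma {a b : Fin m → ℕ} {u v : (Fin m → ℝ) → ℝ} (hu : AnalyticAt ℝ u 0) (hu0 : u 0 ≠ 0)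
    (hv : AnalyticAt ℝ v 0) (hv0 : v 0 ≠ 0)
    (H : BMono (fun w => bmon a w * u w - bmon b w * v w) ∨
      ∀ᶠ w in 𝓝 0, bmon a w * u w - bmon b w * v w = 0) : a ≤ b ∨ b ≤ a := by
  rcases H with ⟨c, e, he, he0, h⟩ | h
  · by_contra hcon
    push Not at hcon
    obtain ⟨hab, hba⟩ := hcon
    obtain ⟨j, hj⟩ := not_forall.1 hab
    obtain ⟨i, hi⟩ := not_forall.1 hba
    have hda : a = (a ⊓ b) + (a - a ⊓ b) := by ext l; simp
    have hdb : b = (a ⊓ b) + (b - a ⊓ b) := by ext l; simp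
    set a' := a - a ⊓ b with ha'
    set b' := b - a ⊓ b with hb'
    have hab' : ∀ l, a' l = 0 ∨ b' l = 0 := by intro l; simp [ha', hb']; omega
    have hj' : 0 < a' j := by simp [ha'] at *; omega
    have hi' : 0 < b' i := by simp [hb'] at *; omega
    obtain ⟨c', hc', h1⟩ := bdiv (f := fun w => bmon a' w * u w - bmon b' w * v w)
      (((bmon_analytic _ 0).mul hu).sub ((bmon_analytic _ 0).mul hv)) he he0 _ (a := a ⊓ b) (b := c) rfl (by
        filter_upwards [h] with w hw
        have e1 : bmon a w = bmon (a ⊓ b) w * bmon a' w := by rw [← bmon_add, ← hda]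
        have e2 : bmon b w = bmon (a ⊓ b) w * bmon b' w := by rw [← bmon_add, ← hdb]
        simp only [e1, e2] at hw
        linear_combination hw)
    have hc0 : c' ≠ 0 := by
      rintro rfl
      have := h1.self_of_nhds
      rw [bmon_eq_zero j hj' rfl, bmon_eq_zero i hi' rfl, bmon_zero] at this
      simp at this
      exact he0 this.symm
    obtain ⟨l, hl⟩ := Function.ne_iff.1 hc0
    have hl : 0 < c' l := Nat.pos_of_ne_zero hl
    have hE := h1.and ((hu.continuousAt.eventually_ne hu0).and (hv.continuousAt.eventually_ne hv0))
    rcases Nat.eq_zero_or_pos (b' l) with hb0 | hb0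
    · rcases Nat.eq_zero_or_pos (a' l) with ha0 | ha0
      · obtain ⟨w, ⟨hw, hwu, hwv⟩, s1, s2⟩ := test_pt hE (fun q => q = l ∨ q = i)
        rw [bmon_eq_zero l hl (s1 l (by simp)), bmon_eq_zero i hi' (s1 i (by simp))] at hw
        refine mul_ne_zero (bmon_ne (a := a') fun q hq => s2 q ?_) hwu (by linarith)
        rintro (rfl | rfl)
        · omega
        · have := hab' q; omega
      · obtain ⟨w, ⟨hw, hwu, hwv⟩, s1, s2⟩ := test_pt hE (fun q => q = l)
        rw [bmon_eq_zero l hl (s1 l rfl), bmon_eq_zero l ha0 (s1 l rfl)] at hw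
        refine mul_ne_zero (bmon_ne (a := b') fun q hq => s2 q ?_) hwv (by linarith)
        rintro rfl
        omega
    · obtain ⟨w, ⟨hw, hwu, hwv⟩, s1, s2⟩ := test_pt hE (fun q => q = l)
      rw [bmon_eq_zero l hl (s1 l rfl), bmon_eq_zero l hb0 (s1 l rfl)] at hw
      refine mul_ne_zero (bmon_ne (a := a') fun q hq => s2 q ?_) hwu (by linarith)
      rintro rfl
      have := hab' q; omega
  · obtain ⟨b', hb', _⟩ := bdiv (f := u) hu hv hv0 _ (a := a) (b := b) rfl (by
      filter_upwards [h] with w hw; linarith)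
    left; rw [hb']; exact le_self_add
end P2

open Filter Topology

section P3
variable {E F G : Type*} [NormedAddCommGroup E] [NormedSpace ℝ E]
  [NormedAddCommGroup F] [NormedSpace ℝ F] [NormedAddCommGroup G] [NormedSpace ℝ G]

lemma acomp {g : F → G} {f : E → F} (hg : AnalyticAt ℝ g 0) (hf : AnalyticAt ℝ f 0) (h0 : f 0 = 0) :
    AnalyticAt ℝ (fun x => g (f x)) 0 :=
  AnalyticAt.fun_comp (by rwa [h0]) hf

lemma etend {f : E → F} (hf : AnalyticAt ℝ f 0) (h0 : f 0 = 0) : Tendsto f (𝓝 0) (𝓝 0) := by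
  have := hf.continuousAt.tendsto
  rwa [h0] at this

/-- vertical derivative -/
noncomputable def vD (f : E × ℝ → ℝ) : E × ℝ → ℝ := fun p => fderiv ℝ f p (0, 1)

lemma vD_an {f : E × ℝ → ℝ} {x} (hf : AnalyticAt ℝ f x) : AnalyticAt ℝ (vD f) x := by
  have h : AnalyticAt ℝ (fderiv ℝ f) x := hf.fderiv
  exact ((ContinuousLinearMap.apply ℝ ℝ ((0, 1) : E × ℝ)).analyticAt _).fun_comp h

lemma vD_iter_an {f : E × ℝ → ℝ} {x} (hf : AnalyticAt ℝ f x) (j : ℕ) : AnalyticAt ℝ (vD^[j] f) x := by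
  induction j with
  | zero => simpa
  | succ j ih => rw [Function.iterate_succ_apply']; exact vD_an ih

lemma vD_congr {f g : E × ℝ → ℝ} {x} (h : f =ᶠ[𝓝 x] g) : vD f =ᶠ[𝓝 x] vD g := by
  have h2 : fderiv ℝ f =ᶠ[𝓝 x] fderiv ℝ g := Filter.EventuallyEq.fderiv h
  filter_upwards [h2] with p hp
  simp [vD, hp]

lemma vD_iter_step {c : E → ℝ} {f f1 : E × ℝ → ℝ} (hc : AnalyticAt ℝ c 0) (hf1 : AnalyticAt ℝ f1 0)
    (h : ∀ᶠ p in 𝓝 (0 : E × ℝ), f p = c p.1 + p.2 * f1 p) (j : ℕ) :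
    ∀ᶠ p in 𝓝 (0 : E × ℝ), (vD^[j+1] f) p = p.2 * (vD^[j+1] f1) p + (j+1) * (vD^[j] f1) p := by
  induction j with
  | zero =>
    have h' : vD f =ᶠ[𝓝 0] vD (fun p => c p.1 + p.2 * f1 p) := vD_congr h
    have hc' : AnalyticAt ℝ (fun p : E × ℝ => c p.1) 0 := acomp hc analyticAt_fst rfl
    filter_upwards [h', hf1.eventually_analyticAt, (show ∀ᶠ p : E × ℝ in 𝓝 0, AnalyticAt ℝ c p.1 from
      (continuous_fst.tendsto' (0 : E × ℝ) 0 rfl).eventually hc.eventually_analyticAt)] with p hp h1 h2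
    simp only [Function.iterate_zero, id, Function.iterate_one, zero_add, hp]
    have hA : HasFDerivAt (fun p : E × ℝ => c p.1) _ p :=
      h2.differentiableAt.hasFDerivAt.comp p hasFDerivAt_fst
    have hB := (hasFDerivAt_snd (𝕜 := ℝ) (p := p)).mul h1.differentiableAt.hasFDerivAt
    have hC := (hA.add hB).fderiv
    have hC' : fderiv ℝ (fun p : E × ℝ => c p.1 + p.2 * f1 p) p = _ := hC
    simp only [vD, hC']
    simp
  | succ j ih =>
    have h' := vD_congr ih
    filter_upwards [h', hf1.eventually_analyticAt] with p hp h1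
    rw [Function.iterate_succ_apply', hp]
    have hB := (hasFDerivAt_snd (𝕜 := ℝ) (p := p)).mul (vD_iter_an h1 (j+1)).differentiableAt.hasFDerivAt
    have hA := ((vD_iter_an h1 j).differentiableAt.hasFDerivAt).const_mul ((j:ℝ)+1)
    have hC' : fderiv ℝ (fun p : E × ℝ => p.2 * (vD^[j+1] f1) p + (j+1) * (vD^[j] f1) p) p = _ := (hB.add hA).fderiv
    simp only [vD, hC']
    rw [Function.iterate_succ_apply' _ (j+1)]
    have : fderiv ℝ (vD^[j] f1) p (0,1) = (vD^[j+1] f1) p := by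
      rw [Function.iterate_succ_apply']; rfl
    simp [this]
    have : fderiv ℝ (vD (vD^[j] f1)) p (0,1) = (vD (vD^[j+1] f1)) p := by
      rw [Function.iterate_succ_apply']; rfl
    simp [vD] at *
    ring

lemma exp0 (k : ℕ) : ∀ (f : E × ℝ → ℝ), AnalyticAt ℝ f 0 →
    ∃ (c : ℕ → E → ℝ) (U : E × ℝ → ℝ), (∀ j, AnalyticAt ℝ (c j) 0) ∧ AnalyticAt ℝ U 0 ∧
      (∀ᶠ p in 𝓝 (0 : E × ℝ), f p = ∑ j ∈ Finset.range k, c j p.1 * p.2 ^ j + p.2 ^ k * U p) ∧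
      (∀ j < k, ∀ᶠ z in 𝓝 (0:E), (vD^[j] f) (z, 0) = j.factorial * c j z) ∧
      (∀ᶠ z in 𝓝 (0:E), (vD^[k] f) (z, 0) = k.factorial * U (z, 0)) := by
  induction k with
  | zero =>
    intro f hf
    exact ⟨fun _ _ => 0, f, fun _ => analyticAt_const, hf, by simp, by simp, by simp⟩
  | succ k ih =>
    intro f hf
    obtain ⟨f1, hf1, h1⟩ := aux_div f hf (ContinuousLinearMap.snd ℝ E ℝ) (0, 1)
    have h1' : ∀ᶠ p in 𝓝 (0 : E × ℝ), f p = (fun z => f (z, 0)) p.1 + p.2 * f1 p := by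
      filter_upwards [h1] with p hp
      rw [hp]
      congr 2
      ext <;> simp
    have hi : AnalyticAt ℝ (fun z : E => (z, (0:ℝ))) 0 := analyticAt_id.prod analyticAt_const
    have hc0 : AnalyticAt ℝ (fun z => f (z, 0)) 0 := acomp hf hi rfl
    obtain ⟨c, U, hc, hU, he, hd, hdk⟩ := ih f1 hf1
    have hst : ∀ j, ∀ᶠ z in 𝓝 (0:E), (vD^[j+1] f) (z, 0) = (j+1) * (vD^[j] f1) (z,0) := by
      intro j
      filter_upwards [(etend hi rfl).eventually (vD_iter_step hc0 hf1 h1' j)] with z hz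
      rw [hz]; simp
    refine ⟨fun j => Nat.casesOn j (fun z => f (z, 0)) c, U, ?_, hU, ?_, ?_, ?_⟩
    · rintro (_ | j)
      · exact hc0
      · exact hc j
    · filter_upwards [h1', he] with p hp hp2
      rw [hp, Finset.sum_range_succ', hp2]
      show f (p.1, 0) + p.2 * (∑ j ∈ Finset.range k, c j p.1 * p.2 ^ j + p.2 ^ k * U p) =
        ∑ j ∈ Finset.range k, c j p.1 * p.2 ^ (j+1) + f (p.1, 0) * p.2 ^ 0 + p.2 ^ (k+1) * U p
      rw [mul_add, Finset.mul_sum]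
      rw [Finset.sum_congr rfl (fun j _ => show p.2 * (c j p.1 * p.2 ^ j) = c j p.1 * p.2 ^ (j+1) by ring)]
      ring
    · rintro (_ | j) hj
      · simp
      · filter_upwards [hst j, hd j (by omega)] with z hz hz2
        rw [hz, hz2]; push_cast [Nat.factorial_succ]; ring
    · filter_upwards [hst k, hdk] with z hz hz2
      rw [hz, hz2]; push_cast [Nat.factorial_succ]; ring

lemma poly_uniq (k : ℕ) : ∀ (a : ℕ → ℝ) (V : ℝ → ℝ), ContinuousAt V 0 →
    (∀ᶠ t in 𝓝[≠] (0:ℝ), ∑ j ∈ Finset.range k, a j * t ^ j + t ^ k * V t = 0) →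
    (∀ j < k, a j = 0) ∧ V 0 = 0 := by
  induction k with
  | zero =>
    intro a V hV h
    refine ⟨by simp, ?_⟩
    have h1 : Tendsto V (𝓝[≠] 0) (𝓝 (V 0)) := tendsto_nhdsWithin_of_tendsto_nhds hV
    have h2 : Tendsto V (𝓝[≠] 0) (𝓝 0) := by
      refine tendsto_const_nhds.congr' ?_
      filter_upwards [h] with t ht
      simpa using ht.symm
    exact tendsto_nhds_unique h1 h2
  | succ k ih =>
    intro a V hV h
    have hW : ContinuousAt (fun t : ℝ => ∑ j ∈ Finset.range (k+1), a j * t ^ j + t ^ (k+1) * V t) 0 := by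
      fun_prop
    have h1 := (tendsto_nhdsWithin_of_tendsto_nhds (s := {0}ᶜ) hW.tendsto)
    have h2 := h1.congr' h
    have h0 : a 0 = 0 := by
      have := tendsto_nhds_unique h2 tendsto_const_nhds
      rw [Finset.sum_range_succ'] at this
      simpa using this
    have := ih (fun j => a (j+1)) V hV (by
      filter_upwards [h, self_mem_nhdsWithin] with t ht ht0
      rw [Finset.sum_range_succ', h0] at ht
      have : t * (∑ j ∈ Finset.range k, a (j+1) * t ^ j + t ^ k * V t) = 0 := by
        rw [← ht, mul_add, Finset.mul_sum]
        rw [Finset.sum_congr rfl (fun j _ => show t * (a (j+1) * t ^ j) = a (j+1) * (t ^ (j+1)) by ring)]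
        ring
      exact (mul_eq_zero.1 this).resolve_left ht0)
    refine ⟨?_, this.2⟩
    rintro (_ | j) hj
    · exact h0
    · exact this.1 j (by omega)

lemma exp1 {k : ℕ} {f : E × ℝ → ℝ} {h : ℝ → ℝ} (hh : ContinuousAt h 0)
    (hf : ∀ᶠ t in 𝓝 (0:ℝ), f (0, t) = t ^ k * h t)
    {c : ℕ → E → ℝ} {U : E × ℝ → ℝ} (hU : AnalyticAt ℝ U 0)
    (he : ∀ᶠ p in 𝓝 (0 : E × ℝ), f p = ∑ j ∈ Finset.range k, c j p.1 * p.2 ^ j + p.2 ^ k * U p) :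
    (∀ j < k, c j 0 = 0) ∧ U 0 = h 0 := by
  have hi : AnalyticAt ℝ (fun t : ℝ => ((0:E), t)) 0 := analyticAt_const.prod analyticAt_id
  have hUc : ContinuousAt (fun t : ℝ => U (0, t)) 0 := (acomp hU hi rfl).continuousAt
  obtain ⟨h1, h2⟩ := poly_uniq k (fun j => c j 0) (fun t => U (0, t) - h t) (hUc.sub hh) (by
    apply eventually_nhdsWithin_of_eventually_nhds
    filter_upwards [hf, (etend hi rfl).eventually he] with t h1 h2
    rw [h1] at h2
    linear_combination -h2)
  refine ⟨h1, ?_⟩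
  have : U (0, 0) = h 0 := by linarith
  exact this

lemma tsch [CompleteSpace E] {k : ℕ} {f : E × ℝ → ℝ} (hfa : AnalyticAt ℝ f 0) {h : ℝ → ℝ}
    (hh : ContinuousAt h 0) (h0 : h 0 ≠ 0)
    (hf : ∀ᶠ t in 𝓝 (0:ℝ), f (0, t) = t ^ (k+1) * h t) :
    ∃ (φ : E → ℝ) (c : ℕ → E → ℝ) (U : E × ℝ → ℝ), AnalyticAt ℝ φ 0 ∧ φ 0 = 0 ∧
      (∀ j, AnalyticAt ℝ (c j) 0) ∧ (∀ j < k, c j 0 = 0) ∧ AnalyticAt ℝ U 0 ∧ U 0 ≠ 0 ∧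
      ∀ᶠ p in 𝓝 (0 : E × ℝ), f (p.1, φ p.1 + p.2) =
        ∑ j ∈ Finset.range k, c j p.1 * p.2 ^ j + p.2 ^ (k+1) * U p := by
  obtain ⟨c, U, hc, hU, he, hd, hdk⟩ := exp0 (k+1) f hfa
  obtain ⟨hc0, hU0⟩ := exp1 hh hf hU he
  set Gf := vD^[k] f with hGf
  have hG : AnalyticAt ℝ Gf 0 := vD_iter_an hfa k
  have hG0 : Gf 0 = 0 := by
    have := (hd k (by omega)).self_of_nhds
    rw [hc0 k (by omega), mul_zero] at this
    exact this
  have hGd : fderiv ℝ Gf 0 (0, 1) ≠ 0 := by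
    have := hdk.self_of_nhds
    rw [Function.iterate_succ_apply'] at this
    have h2 : U ((0:E), (0:ℝ)) = h 0 := hU0
    rw [h2] at this
    have h3 : fderiv ℝ Gf 0 (0, 1) = vD (vD^[k] f) (0, 0) := rfl
    rw [h3, this]
    exact mul_ne_zero (by exact_mod_cast Nat.factorial_ne_zero _) h0
  obtain ⟨χ, hχ, hχ0, -, hχr⟩ := aux_inv1 Gf hG hG0 (ContinuousLinearMap.snd ℝ E ℝ) (0, 1) (by simp) hGd
  have hi : AnalyticAt ℝ (fun z : E => (z, (0:ℝ))) 0 := analyticAt_id.prod analyticAt_const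
  let φ : E → ℝ := fun z => (χ (z, 0)).2
  have hφ : AnalyticAt ℝ φ 0 := acomp (g := Prod.snd) analyticAt_snd (acomp hχ hi rfl) hχ0
  have hφ0 : φ 0 = 0 := by
    show (χ 0).2 = 0
    rw [hχ0]; rfl
  have hφG : ∀ᶠ z in 𝓝 (0:E), Gf (z, φ z) = 0 := by
    filter_upwards [(etend hi rfl).eventually hχr] with z hz
    have h1 := congrArg Prod.fst hz
    have h2 := congrArg Prod.snd hz
    simp at h1 h2
    have : (z, φ z) = χ (z, 0) := by ext <;> simp [φ, h1]
    rw [this, h2]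
  let S : E × ℝ → E × ℝ := fun p => (p.1, φ p.1 + p.2)
  have hφ1 : AnalyticAt ℝ (fun p : E × ℝ => φ p.1) 0 := acomp hφ analyticAt_fst rfl
  have hS : AnalyticAt ℝ S 0 := analyticAt_fst.prod (hφ1.add analyticAt_snd)
  have hS0 : S 0 = 0 := by simp [S, hφ0]
  have hit : ∀ j, vD^[j] (fun p => f (S p)) =ᶠ[𝓝 0] fun p => (vD^[j] f) (S p) := by
    intro j
    induction j with
    | zero => simp
    | succ j ih =>
      have := vD_congr ih
      rw [Function.iterate_succ_apply', Function.iterate_succ_apply']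
      refine this.trans ?_
      filter_upwards [(etend hS hS0).eventually (vD_iter_an hfa j).eventually_analyticAt,
        (show ∀ᶠ p : E × ℝ in 𝓝 0, AnalyticAt ℝ φ p.1 from
      (continuous_fst.tendsto' (0 : E × ℝ) 0 rfl).eventually hφ.eventually_analyticAt)] with p hp hp2
      have e1 : HasFDerivAt (fun p : E × ℝ => φ p.1) _ p :=
        hp2.differentiableAt.hasFDerivAt.comp p hasFDerivAt_fst
      have e2 : HasFDerivAt S _ p := (hasFDerivAt_fst (𝕜 := ℝ)).prodMk (e1.add hasFDerivAt_snd)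
      have e3 : fderiv ℝ (fun p => (vD^[j] f) (S p)) p = _ := (hp.differentiableAt.hasFDerivAt.comp p e2).fderiv
      simp only [vD, e3]
      simp
  obtain ⟨c', U', hc', hU', he', hd', hdk'⟩ := exp0 (k+1) (fun p => f (S p)) (acomp hfa hS hS0)
  obtain ⟨hc0', hU0'⟩ := exp1 (f := fun p => f (S p)) hh (by
    filter_upwards [hf] with t ht
    simp [S, hφ0, ht]) hU' he'
  refine ⟨φ, c', U', hφ, hφ0, hc', fun j hj => hc0' j (by omega), hU', by rw [hU0']; exact h0, ?_⟩
  have hck : ∀ᶠ z in 𝓝 (0:E), c' k z = 0 := by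
    filter_upwards [hd' k (by omega), (etend hi rfl).eventually (hit k), hφG] with z h1 h2 h3
    rw [h2] at h1
    simp only [S, add_zero] at h1
    rw [show (vD^[k] f) (z, φ z) = 0 from h3] at h1
    have : (k.factorial : ℝ) ≠ 0 := by exact_mod_cast Nat.factorial_ne_zero _
    exact (mul_eq_zero.1 h1.symm).resolve_left this
  filter_upwards [he', (continuous_fst.tendsto' (0 : E × ℝ) 0 rfl).eventually hck] with p h1 h2
  have h1' : f (p.1, φ p.1 + p.2) = _ := h1
  rw [h1', Finset.sum_range_succ, h2]
  ring
end P3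

open Filter Topology

section P4
variable {ι : Type*} {D E F : Type*} [NormedAddCommGroup D] [NormedSpace ℝ D]
  [NormedAddCommGroup E] [NormedSpace ℝ E]
  [NormedAddCommGroup F] [NormedSpace ℝ F] {U : Ultrafilter ι}

/-- covering of a hyperpoint -/
def Cov (U : Ultrafilter ι) (π : E → F) (q : ι → E) (p : ι → F) : Prop :=
  AnalyticAt ℝ π 0 ∧ π 0 = 0 ∧ Tendsto q U (𝓝 0) ∧ ∀ᶠ i in (U : Filter ι), π (q i) = p i

lemma Cov.comp {π : E → F} {π' : D → E} {q' q p} (h : Cov U π q p) (h' : Cov U π' q' q) :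
    Cov U (fun x => π (π' x)) q' p := by
  obtain ⟨a1, a2, a3, a4⟩ := h
  obtain ⟨b1, b2, b3, b4⟩ := h'
  refine ⟨acomp a1 b1 b2, by simp only [b2, a2], b3, ?_⟩
  filter_upwards [a4, b4] with i h1 h2
  rw [h2, h1]

lemma Cov.tendsto {π : E → F} {q p} (h : Cov U π q p) : Tendsto p U (𝓝 0) := by
  obtain ⟨a1, a2, a3, a4⟩ := h
  exact ((etend a1 a2).comp a3).congr' a4

lemma Cov.et {π : E → F} {q p} (h : Cov U π q p) : Tendsto π (𝓝 0) (𝓝 0) := etend h.1 h.2.1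

/-- local monomialization exists -/
def Good (U : Ultrafilter ι) (m : ℕ) (f : E → ℝ) (p : ι → E) : Prop :=
  ∃ (π : (Fin m → ℝ) → E) (q : ι → Fin m → ℝ), Cov U π q p ∧ BMono (fun w => f (π w))

lemma Good.pull {m : ℕ} {f : F → ℝ} {π : E → F} {p' p} (h : Cov U π p' p)
    (hg : Good U m (fun x => f (π x)) p') : Good U m f p := by
  obtain ⟨π', q, h1, h2⟩ := hg
  exact ⟨_, q, h.comp h1, h2⟩

lemma Good.congr {m : ℕ} {f f' : E → ℝ} {p} (h : ∀ᶠ x in 𝓝 0, f x = f' x) (hg : Good U m f' p) :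
    Good U m f p := by
  obtain ⟨π', q, h1, h2⟩ := hg
  exact ⟨π', q, h1, bmono_congr (h1.et.eventually h) h2⟩

/-- local monomialization in dimension m -/
def LM (U : Ultrafilter ι) (m : ℕ) : Prop :=
  ∀ f : (Fin m → ℝ) → ℝ, AnalyticAt ℝ f 0 → (¬ ∀ᶠ x in 𝓝 0, f x = 0) →
    ∀ p : ι → Fin m → ℝ, Tendsto p U (𝓝 0) → Good U m f p

lemma tail_an {m : ℕ} (x) : AnalyticAt ℝ (fun w : Fin (m+1) → ℝ => (fun i : Fin m => w i.succ)) x := by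
  rw [analyticAt_pi_iff]
  exact fun i => coord_analytic i.succ x

lemma bmono_tail {m : ℕ} {g : (Fin m → ℝ) → ℝ} (h : BMono g) :
    BMono (fun w : Fin (m+1) → ℝ => g (fun i => w i.succ)) := by
  obtain ⟨a, u, h1, h2, h3⟩ := h
  refine ⟨Fin.cons 0 a, fun w => u (fun i => w i.succ), acomp h1 (tail_an 0) rfl, h2, ?_⟩
  filter_upwards [(etend (tail_an (m := m) 0) rfl).eventually h3] with w hw
  rw [hw]
  simp [bmon, Fin.prod_univ_succ]

lemma cov_J {m : ℕ} {z : ι → Fin m → ℝ} {t : ι → ℝ} (hz : Tendsto z U (𝓝 0)) (ht : Tendsto t U (𝓝 0)) :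
    Cov U (fun w : Fin (m+1) → ℝ => ((fun i : Fin m => w i.succ), w 0)) (fun i => Fin.cons (t i) (z i))
      (fun i => (z i, t i)) := by
  refine ⟨(tail_an 0).prod (coord_analytic 0 0), rfl, ?_, by simp⟩
  rw [tendsto_pi_nhds] at hz ⊢
  intro i
  refine Fin.cases ?_ (fun i => ?_) i
  · simpa using ht
  · simpa using hz i

lemma Cov.prod_id {π : E → F} {q p} (h : Cov U π q p) {t : ι → ℝ} (ht : Tendsto t U (𝓝 0)) :
    Cov U (fun x : E × ℝ => (π x.1, x.2)) (fun i => (q i, t i)) (fun i => (p i, t i)) := by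
  obtain ⟨a1, a2, a3, a4⟩ := h
  refine ⟨(acomp (f := Prod.fst) a1 analyticAt_fst rfl).prod analyticAt_snd, by simp [a2], a3.prodMk_nhds ht, ?_⟩
  filter_upwards [a4] with i h
  simp [h]

lemma dich (U : Ultrafilter ι) (a b : ι → ℝ) :
    (∃ (τ0 : ℝ) (r : ι → ℝ), Tendsto r U (𝓝 τ0) ∧ ∀ᶠ i in (U : Filter ι), a i = b i * r i) ∨
    ((∀ᶠ i in (U : Filter ι), a i ≠ 0) ∧ Tendsto (fun i => b i / a i) U (𝓝 0)) := by
  by_cases H : ∃ M : ℝ, ∀ᶠ i in (U : Filter ι), |a i| ≤ M * |b i|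
  · left
    obtain ⟨M, hM⟩ := H
    have h1 : ∀ᶠ i in (U : Filter ι), a i / b i ∈ Set.Icc (-|M|) |M| := by
      filter_upwards [hM] with i hi
      rw [Set.mem_Icc, ← abs_le, abs_div]
      refine div_le_of_le_mul₀ (abs_nonneg _) (abs_nonneg _) (hi.trans ?_)
      gcongr
      exact le_abs_self M
    obtain ⟨τ0, -, h2⟩ := isCompact_Icc.ultrafilter_le_nhds (U.map (fun i => a i / b i))
      (by rw [le_principal_iff]; exact h1)
    refine ⟨τ0, fun i => a i / b i, h2, ?_⟩
    filter_upwards [hM] with i hi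
    by_cases hb : b i = 0
    · simp [hb] at hi ⊢; exact hi
    · field_simp
  · right
    push Not at H
    have H' : ∀ M : ℝ, ∀ᶠ i in (U : Filter ι), M * |b i| < |a i| := by
      exact H
    refine ⟨?_, ?_⟩
    · filter_upwards [H' 0] with i hi
      simpa using hi
    · rw [Metric.tendsto_nhds]
      intro ε hε
      filter_upwards [H' (1/ε)] with i hi
      have h0 : 0 < |a i| := lt_of_le_of_lt (by positivity) hi
      rw [dist_zero_right, Real.norm_eq_abs, abs_div, div_lt_iff₀ h0]
      rw [div_mul_eq_mul_div, one_mul, div_lt_iff₀ hε] at hi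
      linarith

lemma toric (U : Ultrafilter ι) (m N : ℕ) : ∀ (β : Fin m → ℕ), ∑ j, β j = N →
    ∀ (v : ι → Fin m → ℝ) (t : ι → ℝ), Tendsto v U (𝓝 0) → Tendsto t U (𝓝 0) →
    (∀ᶠ i in (U : Filter ι), t i ≠ 0) → Tendsto (fun i => bmon β (v i) / t i) U (𝓝 0) →
    ∃ (π : (Fin (m+1) → ℝ) → (Fin m → ℝ) × ℝ) (q : ι → Fin (m+1) → ℝ),
      Cov U π q (fun i => (v i, t i)) ∧ (∀ i, BMono (fun w => (π w).1 i)) ∧ BMono (fun w => (π w).2) ∧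
      ∃ σ : (Fin (m+1) → ℝ) → ℝ, AnalyticAt ℝ σ 0 ∧
        ∀ᶠ w in 𝓝 0, bmon β (π w).1 = (π w).2 * σ w := by
  induction N using Nat.strong_induction_on with
  | _ N ih =>
  intro β hβ v t hv ht ht0 hr
  by_cases hβ0 : β = 0
  · exfalso
    subst hβ0
    have h1 := hr.mul ht
    rw [mul_zero] at h1
    have h2 : Tendsto (fun _ : ι => (1:ℝ)) U (𝓝 0) := by
      refine h1.congr' ?_
      filter_upwards [ht0] with i hi
      simp [bmon_zero, hi]
    exact one_ne_zero (tendsto_nhds_unique tendsto_const_nhds h2)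
  obtain ⟨l, β', hb, hlt⟩ := exists_pred hβ0
  rcases dich U (fun i => v i l) t with ⟨τ0, r, hr0, hvr⟩ | ⟨hv0, htv⟩
  · let π : (Fin (m+1) → ℝ) → (Fin m → ℝ) × ℝ := fun w =>
      (fun i => if i = l then w 0 * (τ0 + w l.succ) else w i.succ, w 0)
    have hπ1 : AnalyticAt ℝ (fun w : Fin (m+1) → ℝ => τ0 + w l.succ) 0 :=
      analyticAt_const.add (coord_analytic _ _)
    have hπi : ∀ i, AnalyticAt ℝ (fun w => (π w).1 i) 0 := by
      intro i
      by_cases h : i = l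
      · simp only [π, h, if_true]
        exact (coord_analytic _ _).mul hπ1
      · simp only [π, h, if_false]
        exact coord_analytic _ _
    have hπf : AnalyticAt ℝ (fun w => (π w).1) 0 := analyticAt_pi_iff.2 hπi
    have hπ0 : π 0 = 0 := by
      ext i <;> simp [π]
    refine ⟨π, fun i => Fin.cons (t i) (fun j => if j = l then r i - τ0 else v i j), ⟨hπf.prod (coord_analytic _ _), hπ0, ?_, ?_⟩, ?_, ?_, ?_⟩
    · rw [tendsto_pi_nhds] at hv ⊢
      intro i
      refine Fin.cases ?_ (fun i => ?_) i
      · simpa using ht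
      · by_cases h : i = l
        · simp only [h, Fin.cons_succ, if_true]
          simpa using hr0.sub_const τ0
        · simpa [h] using hv i
    · filter_upwards [hvr] with i hi
      ext j
      · by_cases h : j = l
        · subst h; simp [π, hi]
        · simp [π, h]
      · simp [π]
    · intro i
      by_cases h : i = l
      · simp only [π, h, if_true]
        refine bmono_mul (bmono_coord 0) ?_
        by_cases hτ : τ0 = 0
        · simpa [hτ] using bmono_coord l.succ
        · exact bmono_unit hπ1 (by simpa using hτ)
      · simpa only [π, h, if_false] using bmono_coord i.succ
    · exact bmono_coord 0
    · refine ⟨fun w => (τ0 + w l.succ) * bmon β' (π w).1, hπ1.mul (AnalyticAt.fun_comp (bmon_analytic _ _) hπf), ?_⟩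
      refine Eventually.of_forall fun w => ?_
      rw [hb, bmon_add, bmon_single]
      simp [π]
      ring
  · obtain ⟨π, q, hC, h1, h2, σ, hσ, h3⟩ := ih _ (hβ ▸ hlt) β' rfl v (fun i => t i / v i l) hv htv
      (by filter_upwards [ht0, hv0] with i a b using div_ne_zero a b)
      (by
        refine hr.congr' ?_
        filter_upwards [ht0, hv0] with i a b
        rw [hb, bmon_add, bmon_single]
        field_simp)
    have hA : Cov U (fun p : (Fin m → ℝ) × ℝ => (p.1, p.1 l * p.2)) (fun i => (v i, t i / v i l))
        (fun i => (v i, t i)) := by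
      refine ⟨analyticAt_fst.prod (AnalyticAt.mul ?_ analyticAt_snd), by simp, hv.prodMk_nhds htv, ?_⟩
      · exact AnalyticAt.fun_comp (coord_analytic l _) analyticAt_fst
      · filter_upwards [hv0] with i hi
        ext
        · rfl
        · simp; field_simp
    refine ⟨_, q, hA.comp hC, h1, bmono_mul (h1 l) h2, σ, hσ, ?_⟩
    filter_upwards [h3] with w hw
    rw [hb, bmon_add, bmon_single, hw]
    ring

lemma powsub (U : Ultrafilter ι) {m : ℕ} (z : ι → Fin m → ℝ) (hz : Tendsto z U (𝓝 0)) {N : ℕ} (hN : N ≠ 0) :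
    ∃ (s : Fin m → ℝ) (v : ι → Fin m → ℝ), (∀ i, s i ≠ 0) ∧
      Cov U (fun w : Fin m → ℝ => fun i => s i * w i ^ N) v z := by
  have h : ∀ l, ∃ s : ℝ, s ≠ 0 ∧ ∀ᶠ i in (U : Filter ι), s * |z i l| = z i l := by
    intro l
    rcases Ultrafilter.eventually_or.1 (Eventually.of_forall (f := (U : Filter ι)) fun i => le_total 0 (z i l)) with h | h
    · exact ⟨1, one_ne_zero, by filter_upwards [h] with i hi; rw [abs_of_nonneg hi, one_mul]⟩
    · exact ⟨-1, by norm_num, by filter_upwards [h] with i hi; rw [abs_of_nonpos hi]; ring⟩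
  choose s hs hsz using h
  refine ⟨s, fun i l => |z i l| ^ ((N:ℝ)⁻¹), hs, ?_, ?_, ?_, ?_⟩
  · rw [analyticAt_pi_iff]
    exact fun i => analyticAt_const.mul ((coord_analytic i 0).pow N)
  · ext i; simp [hN]
  · rw [tendsto_pi_nhds] at hz ⊢
    intro l
    have h1 : Tendsto (fun i => |z i l|) U (𝓝 0) := by simpa using (hz l).abs
    have h2 : Tendsto (fun x : ℝ => x ^ ((N:ℝ)⁻¹)) (𝓝 0) (𝓝 0) := by
      have := (Real.continuousAt_rpow_const 0 ((N:ℝ)⁻¹) (Or.inr (by positivity))).tendsto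
      rwa [Real.zero_rpow (by positivity)] at this
    exact h2.comp h1
  · filter_upwards [eventually_all.2 hsz] with i hi
    ext l
    rw [Real.rpow_inv_natCast_pow (abs_nonneg _) hN, hi l]

lemma bmon_pow_sub {m : ℕ} (a : Fin m → ℕ) (s w : Fin m → ℝ) (N : ℕ) :
    bmon a (fun i => s i * w i ^ N) = bmon a s * bmon (N • a) w := by
  rw [bmon_smul]
  simp [bmon, mul_pow, Finset.prod_mul_distrib, ← Finset.prod_pow, ← pow_mul, mul_comm]
end P4

open Filter Topology

section P5
variable {ι : Type*} {U : Ultrafilter ι}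

lemma bmono_pow_sub {m : ℕ} {f : (Fin m → ℝ) → ℝ} (hf : BMono f) {s : Fin m → ℝ} (hs : ∀ i, s i ≠ 0) {N : ℕ}
    (hN : N ≠ 0) : BMono (fun w => f (fun i => s i * w i ^ N)) := by
  obtain ⟨a, u, h1, h2, h3⟩ := hf
  have hS : AnalyticAt ℝ (fun w : Fin m → ℝ => fun i => s i * w i ^ N) 0 := by
    rw [analyticAt_pi_iff]
    exact fun i => analyticAt_const.mul ((coord_analytic i 0).pow N)
  have hS0 : (fun i => s i * (0 : Fin m → ℝ) i ^ N) = 0 := by ext i; simp [hN]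
  refine ⟨N • a, fun w => bmon a s * u (fun i => s i * w i ^ N), analyticAt_const.mul (acomp h1 hS hS0), ?_, ?_⟩
  · simp only [hS0]
    exact mul_ne_zero (bmon_ne fun i _ => hs i) h2
  · filter_upwards [(etend hS hS0).eventually h3] with w hw
    rw [hw, bmon_pow_sub]; ring

lemma prep {m : ℕ} (hLM : LM U m) {k : ℕ} (c : ℕ → (Fin m → ℝ) → ℝ) (hc : ∀ j, AnalyticAt ℝ (c j) 0)
    (hc0 : ∀ j < k, c j 0 = 0) (hne : ∃ j < k, ¬ ∀ᶠ z in 𝓝 0, c j z = 0)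
    (g : (Fin m → ℝ) → ℝ) (hg : AnalyticAt ℝ g 0) (hg0 : ¬ ∀ᶠ z in 𝓝 0, g z = 0)
    (z : ι → Fin m → ℝ) (hz : Tendsto z U (𝓝 0)) :
    ∃ (π : (Fin m → ℝ) → (Fin m → ℝ)) (z' : ι → Fin m → ℝ) (β : Fin m → ℕ) (ch : ℕ → (Fin m → ℝ) → ℝ),
      Cov U π z' z ∧ β ≠ 0 ∧ (∀ j, AnalyticAt ℝ (ch j) 0) ∧
      (∀ j < k, ∀ᶠ v in 𝓝 0, c j (π v) = bmon β v ^ (k+1-j) * ch j v) ∧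
      (∃ j < k, ch j 0 ≠ 0) ∧ BMono (fun v => g (π v)) := by
  classical
  set J := (Finset.range k).filter (fun j => ¬ ∀ᶠ z in 𝓝 0, c j z = 0) with hJ
  set N := (k+1).factorial with hNdef
  have hN : N ≠ 0 := Nat.factorial_ne_zero _
  let e : ℕ → ℕ := fun j => N / (k+1-j)
  have he : ∀ j < k, (k+1-j) * e j = N := fun j hj =>
    Nat.mul_div_cancel' (Nat.dvd_factorial (by omega) (by omega))
  have hJk : ∀ j ∈ J, j < k := fun j hj => by simpa using (Finset.mem_filter.1 hj).1
  let d : ℕ × ℕ → (Fin m → ℝ) → ℝ := fun q z => c q.1 z ^ e q.1 - c q.2 z ^ e q.2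
  have hd : ∀ q, AnalyticAt ℝ (d q) 0 := fun q => ((hc _).pow _).sub ((hc _).pow _)
  set P := (J ×ˢ J).filter (fun q => ¬ ∀ᶠ z in 𝓝 0, d q z = 0) with hP
  have hA : AnalyticAt ℝ (fun z => ∏ j ∈ J, c j z) 0 := Finset.analyticAt_fun_prod _ fun j _ => hc j
  have hB : AnalyticAt ℝ (fun z => ∏ q ∈ P, d q z) 0 := Finset.analyticAt_fun_prod _ fun j _ => hd j
  obtain ⟨π, q, hC, hM⟩ := hLM (fun z => g z * ((∏ j ∈ J, c j z) * ∏ q ∈ P, d q z)) (hg.mul (hA.mul hB))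
    (by
      intro h
      rcases aux_nzd _ _ hg (hA.mul hB) h with h | h
      · exact hg0 h
      · rcases aux_nzd _ _ hA hB h with h | h
        · exact aux_nzd_prod _ _ (fun j _ => hc j) (fun j hj => (Finset.mem_filter.1 hj).2) h
        · exact aux_nzd_prod _ _ (fun j _ => hd j) (fun j hj => (Finset.mem_filter.1 hj).2) h) z hz
  obtain ⟨hπ, hπ0, -, -⟩ := id hC
  have hAπ : AnalyticAt ℝ (fun w => ∏ j ∈ J, c j (π w)) 0 := acomp (g := fun z => ∏ j ∈ J, c j z) hA hπ hπ0
  have hBπ : AnalyticAt ℝ (fun w => ∏ q ∈ P, d q (π w)) 0 := acomp (g := fun z => ∏ q ∈ P, d q z) hB hπ hπ0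
  have hgM : BMono (fun w => g (π w)) := bmono_of_mul (acomp hg hπ hπ0) (acomp (hA.mul hB) hπ hπ0) hM
  have hM2 : BMono (fun w => (∏ j ∈ J, c j (π w)) * ∏ q ∈ P, d q (π w)) :=
    bmono_of_mul (h := fun w => g (π w)) (acomp (hA.mul hB) hπ hπ0) (acomp hg hπ hπ0)
      (bmono_congr (Eventually.of_forall fun w => mul_comm _ _) hM)
  have hM3 : BMono (fun w => ∏ j ∈ J, c j (π w)) := bmono_of_mul hAπ hBπ hM2
  have hM4 : BMono (fun w => ∏ q ∈ P, d q (π w)) := bmono_of_mul hBπ hAπ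
    (bmono_congr (Eventually.of_forall fun w => mul_comm _ _) hM2)
  have hcM : ∀ j ∈ J, BMono (fun w => c j (π w)) := fun j hj =>
    bmono_of_prod (f := fun j w => c j (π w)) (fun j _ => acomp (hc j) hπ hπ0) hM3 hj
  have hdM : ∀ q ∈ P, BMono (fun w => d q (π w)) := fun j hj =>
    bmono_of_prod (f := fun j w => d j (π w)) (fun j _ => acomp (hd j) hπ hπ0) hM4 hj
  have : ∀ j, ∃ (a : Fin m → ℕ) (u : (Fin m → ℝ) → ℝ), j ∈ J → (AnalyticAt ℝ u 0 ∧ u 0 ≠ 0 ∧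
    ∀ᶠ w in 𝓝 0, c j (π w) = bmon a w * u w) := by
    intro j
    by_cases hj : j ∈ J
    · obtain ⟨a, u, h⟩ := hcM j hj
      exact ⟨a, u, fun _ => h⟩
    · exact ⟨0, 0, fun h => absurd h hj⟩
  choose a u hau using this
  let b : ℕ → Fin m → ℕ := fun j => e j • a j
  have hcomp : ∀ i ∈ J, ∀ j ∈ J, b i ≤ b j ∨ b j ≤ b i := by
    intro i hi j hj
    obtain ⟨i1, i2, i3⟩ := hau i hi
    obtain ⟨j1, j2, j3⟩ := hau j hj
    have hev : ∀ᶠ w in 𝓝 0, bmon (b i) w * u i w ^ e i - bmon (b j) w * u j w ^ e j = d (i, j) (π w) := by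
      filter_upwards [i3, j3] with w h1 h2
      simp only [d, h1, h2, b, bmon_smul, mul_pow]
    refine order_lemma (i1.pow (e i)) (pow_ne_zero _ i2) (j1.pow (e j)) (pow_ne_zero _ j2) ?_
    by_cases hz : ∀ᶠ z in 𝓝 0, d (i, j) z = 0
    · right
      filter_upwards [hev, (etend hπ hπ0).eventually hz] with w h1 h2
      exact h1.trans h2
    · left
      exact bmono_congr hev (hdM _ (Finset.mem_filter.2 ⟨Finset.mem_product.2 ⟨hi, hj⟩, hz⟩))
  have hJne : J.Nonempty := by
    obtain ⟨j, h1, h2⟩ := hne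
    exact ⟨j, Finset.mem_filter.2 ⟨Finset.mem_range.2 h1, h2⟩⟩
  obtain ⟨j0, hj0, hmin⟩ := Finset.exists_min_image J (fun j => ∑ l, b j l) hJne
  have hle : ∀ j ∈ J, b j0 ≤ b j := by
    intro j hj
    rcases hcomp j0 hj0 j hj with h | h
    · exact h
    · have h1 : ∑ l, b j l = ∑ l, b j0 l := le_antisymm (Finset.sum_le_sum fun l _ => h l) (hmin j hj)
      have h2 := (Finset.sum_eq_sum_iff_of_le (fun l _ => h l)).1 h1
      exact fun l => (h2 l (Finset.mem_univ l)).ge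
  have ha0 : a j0 ≠ 0 := by
    intro h
    obtain ⟨i1, i2, i3⟩ := hau j0 hj0
    have := i3.self_of_nhds
    rw [hπ0, hc0 j0 (hJk _ hj0), h, bmon_zero, one_mul] at this
    exact i2 this.symm
  have he0 : ∀ j < k, e j ≠ 0 := fun j hj h => by
    have := he j hj
    rw [h] at this; omega
  have hβ : b j0 ≠ 0 := by
    intro h
    apply ha0
    ext l
    have := congrFun h l
    simpa [b, he0 j0 (hJk _ hj0)] using this
  obtain ⟨s, v, hs, hCs⟩ := powsub U q hC.2.2.1 hN
  obtain ⟨hS, hS0, -, -⟩ := id hCs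
  refine ⟨_, v, b j0, fun j w => if j ∈ J then bmon (a j) s * (bmon ((k+1-j) • (b j - b j0)) w *
    u j (fun i => s i * w i ^ N)) else 0, hC.comp hCs, hβ, ?_, ?_, ?_, bmono_pow_sub hgM hs hN⟩
  · intro j
    by_cases hj : j ∈ J
    · simp only [hj, if_true]
      exact analyticAt_const.mul ((bmon_analytic _ _).mul (acomp (hau j hj).1 hS hS0))
    · simp only [hj, if_false]
      exact analyticAt_const
  · intro j hj
    by_cases hjJ : j ∈ J
    · simp only [hjJ, if_true]
      filter_upwards [hCs.et.eventually (hau j hjJ).2.2] with w hw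
      rw [hw, bmon_pow_sub]
      have h1 : N • a j = (k+1-j) • b j0 + (k+1-j) • (b j - b j0) := by
        rw [← smul_add, add_tsub_cancel_of_le (hle j hjJ), ← he j hj, mul_smul]
      rw [h1, bmon_add, bmon_smul (k+1-j) (b j0)]
      ring
    · simp only [hjJ, if_false, mul_zero]
      have : ∀ᶠ z in 𝓝 0, c j z = 0 := by
        by_contra h
        exact hjJ (Finset.mem_filter.2 ⟨Finset.mem_range.2 hj, h⟩)
      exact (hC.comp hCs).et.eventually this
  · refine ⟨j0, hJk _ hj0, ?_⟩
    simp only [hj0, if_true, tsub_self, smul_zero, bmon_zero, one_mul]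
    have : (fun i => s i * (0 : Fin m → ℝ) i ^ N) = 0 := hS0
    rw [this]
    exact mul_ne_zero (bmon_ne fun i _ => hs i) (hau j0 hj0).2.1

lemma good_vert {m : ℕ} (hLM : LM U m) {k : ℕ} {f V : (Fin m → ℝ) × ℝ → ℝ} (hV : AnalyticAt ℝ V 0) (hV0 : V 0 ≠ 0)
    (hf : ∀ᶠ p in 𝓝 0, f p = p.2 ^ k * V p)
    {g : (Fin m → ℝ) → ℝ} (hg : AnalyticAt ℝ g 0) (hg0 : ¬ ∀ᶠ z in 𝓝 0, g z = 0)
    {z : ι → Fin m → ℝ} {t : ι → ℝ} (hz : Tendsto z U (𝓝 0)) (ht : Tendsto t U (𝓝 0)) :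
    Good U (m+1) (fun p => f p * g p.1) (fun i => (z i, t i)) := by
  obtain ⟨π, q, hC, hM⟩ := hLM g hg hg0 z hz
  have h1 := (hC.prod_id ht).comp (cov_J hC.2.2.1 ht)
  refine ⟨_, _, h1, ?_⟩
  refine bmono_mul ?_ (bmono_tail hM)
  refine bmono_congr (h1.et.eventually hf) ?_
  refine bmono_mul (bmono_pow (bmono_coord 0) k) (bmono_unit (acomp hV h1.1 h1.2.1) ?_)
  rw [show (π fun i => (0 : Fin (m+1) → ℝ) i.succ, (0 : Fin (m+1) → ℝ) 0) = 0 from h1.2.1]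
  exact hV0
end P5

open Filter Topology

section P6
variable {ι : Type*} {U : Ultrafilter ι}

open Polynomial in
lemma polymult {k : ℕ} (a : ℕ → ℝ) {u : ℝ} (hu : u ≠ 0) (ha : ∃ j < k, a j ≠ 0) (τ : ℝ) :
    ∃ (k' : ℕ) (h : ℝ → ℝ), k' < k + 1 ∧ Continuous h ∧ h 0 ≠ 0 ∧
      ∀ s, ∑ j ∈ Finset.range k, a j * (τ + s) ^ j + (τ + s) ^ (k+1) * u = s ^ k' * h s := by
  set P : ℝ[X] := ∑ j ∈ Finset.range k, C (a j) * X ^ j + C u * X ^ (k+1) with hPdef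
  have hcoef : ∀ i, P.coeff i = (if i < k then a i else 0) + (if i = k+1 then u else 0) := by
    intro i
    simp [hPdef, coeff_X_pow]
  have hP : P ≠ 0 := by
    intro h
    have := hcoef (k+1)
    rw [h] at this
    simp at this
    exact hu this.symm
  have hdeg : P.natDegree ≤ k+1 := by
    rw [natDegree_le_iff_coeff_eq_zero]
    intro i hi
    rw [hcoef, if_neg (by omega), if_neg (by omega), add_zero]
  have heval : ∀ s, P.eval s = ∑ j ∈ Finset.range k, a j * s ^ j + s ^ (k+1) * u := by
    intro s
    simp [hPdef, eval_finsetSum, mul_comm u]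
  obtain ⟨q, hq, hnd⟩ := exists_eq_pow_rootMultiplicity_mul_and_not_dvd P hP τ
  have hq0 : q.eval τ ≠ 0 := fun h => hnd (dvd_iff_isRoot.2 h)
  have hqne : q ≠ 0 := by rintro rfl; simp at hq0
  set M := P.rootMultiplicity τ
  have hMd : P.natDegree = M + q.natDegree := by
    conv_lhs => rw [hq]
    rw [natDegree_mul (pow_ne_zero _ (X_sub_C_ne_zero τ)) hqne, natDegree_pow, natDegree_X_sub_C, mul_one]
  refine ⟨M, fun s => q.eval (τ + s), ?_, by fun_prop, by simpa using hq0, ?_⟩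
  · by_contra hM
    have hM' : M = k+1 := by omega
    have hqd : q.natDegree = 0 := by omega
    obtain ⟨c, hc⟩ := natDegree_eq_zero.1 hqd
    rw [← hc, hM', sub_eq_add_neg, ← C_neg] at hq
    have hc0 : c ≠ 0 := by rintro rfl; simp at hc; exact hqne hc.symm
    have h1 := hcoef k
    rw [hq, coeff_mul_C, coeff_X_add_C_pow, if_neg (by omega), if_neg (by omega)] at h1
    simp at h1
    have hτ : τ = 0 := by
      rcases h1 with (h | h) | h
      · exact h
      · exfalso
        have : (k:ℝ) + 1 ≠ 0 := by positivity
        exact this h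
      · exact absurd h hc0
    obtain ⟨j, hj, haj⟩ := ha
    have h2 := hcoef j
    rw [hq, hτ, if_pos hj, if_neg (by omega)] at h2
    simp [coeff_X_pow] at h2
    exact haj (by rw [← h2, if_neg (by omega)])
  · intro s
    rw [← heval, hq]
    simp

lemma bmono_comp {m m' : ℕ} {g : (Fin m → ℝ) → ℝ} (hg : BMono g) {ρ : (Fin m' → ℝ) → Fin m → ℝ}
    (hρ : AnalyticAt ℝ ρ 0) (hρ0 : ρ 0 = 0) (h : ∀ i, BMono (fun w => ρ w i)) : BMono (fun w => g (ρ w)) := by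
  obtain ⟨a, u, h1, h2, h3⟩ := hg
  refine bmono_congr ((etend hρ hρ0).eventually h3) (bmono_mul ?_ (bmono_unit (acomp h1 hρ hρ0) (by rwa [hρ0])))
  exact bmono_prod _ fun i _ => bmono_pow (h i) (a i)

lemma S_lemma {m : ℕ} (hLM : LM U m) (k : ℕ) : ∀ (f : (Fin m → ℝ) × ℝ → ℝ) (h : ℝ → ℝ) (g : (Fin m → ℝ) → ℝ)
    (z : ι → Fin m → ℝ) (t : ι → ℝ), AnalyticAt ℝ f 0 → ContinuousAt h 0 → h 0 ≠ 0 →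
    (∀ᶠ s in 𝓝 (0:ℝ), f (0, s) = s ^ k * h s) → AnalyticAt ℝ g 0 → (¬ ∀ᶠ z in 𝓝 0, g z = 0) →
    Tendsto z U (𝓝 0) → Tendsto t U (𝓝 0) →
    Good U (m+1) (fun p => f p * g p.1) (fun i => (z i, t i)) := by
  induction k using Nat.strong_induction_on with
  | _ k ih =>
  intro f h g z t hf hh h0 hfh hg hg0 hz ht
  rcases k with _ | k
  · refine good_vert hLM (k := 0) hf ?_ (by simp) hg hg0 hz ht
    have := hfh.self_of_nhds
    rw [pow_zero, one_mul] at this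
    show f (0, 0) ≠ 0
    rw [this]; exact h0
  obtain ⟨φ, c, V, hφ, hφ0, hc, hc0, hV, hV0, he⟩ := tsch hf hh h0 hfh
  have hφ1 : AnalyticAt ℝ (fun p : (Fin m → ℝ) × ℝ => φ p.1) 0 := acomp hφ analyticAt_fst rfl
  have ht1 : Tendsto (fun i => t i - φ (z i)) U (𝓝 0) := by
    simpa using ht.sub ((etend hφ hφ0).comp hz)
  have hS : Cov U (fun p : (Fin m → ℝ) × ℝ => (p.1, φ p.1 + p.2)) (fun i => (z i, t i - φ (z i)))
      (fun i => (z i, t i)) :=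
    ⟨analyticAt_fst.prod (hφ1.add analyticAt_snd), by simp [hφ0], hz.prodMk_nhds ht1, by simp⟩
  refine Good.pull hS ?_
  set t1 := fun i => t i - φ (z i) with ht1def
  by_cases hall : ∀ j < k, ∀ᶠ z in 𝓝 0, c j z = 0
  · refine good_vert hLM (k := k+1) (f := fun p => f (p.1, φ p.1 + p.2)) hV hV0 ?_ hg hg0 hz ht1
    have : ∀ᶠ p : (Fin m → ℝ) × ℝ in 𝓝 0, ∀ j ∈ Finset.range k, c j p.1 = 0 := by
      rw [Finset.eventually_all]
      intro j hj
      exact (etend (analyticAt_fst (E := Fin m → ℝ) (F := ℝ)) rfl).eventually (hall j (Finset.mem_range.1 hj))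
    filter_upwards [he, this] with p h1 h2
    rw [h1, Finset.sum_eq_zero (fun j hj => by rw [h2 j hj, zero_mul]), zero_add]
  push Not at hall
  obtain ⟨π, z', β, ch, hC, hβ, hch, hcc, hch0, hgM⟩ := prep hLM c hc hc0 (by
    obtain ⟨j, h1, h2⟩ := hall
    exact ⟨j, h1, fun h3 => h2 (h3.mono fun x hx hx2 => hx2 hx)⟩) g hg hg0 z hz
  obtain ⟨hπ, hπ0, hz', -⟩ := id hC
  have hC2 := hC.prod_id ht1
  refine Good.pull hC2 ?_
  have hcc' : ∀ᶠ v in 𝓝 0, ∀ j ∈ Finset.range k, c j (π v) = bmon β v ^ (k+1-j) * ch j v := by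
    rw [Finset.eventually_all]
    exact fun j hj => hcc j (Finset.mem_range.1 hj)
  have hev : ∀ᶠ p : (Fin m → ℝ) × ℝ in 𝓝 0, f (π p.1, φ (π p.1) + p.2) =
      ∑ j ∈ Finset.range k, bmon β p.1 ^ (k+1-j) * ch j p.1 * p.2 ^ j + p.2 ^ (k+1) * V (π p.1, p.2) := by
    filter_upwards [hC2.et.eventually he, (etend (analyticAt_fst (E := Fin m → ℝ) (F := ℝ)) rfl).eventually hcc']
      with p h1 h2
    refine h1.trans ?_
    congr 1
    exact Finset.sum_congr rfl fun j hj => by rw [h2 j hj]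
  rcases dich U t1 (fun i => bmon β (z' i)) with ⟨τ, r, hr, htr⟩ | ⟨ht0, hbt⟩
  · have hr' : Tendsto (fun i => r i - τ) U (𝓝 0) := by simpa using hr.sub_const τ
    have hbm : AnalyticAt ℝ (fun p : (Fin m → ℝ) × ℝ => bmon β p.1) 0 :=
      acomp (bmon_analytic β 0) analyticAt_fst rfl
    have hτs : AnalyticAt ℝ (fun p : (Fin m → ℝ) × ℝ => τ + p.2) 0 := analyticAt_const.add analyticAt_snd
    have hA : Cov U (fun p : (Fin m → ℝ) × ℝ => (p.1, bmon β p.1 * (τ + p.2))) (fun i => (z' i, r i - τ))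
        (fun i => (z' i, t1 i)) := by
      refine ⟨analyticAt_fst.prod (hbm.mul hτs), by simp [bmon_at_zero hβ], hz'.prodMk_nhds hr', ?_⟩
      filter_upwards [htr] with i hi
      simp [hi]
    refine Good.pull hA ?_
    have hVA : AnalyticAt ℝ (fun p : (Fin m → ℝ) × ℝ => V (π p.1, bmon β p.1 * (τ + p.2))) 0 :=
      acomp hV (acomp hC2.1 hA.1 hA.2.1) (hC2.comp hA).2.1
    let f2 : (Fin m → ℝ) × ℝ → ℝ := fun p =>
      ∑ j ∈ Finset.range k, ch j p.1 * (τ + p.2) ^ j + (τ + p.2) ^ (k+1) * V (π p.1, bmon β p.1 * (τ + p.2))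
    have hf2 : AnalyticAt ℝ f2 0 := by
      refine AnalyticAt.add ?_ ((hτs.pow _).mul hVA)
      refine Finset.analyticAt_fun_sum _ fun j _ => ?_
      exact (acomp (hch j) analyticAt_fst rfl).mul (hτs.pow _)
    obtain ⟨k', h', hk', hh', h0', hQ⟩ := polymult (fun j => ch j 0) hV0 hch0 τ
    have hgm : BMono (fun v => bmon β v ^ (k+1) * g (π v)) := bmono_mul (bmono_pow (bmono_mon β) _) hgM
    have := ih k' hk' f2 h' (fun v => bmon β v ^ (k+1) * g (π v)) z' (fun i => r i - τ) hf2 hh'.continuousAt h0'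
      (Eventually.of_forall fun s => by
        rw [← hQ s]
        have : V (π 0, 0) = V 0 := by rw [hπ0]; rfl
        simp [f2, bmon_at_zero hβ, this])
      (((bmon_analytic β 0).pow _).mul (acomp hg hπ hπ0)) (bmono_ne_zero hgm) hz' hr'
    refine Good.congr ?_ this
    filter_upwards [hA.et.eventually hev] with p hp
    have hp' : f (π p.1, φ (π p.1) + bmon β p.1 * (τ + p.2)) = _ := hp
    show f (π p.1, φ (π p.1) + bmon β p.1 * (τ + p.2)) * g (π p.1) = f2 p * (bmon β p.1 ^ (k+1) * g (π p.1))
    rw [hp', ← mul_assoc]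
    congr 1
    simp only [f2]
    rw [add_mul, Finset.sum_mul]
    congr 1
    · refine Finset.sum_congr rfl fun j hj => ?_
      have : bmon β p.1 ^ (k+1) = bmon β p.1 ^ (k+1-j) * bmon β p.1 ^ j := by
        rw [← pow_add]; congr 1; have := Finset.mem_range.1 hj; omega
      rw [this, mul_pow]; ring
    · rw [mul_pow]; ring
  · obtain ⟨ρ, q, hCρ, hm1, hm2, σ, hσ, hσe⟩ := toric U m _ β rfl z' t1 hz' ht1 ht0 hbt
    have hσ0 : σ 0 = 0 := by
      have h1 : Tendsto (fun i => σ (q i)) U (𝓝 (σ 0)) := hσ.continuousAt.tendsto.comp hCρ.2.2.1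
      refine tendsto_nhds_unique h1 (hbt.congr' ?_)
      filter_upwards [ht0, hCρ.2.2.1.eventually hσe, hCρ.2.2.2] with i h1 h2 h3
      rw [h3] at h2
      simp only at h2
      rw [h2]; field_simp
    refine ⟨ρ, q, hCρ, ?_⟩
    have hρ1 : AnalyticAt ℝ (fun w => (ρ w).1) 0 := analyticAt_fst.fun_comp hCρ.1
    have hρ0 : (ρ 0).1 = 0 := by rw [hCρ.2.1]; rfl
    refine bmono_mul ?_ (bmono_comp hgM hρ1 hρ0 hm1)
    have hVA : AnalyticAt ℝ (fun w => V (π (ρ w).1, (ρ w).2)) 0 :=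
      acomp hV (hC2.comp hCρ).1 (hC2.comp hCρ).2.1
    have h1 : BMono (fun w => (ρ w).2 ^ (k+1) * (∑ j ∈ Finset.range k, σ w ^ (k+1-j) * ch j (ρ w).1 + V (π (ρ w).1, (ρ w).2))) := by
      refine bmono_mul (bmono_pow hm2 _) (bmono_unit (AnalyticAt.add ?_ hVA) ?_)
      · refine Finset.analyticAt_fun_sum _ fun j _ => ?_
        exact (hσ.pow _).mul (acomp (hch j) hρ1 hρ0)
      · rw [Finset.sum_eq_zero, zero_add]
        · rw [show (π (ρ 0).1, (ρ 0).2) = 0 from (hC2.comp hCρ).2.1]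
          exact hV0
        · intro j hj
          have := Finset.mem_range.1 hj
          rw [hσ0, zero_pow (by omega), zero_mul]
    refine bmono_congr ?_ h1
    filter_upwards [hCρ.et.eventually hev, hσe] with w hw hw2
    refine hw.trans ?_
    rw [hw2, mul_add, Finset.mul_sum]
    congr 1
    refine Finset.sum_congr rfl fun j hj => ?_
    have : (ρ w).2 ^ (k+1) = (ρ w).2 ^ (k+1-j) * (ρ w).2 ^ j := by
      rw [← pow_add]; congr 1; have := Finset.mem_range.1 hj; omega
    rw [this, mul_pow]; ring

lemma LM_all (U : Ultrafilter ι) (m : ℕ) : LM U m := by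
  induction m with
  | zero =>
    intro f hf h0 p hp
    refine ⟨id, p, ⟨analyticAt_id, rfl, hp, by simp⟩, bmono_unit hf ?_⟩
    intro h
    apply h0
    refine Eventually.of_forall fun x => ?_
    rw [Subsingleton.elim x 0]; exact h
  | succ m ih =>
    intro f hf hne p hp
    by_cases hf0 : f 0 = 0
    swap
    · exact ⟨id, p, ⟨analyticAt_id, rfl, hp, by simp⟩, bmono_unit hf hf0⟩
    obtain ⟨r, hr, hB⟩ := Metric.eventually_nhds_iff_ball.1 hf.eventually_analyticAt
    have : ∃ v ∈ Metric.ball (0 : Fin (m+1) → ℝ) r, f v ≠ 0 := by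
      by_contra hcon
      push Not at hcon
      exact hne (Metric.eventually_nhds_iff_ball.2 ⟨r, hr, hcon⟩)
    obtain ⟨v, hvr, hv⟩ := this
    have hv0 : v ≠ 0 := by rintro rfl; exact hv hf0
    obtain ⟨l, hl⟩ := Function.ne_iff.1 hv0
    have hl : v l ≠ 0 := hl
    let L : (Fin m → ℝ) × ℝ → Fin (m+1) → ℝ := fun q => l.insertNth 0 q.1 + q.2 • v
    have hLi : ∀ (q : (Fin m → ℝ) × ℝ) i, L q i = (l.insertNth 0 q.1 : Fin (m+1) → ℝ) i + q.2 * v i := fun q i => rfl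
    have hLl : ∀ q, L q l = q.2 * v l := fun q => by simp [hLi]
    have hLs : ∀ q i, L q (l.succAbove i) = q.1 i + q.2 * v (l.succAbove i) := fun q i => by simp [hLi]
    have hL : AnalyticAt ℝ L 0 := by
      rw [analyticAt_pi_iff]
      intro i
      refine Fin.succAboveCases l ?_ (fun i => ?_) i
      · refine AnalyticAt.congr ?_ (Eventually.of_forall fun q => (hLl q).symm)
        exact analyticAt_snd.mul analyticAt_const
      · refine AnalyticAt.congr ?_ (Eventually.of_forall fun q => (hLs q i).symm)
        exact (AnalyticAt.fun_comp (coord_analytic i _) analyticAt_fst).add (analyticAt_snd.mul analyticAt_const)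
    have hL0 : L 0 = 0 := by
      ext i
      refine Fin.succAboveCases l ?_ (fun i => ?_) i
      · simp [hLl]
      · simp [hLs]
    have hp' := tendsto_pi_nhds.1 hp
    have hpl : Tendsto (fun i => p i l / v l) U (𝓝 0) := by simpa using (hp' l).div_const (v l)
    let z : ι → Fin m → ℝ := fun i j => p i (l.succAbove j) - p i l / v l * v (l.succAbove j)
    have hz : Tendsto z U (𝓝 0) := by
      rw [tendsto_pi_nhds]
      intro j
      simpa using (hp' (l.succAbove j)).sub (hpl.mul_const (v (l.succAbove j)))
    have hC : Cov U L (fun i => (z i, p i l / v l)) p := by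
      refine ⟨hL, hL0, hz.prodMk_nhds hpl, Eventually.of_forall fun i => ?_⟩
      ext j
      refine Fin.succAboveCases l ?_ (fun i => ?_) j
      · rw [hLl]; field_simp
      · rw [hLs]; simp [z]
    refine Good.pull hC ?_
    have hline : AnalyticOnNhd ℝ (fun s : ℝ => f (s • v)) (Set.Icc 0 1) := by
      intro s hs
      have h1 : AnalyticAt ℝ f (s • v) := by
        apply hB
        rw [mem_ball_zero_iff] at hvr ⊢
        rw [norm_smul, Real.norm_of_nonneg hs.1]
        exact lt_of_le_of_lt (mul_le_of_le_one_left (norm_nonneg _) hs.2) hvr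
      exact AnalyticAt.fun_comp h1 (analyticAt_id.smul analyticAt_const)
    have hnz : ¬ ∀ᶠ s in 𝓝 (0:ℝ), f (s • v) = 0 := by
      intro h
      have := hline.eqOn_zero_of_preconnected_of_eventuallyEq_zero isPreconnected_Icc
        (Set.left_mem_Icc.2 zero_le_one) h (Set.right_mem_Icc.2 zero_le_one)
      simp at this
      exact hv this
    obtain ⟨k, h, hh, h0, he⟩ := (hline 0 (Set.left_mem_Icc.2 zero_le_one)).exists_eventuallyEq_pow_smul_nonzero_iff.2 hnz
    have hg := S_lemma ih k (fun q => f (L q)) h (fun _ => 1) z (fun i => p i l / v l) (acomp hf hL hL0)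
      hh.continuousAt h0 (by
        filter_upwards [he] with s hs
        have : L (0, s) = s • v := by
          ext i
          refine Fin.succAboveCases l ?_ (fun i => ?_) i
          · simp [hLl]
          · simp [hLs]
        rw [this, hs]; simp) analyticAt_const (fun h => one_ne_zero h.self_of_nhds) hz hpl
    simpa using hg
end P6

open Filter Topology

section P7
variable {ι : Type*} {U : Ultrafilter ι} {E : Type*} [NormedAddCommGroup E] [NormedSpace ℝ E]

lemma minpar_zero {p : ι → E} {m : ℕ}
    (hmin : ∀ m' < m, ¬ ∃ (Φ : (Fin m' → ℝ) → E) (q : ι → Fin m' → ℝ), Cov U Φ q p)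
    {Φ : (Fin m → ℝ) → E} {q : ι → Fin m → ℝ} (h : Cov U Φ q p) {φ : (Fin m → ℝ) → ℝ} (hφ : AnalyticAt ℝ φ 0)
    (hz : ∀ᶠ i in (U : Filter ι), φ (q i) = 0) : ∀ᶠ w in 𝓝 0, φ w = 0 := by
  by_contra hne
  obtain ⟨π, q', hC, a, u, hu, hu0, he⟩ := LM_all U m φ hφ hne q h.2.2.1
  have h1 : ∀ᶠ i in (U : Filter ι), ∃ l, q' i l = 0 := by
    filter_upwards [hz, hC.2.2.2, hC.2.2.1.eventually he, hC.2.2.1.eventually (hu.continuousAt.eventually_ne hu0)]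
      with i h1 h2 h3 h4
    rw [h2, h1] at h3
    by_contra hcon
    push Not at hcon
    exact mul_ne_zero (bmon_ne fun i _ => hcon i) h4 h3.symm
  have h2 : ∃ l, ∀ᶠ i in (U : Filter ι), q' i l = 0 := by
    by_contra hcon
    push Not at hcon
    have h3 : ∀ l, ∀ᶠ i in (U : Filter ι), q' i l ≠ 0 := by
      intro l
      exact hcon l
    obtain ⟨i, hi1, l, hi2⟩ := ((eventually_all.2 h3).and h1).exists
    exact hi1 l hi2
  obtain ⟨l, hl⟩ := h2
  rcases m with _ | m
  · exact l.elim0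
  have hI : Cov U (fun w : Fin m → ℝ => (l.insertNth 0 w : Fin (m+1) → ℝ)) (fun i j => q' i (l.succAbove j)) q' := by
    refine ⟨?_, ?_, ?_, ?_⟩
    · rw [analyticAt_pi_iff]
      intro i
      refine Fin.succAboveCases l ?_ (fun i => ?_) i
      · simpa using analyticAt_const
      · simpa using coord_analytic i 0
    · ext i
      refine Fin.succAboveCases l ?_ (fun i => ?_) i
      · simp
      · simp
    · rw [tendsto_pi_nhds]
      intro j
      exact tendsto_pi_nhds.1 hC.2.2.1 (l.succAbove j)
    · filter_upwards [hl] with i hi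
      ext j
      refine Fin.succAboveCases l ?_ (fun i => ?_) j
      · simp [hi]
      · simp
  exact hmin m (by omega) ⟨_, _, (h.comp hC).comp hI⟩

/-- existence of normalized minimal parametrization -/
lemma norm_par {n : ℕ} {U : Ultrafilter ℝ} (hU : (U : Filter ℝ) ≤ 𝓝[>] 0) {x : ℝ → Fin n → ℝ}
    (hx : Tendsto x U (𝓝 0)) :
    ∃ (m : ℕ) (Φ : (Fin m → ℝ) → ℝ × (Fin n → ℝ)) (q : ℝ → Fin m → ℝ) (α : Fin m → ℕ),
      Cov U Φ q (fun μ => (μ, x μ)) ∧ α ≠ 0 ∧ (∀ᶠ μ in (U : Filter ℝ), ∀ i, 0 < q μ i) ∧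
      (∀ᶠ w in 𝓝 0, (Φ w).1 = bmon α w) ∧
      (∀ φ : (Fin m → ℝ) → ℝ, AnalyticAt ℝ φ 0 → (∀ᶠ μ in (U : Filter ℝ), φ (q μ) = 0) → ∀ᶠ w in 𝓝 0, φ w = 0) := by
  classical
  have hμ : Tendsto (fun μ : ℝ => μ) U (𝓝 0) := hU.trans nhdsWithin_le_nhds
  have hpos : ∀ᶠ μ in (U : Filter ℝ), 0 < μ := hU self_mem_nhdsWithin
  have hex : ∃ m, ∃ (Φ : (Fin m → ℝ) → ℝ × (Fin n → ℝ)) (q : ℝ → Fin m → ℝ), Cov U Φ q (fun μ => (μ, x μ)) := by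
    have h1 := cov_J (m := n) hx hμ
    refine ⟨n+1, _, _, Cov.comp (π := fun p : (Fin n → ℝ) × ℝ => (p.2, p.1)) (q := fun μ => (x μ, μ)) ?_ h1⟩
    exact ⟨analyticAt_snd.prod analyticAt_fst, rfl, hx.prodMk_nhds hμ, by simp⟩
  set m := Nat.find hex with hm
  have hmin : ∀ m' < m, ¬ ∃ (Φ : (Fin m' → ℝ) → ℝ × (Fin n → ℝ)) (q : ℝ → Fin m' → ℝ),
    Cov U Φ q (fun μ => (μ, x μ)) := fun m' hm' => Nat.find_min hex hm'
  obtain ⟨Φ, q, h⟩ := Nat.find_spec hex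
  obtain ⟨π, q1, h1, α, u, hu, hu0, he⟩ := LM_all U m (fun w => (Φ w).1) (analyticAt_fst.fun_comp h.1) (by
    intro hcon
    obtain ⟨μ, e1, e2, e3⟩ := ((h.2.2.1.eventually hcon).and (h.2.2.2.and hpos)).exists
    rw [e2] at e1
    exact e3.ne' e1) q h.2.2.1
  have h2 := h.comp h1
  have hq1 : ∀ i, ∀ᶠ μ in (U : Filter ℝ), q1 μ i ≠ 0 := by
    intro i
    by_contra hcon
    have := Ultrafilter.frequently_iff_eventually.1 (show ∃ᶠ μ in (U : Filter ℝ), q1 μ i = 0 by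
      intro h'; exact hcon h')
    exact coord_not_zero i (minpar_zero hmin h2 (coord_analytic i 0) this)
  -- signs
  have hsgn : ∀ l, ∃ s : ℝ, s ≠ 0 ∧ ∀ᶠ μ in (U : Filter ℝ), s * |q1 μ l| = q1 μ l := by
    intro l
    rcases Ultrafilter.eventually_or.1 (Eventually.of_forall (f := (U : Filter ℝ)) fun i => le_total 0 (q1 i l)) with h | h
    · exact ⟨1, one_ne_zero, by filter_upwards [h] with i hi; rw [abs_of_nonneg hi, one_mul]⟩
    · exact ⟨-1, by norm_num, by filter_upwards [h] with i hi; rw [abs_of_nonpos hi]; ring⟩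
  choose s hs hsq using hsgn
  have hSan : AnalyticAt ℝ (fun w : Fin m → ℝ => fun i => s i * w i ^ 1) 0 := by
    rw [analyticAt_pi_iff]
    exact fun i => analyticAt_const.mul ((coord_analytic i 0).pow 1)
  have hSC : Cov U (fun w : Fin m → ℝ => fun i => s i * w i ^ 1) (fun μ i => |q1 μ i|) q1 := by
    refine ⟨hSan, by ext i; simp, ?_, ?_⟩
    · rw [tendsto_pi_nhds]
      intro j
      simpa using (tendsto_pi_nhds.1 h1.2.2.1 j).abs
    · filter_upwards [eventually_all.2 hsq] with μ hμ
      ext i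
      simp [hμ i]
  have h3 := h2.comp hSC
  set Φ3 := fun w : Fin m → ℝ => Φ (π (fun i => s i * w i ^ 1)) with hΦ3
  set q3 : ℝ → Fin m → ℝ := fun μ i => |q1 μ i| with hq3
  have hq3p : ∀ᶠ μ in (U : Filter ℝ), ∀ i, 0 < q3 μ i := by
    filter_upwards [eventually_all.2 hq1] with μ hμ i
    exact abs_pos.2 (hμ i)
  let u3 : (Fin m → ℝ) → ℝ := fun w => bmon α s * u (fun i => s i * w i ^ 1)
  have hu3 : AnalyticAt ℝ u3 0 := analyticAt_const.mul (acomp hu hSC.1 hSC.2.1)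
  have he3 : ∀ᶠ w in 𝓝 0, (Φ3 w).1 = bmon α w * u3 w := by
    filter_upwards [hSC.et.eventually he] with w hw
    refine Eq.trans hw ?_
    rw [bmon_pow_sub, one_smul]; simp only [u3]; ring
  have hu30 : u3 0 ≠ 0 := by
    refine mul_ne_zero (bmon_ne fun i _ => hs i) ?_
    rw [show (fun i => s i * (0 : Fin m → ℝ) i ^ 1) = 0 from hSC.2.1]
    exact hu0
  have hu3q : ∀ᶠ μ in (U : Filter ℝ), 0 < u3 (q3 μ) := by
    filter_upwards [hq3p, h3.2.2.1.eventually he3, h3.2.2.2, hpos] with μ e1 e2 e3 e4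
    rw [e3] at e2
    have e5 : 0 < bmon α (q3 μ) := Finset.prod_pos fun i _ => pow_pos (e1 i) _
    have e2 : μ = bmon α (q3 μ) * u3 (q3 μ) := e2
    rw [e2] at e4
    exact pos_of_mul_pos_right e4 e5.le
  have hu3p : 0 < u3 0 := by
    refine lt_of_le_of_ne ?_ hu30.symm
    exact ge_of_tendsto (hu3.continuousAt.tendsto.comp h3.2.2.1) (hu3q.mono fun μ h => h.le)
  have hα : α ≠ 0 := by
    rintro rfl
    have := he3.self_of_nhds
    rw [h3.2.1, bmon_zero, one_mul] at this
    exact hu30 this.symm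
  obtain ⟨i0, hi0⟩ := Function.ne_iff.1 hα
  have hi0 : α i0 ≠ 0 := hi0
  let V : (Fin m → ℝ) → ℝ := fun w => u3 w ^ ((α i0 : ℝ)⁻¹)
  have hV : AnalyticAt ℝ V 0 := by
    have e1 : AnalyticAt ℝ (fun w => Real.exp (Real.log (u3 w) * (α i0 : ℝ)⁻¹)) 0 :=
      (((analyticAt_log hu3p).fun_comp hu3).mul analyticAt_const).rexp'
    refine e1.congr ?_
    filter_upwards [hu3.continuousAt.eventually (lt_mem_nhds hu3p)] with w hw
    exact (Real.rpow_def_of_pos hw _).symm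
  have hV0 : 0 < V 0 := Real.rpow_pos_of_pos hu3p _
  have hVp : ∀ᶠ w in 𝓝 0, V w ^ α i0 = u3 w := by
    filter_upwards [hu3.continuousAt.eventually (lt_mem_nhds hu3p)] with w hw
    exact Real.rpow_inv_natCast_pow (le_of_lt hw) hi0
  let G : (Fin m → ℝ) → ℝ := fun w => w i0 * V w
  have hG : AnalyticAt ℝ G 0 := (coord_analytic i0 0).mul hV
  have hGd : fderiv ℝ G 0 (Pi.single i0 1) ≠ 0 := by
    have e1 := ((ContinuousLinearMap.proj (R := ℝ) (φ := fun _ : Fin m => ℝ) i0).hasFDerivAt (x := 0)).mul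
      hV.differentiableAt.hasFDerivAt
    have e2 : fderiv ℝ G 0 = _ := e1.fderiv
    rw [e2]
    simp
    exact hV0.ne'
  obtain ⟨χ, hχ, hχ0, hχ1, hχ2⟩ := aux_inv1 G hG (by simp [G]) (ContinuousLinearMap.proj (R := ℝ) (φ := fun _ : Fin m => ℝ) i0)
    (Pi.single i0 1) (by simp) hGd
  let Ψ : (Fin m → ℝ) → (Fin m → ℝ) := fun w => w + (G w - w i0) • Pi.single i0 1
  have hΨi : ∀ w i, Ψ w i = if i = i0 then w i * V w else w i := by
    intro w i
    by_cases h : i = i0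
    · subst h; simp [Ψ, G]
    · simp [Ψ, h]
  have hΨ : AnalyticAt ℝ Ψ 0 := analyticAt_id.add ((hG.sub (coord_analytic i0 0)).smul analyticAt_const)
  have hΨ0 : Ψ 0 = 0 := by ext i; simp [hΨi]
  have hbΨ : ∀ᶠ w in 𝓝 0, bmon α (Ψ w) = bmon α w * u3 w := by
    filter_upwards [hVp] with w hw
    rw [← hw, bmon, bmon, ← Finset.mul_prod_erase _ _ (Finset.mem_univ i0), ← Finset.mul_prod_erase _ _ (Finset.mem_univ i0)]
    rw [hΨi, if_pos rfl, mul_pow, Finset.prod_congr rfl (fun i hi => by rw [hΨi, if_neg (Finset.ne_of_mem_erase hi)])]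
    ring
  have h4 : Cov U χ (fun μ => Ψ (q3 μ)) q3 :=
    ⟨hχ, hχ0, (etend hΨ hΨ0).comp h3.2.2.1, h3.2.2.1.eventually hχ1⟩
  have h5 := h3.comp h4
  refine ⟨m, _, _, α, h5, hα, ?_, ?_, fun φ hφ hz => minpar_zero hmin h5 hφ hz⟩
  · filter_upwards [hq3p, hu3q] with μ e1 e2 i
    rw [hΨi]
    split_ifs
    · exact mul_pos (e1 i) (Real.rpow_pos_of_pos e2 _)
    · exact e1 i
  · filter_upwards [(etend hχ hχ0).eventually he3, (etend hχ hχ0).eventually hbΨ, hχ2] with w e1 e2 e3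
    rw [e1, ← e2]
    congr 1
end P7

open Filter Topology

section P8

lemma exp_curve {m : ℕ} (p b : Fin m → ℝ) (θ : ℝ) :
    HasDerivAt (fun θ : ℝ => (fun l => p l * Real.exp (θ * b l) : Fin m → ℝ))
      (fun l => (p l * Real.exp (θ * b l)) * b l) θ := by
  rw [hasDerivAt_pi]
  intro l
  have h1 : HasDerivAt (fun θ : ℝ => θ * b l) (b l) θ := by simpa using (hasDerivAt_id θ).mul_const (b l)
  exact (h1.exp.const_mul (p l)).congr_deriv (by ring)

lemma bmon_exp {m : ℕ} (α : Fin m → ℕ) (p b : Fin m → ℝ) (h : ∑ l, (α l : ℝ) * b l = 0) (θ : ℝ) :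
    bmon α (fun l => p l * Real.exp (θ * b l)) = bmon α p := by
  simp only [bmon, mul_pow, Finset.prod_mul_distrib, ← Real.exp_nat_mul]
  rw [← Real.exp_sum, show ∑ x, (α x : ℝ) * (θ * b x) = θ * ∑ l, (α l : ℝ) * b l by
    rw [Finset.mul_sum]; exact Finset.sum_congr rfl fun i _ => by ring, h]
  simp

lemma curve0 {n : ℕ} {κ : Type*} [Finite κ] {U : Ultrafilter ℝ} (hU : (U : Filter ℝ) ≤ 𝓝[>] 0) {x : ℝ → Fin n → ℝ}
    (hx : Tendsto x U (𝓝 0)) (F : κ → ℝ × (Fin n → ℝ) → ℝ) (hF : ∀ j, AnalyticAt ℝ (F j) 0)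
    (hsol : ∀ᶠ μ in (U : Filter ℝ), (∀ j, F j (μ, x μ) = 0) ∧
      ∀ᶠ y in 𝓝 (x μ), (∀ j, F j (μ, y) = 0) → y = x μ) :
    ∃ (ρ : ℕ) (y : ℝ → Fin n → ℝ), 0 < ρ ∧ AnalyticAt ℝ y 0 ∧
      ∀ᶠ μ in (U : Filter ℝ), x μ = y (μ ^ ((ρ:ℝ)⁻¹)) := by
  classical
  have hpos : ∀ᶠ μ in (U : Filter ℝ), 0 < μ := hU self_mem_nhdsWithin
  obtain ⟨m, Φ, q, α, hC, hα, hqp, hΦ0, hz⟩ := norm_par hU hx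
  obtain ⟨i0, hi0⟩ := Function.ne_iff.1 hα
  have hi0 : α i0 ≠ 0 := hi0
  let R : (Fin m → ℝ) → Fin n → ℝ := fun w => (Φ w).2
  have hR : AnalyticAt ℝ R 0 := analyticAt_snd.fun_comp hC.1
  have hFΦ : ∀ᶠ w in 𝓝 0, ∀ j, F j (Φ w) = 0 := by
    rw [eventually_all]
    intro j
    refine hz _ (acomp (hF j) hC.1 hC.2.1) ?_
    filter_upwards [hC.2.2.2, hsol] with μ h1 h2
    rw [h1]; exact h2.1 j
  -- derivative vanishing
  have hder : ∀ b : Fin m → ℝ, ∑ l, (α l : ℝ) * b l = 0 →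
      ∀ᶠ w in 𝓝 0, fderiv ℝ R w (fun l => w l * b l) = 0 := by
    intro b hb
    have han : AnalyticAt ℝ (fun w => fderiv ℝ R w (fun l => w l * b l)) 0 := by
      have h1 : AnalyticAt ℝ (fun w : Fin m → ℝ => (fun l => w l * b l : Fin m → ℝ)) 0 := by
        rw [analyticAt_pi_iff]
        exact fun i => (coord_analytic i 0).mul analyticAt_const
      exact AnalyticAt.fun_comp (g := fun p : ((Fin m → ℝ) →L[ℝ] (Fin n → ℝ)) × (Fin m → ℝ) => p.1 p.2)
        ((ContinuousLinearMap.id ℝ ((Fin m → ℝ) →L[ℝ] (Fin n → ℝ))).analyticAt_bilinear _) (hR.fderiv.prod h1)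
    have hk : ∀ k, ∀ᶠ w in 𝓝 0, fderiv ℝ R w (fun l => w l * b l) k = 0 := by
      intro k
      refine hz _ (analyticAt_pi_iff.1 han k) ?_
      have hev := ((hΦ0.and hFΦ).and hR.eventually_analyticAt).eventually_nhds
      filter_upwards [hC.2.2.1.eventually hev, hC.2.2.2, hsol] with μ h1 h2 h3
      have hRx : R (q μ) = x μ := by simp only [R, h2]
      have h1s := h1.self_of_nhds
      have hμ : bmon α (q μ) = μ := by
        rw [← h1s.1.1, h2]
      -- curve
      let c : ℝ → Fin m → ℝ := fun θ l => q μ l * Real.exp (θ * b l)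
      have hc0 : c 0 = q μ := by ext l; simp [c]
      have hcd := exp_curve (q μ) b 0
      have hct : Tendsto c (𝓝 0) (𝓝 (q μ)) := by
        have := hcd.continuousAt.tendsto
        rw [show (fun l => q μ l * Real.exp (0 * b l)) = q μ from hc0] at this
        exact this
      have hRc : ContinuousAt R (q μ) := h1s.2.continuousAt
      have hRt : Tendsto R (𝓝 (q μ)) (𝓝 (x μ)) := by
        have := hRc.tendsto
        rwa [hRx] at this
      have hconst : ∀ᶠ θ in 𝓝 (0:ℝ), R (c θ) = x μ := by
        filter_upwards [hct.eventually h1, (hRt.comp hct).eventually h3.2] with θ e1 e2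
        apply e2
        intro j
        have e3 : (Φ (c θ)).1 = μ := by
          rw [e1.1.1, ← hμ]
          exact bmon_exp α (q μ) b hb θ
        have e4 : Φ (c θ) = (μ, R (c θ)) := by ext <;> simp [e3, R]
        have e5 := e1.1.2 j
        rw [e4] at e5
        exact e5
      have hd1 : HasDerivAt (fun θ => R (c θ)) 0 0 := by
        refine (hasDerivAt_const (0:ℝ) (x μ)).congr_of_eventuallyEq hconst
      have hd2 : HasDerivAt (fun θ => R (c θ)) (fderiv ℝ R (q μ) (fun l => q μ l * b l)) 0 := by
        have e1 : HasFDerivAt R (fderiv ℝ R (q μ)) (c 0) := by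
          rw [hc0]; exact h1s.2.differentiableAt.hasFDerivAt
        have e2 := e1.comp_hasDerivAt (0:ℝ) hcd
        exact e2.congr_deriv (by simp)
      rw [hd2.unique hd1]; rfl
    filter_upwards [eventually_all.2 hk] with w hw
    ext k
    exact hw k
  let B : Fin m → Fin m → ℝ := fun i l => (α i0 : ℝ) * (Pi.single i 1 : Fin m → ℝ) l - α i * (Pi.single i0 1 : Fin m → ℝ) l
  have hB : ∀ i, ∑ l, (α l : ℝ) * B i l = 0 := by
    intro i
    simp only [B, mul_sub, Finset.sum_sub_distrib, Pi.single_apply]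
    simp
    ring
  have hall : ∀ᶠ w in 𝓝 0, ∀ b : Fin m → ℝ, ∑ l, (α l : ℝ) * b l = 0 → fderiv ℝ R w (fun l => w l * b l) = 0 := by
    filter_upwards [eventually_all.2 fun i => hder (B i) (hB i)] with w hw b hb
    have hbe : (fun l => w l * b l) = ∑ i, ((α i0 : ℝ)⁻¹ * b i) • (fun l => w l * B i l) := by
      ext l
      simp only [Finset.sum_apply, Pi.smul_apply, smul_eq_mul, B, Pi.single_apply]
      have h1 : ∀ i, (α i0 : ℝ)⁻¹ * b i * (w l * ((α i0 : ℝ) * (if l = i then 1 else 0) - α i * (if l = i0 then 1 else 0)))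
        = (if l = i then w l * b i else 0) - ((α i0 : ℝ)⁻¹ * w l * (if l = i0 then 1 else 0)) * (α i * b i) := by
        intro i
        have : (α i0 : ℝ) ≠ 0 := by exact_mod_cast hi0
        split_ifs <;> field_simp <;> ring
      rw [Finset.sum_congr rfl fun i _ => h1 i, Finset.sum_sub_distrib, ← Finset.mul_sum, hb]
      simp
    rw [hbe, map_sum]
    exact Finset.sum_eq_zero fun i _ => by rw [map_smul, hw i, smul_zero]
  obtain ⟨r, hr, hball⟩ := Metric.eventually_nhds_iff_ball.1 (hall.and hR.eventually_analyticAt)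
  set ρ := ∑ l, α l with hρ
  have hρ0 : 0 < ρ := by
    refine lt_of_lt_of_le (Nat.pos_of_ne_zero hi0) ?_
    exact Finset.single_le_sum (f := α) (fun i _ => Nat.zero_le _) (Finset.mem_univ i0)
  have hdiag : AnalyticAt ℝ (fun s : ℝ => (fun _ => s : Fin m → ℝ)) 0 := by
    rw [analyticAt_pi_iff]
    exact fun _ => analyticAt_id
  refine ⟨ρ, fun s => R (fun _ => s), hρ0, acomp hR hdiag rfl, ?_⟩
  have hst : Tendsto (fun μ : ℝ => μ ^ ((ρ:ℝ)⁻¹)) U (𝓝 0) := by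
    have h2 : Tendsto (fun x : ℝ => x ^ ((ρ:ℝ)⁻¹)) (𝓝 0) (𝓝 0) := by
      have := (Real.continuousAt_rpow_const 0 ((ρ:ℝ)⁻¹) (Or.inr (by positivity))).tendsto
      rwa [Real.zero_rpow (by positivity)] at this
    exact h2.mono_left (hU.trans nhdsWithin_le_nhds)
  filter_upwards [hC.2.2.1.eventually (Metric.ball_mem_nhds 0 hr), hst.eventually (gt_mem_nhds hr), hC.2.2.2,
    hqp, hpos, hC.2.2.1.eventually hΦ0] with μ h1 h2 h3 h4 h5 h6
  replace h1 : q μ ∈ Metric.ball (0 : Fin m → ℝ) r := h1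
  set s := μ ^ ((ρ:ℝ)⁻¹) with hs
  have hs0 : 0 < s := Real.rpow_pos_of_pos h5 _
  let b : Fin m → ℝ := fun l => Real.log s - Real.log (q μ l)
  have hb : ∑ l, (α l : ℝ) * b l = 0 := by
    have e1 : Real.log μ = ∑ l, (α l : ℝ) * Real.log (q μ l) := by
      have : μ = bmon α (q μ) := by rw [← h6, h3]
      conv_lhs => rw [this, bmon]
      rw [Real.log_prod (fun i _ => (pow_pos (h4 i) _).ne')]
      simp
    have e2 : (ρ : ℝ) * Real.log s = Real.log μ := by
      rw [hs, Real.log_rpow h5]; field_simp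
    simp only [b, mul_sub, Finset.sum_sub_distrib]
    rw [← e1, ← Finset.sum_mul, ← e2, hρ]
    push_cast; ring
  let c : ℝ → Fin m → ℝ := fun θ l => q μ l * Real.exp (θ * b l)
  have hcball : ∀ θ ∈ Set.Icc (0:ℝ) 1, c θ ∈ Metric.ball (0 : Fin m → ℝ) r := by
    intro θ hθ
    rw [mem_ball_zero_iff, pi_norm_lt_iff hr] at h1 ⊢
    intro l
    have hql : q μ l < r := by
      have := h1 l
      rwa [Real.norm_of_nonneg (h4 l).le] at this
    have hcp : 0 < c θ l := mul_pos (h4 l) (Real.exp_pos _)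
    rw [Real.norm_of_nonneg hcp.le]
    rcases le_total (b l) 0 with hbl | hbl
    · refine lt_of_le_of_lt ?_ hql
      have : Real.exp (θ * b l) ≤ 1 := Real.exp_le_one_iff.2 (mul_nonpos_of_nonneg_of_nonpos hθ.1 hbl)
      exact mul_le_of_le_one_right (h4 l).le this
    · refine lt_of_le_of_lt ?_ h2
      calc c θ l ≤ q μ l * Real.exp (b l) := by
            refine mul_le_mul_of_nonneg_left (Real.exp_le_exp.2 ?_) (h4 l).le
            exact mul_le_of_le_one_left hbl hθ.2
        _ = s := by
            simp only [b]
            rw [Real.exp_sub, Real.exp_log hs0, Real.exp_log (h4 l)]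
            field_simp [(h4 l).ne']
  have hcder : ∀ θ ∈ Set.Icc (0:ℝ) 1, HasDerivAt (fun θ => R (c θ)) 0 θ := by
    intro θ hθ
    obtain ⟨e1, e2⟩ := hball _ (hcball θ hθ)
    have e3 := (e2.differentiableAt.hasFDerivAt).comp_hasDerivAt θ (exp_curve (q μ) b θ)
    have e4 : fderiv ℝ R (c θ) (fun l => c θ l * b l) = 0 := e1 b hb
    rw [← e4]
    exact e3
  have hfin := constant_of_has_deriv_right_zero (f := fun θ => R (c θ)) (a := 0) (b := 1)
    (fun θ hθ => (hcder θ hθ).continuousAt.continuousWithinAt)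
    (fun θ hθ => (hcder θ ⟨hθ.1, hθ.2.le⟩).hasDerivWithinAt) 1 (Set.right_mem_Icc.2 zero_le_one)
  have hc0 : c 0 = q μ := by ext l; simp [c]
  have hc1 : c 1 = fun _ => s := by
    ext l
    simp only [c, b, one_mul]
    rw [Real.exp_sub, Real.exp_log hs0, Real.exp_log (h4 l)]
    field_simp [(h4 l).ne']
  simp only [hc0, hc1] at hfin
  rw [hfin]
  simp only [R, h3]
end P8

open Filter Topology

section P9

lemma uf_cover {α K : Type*} (l : Filter α) (T : K → Set α)
    (h : ∀ U : Ultrafilter α, (U : Filter α) ≤ l → ∃ k, T k ∈ U) :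
    ∃ s : Finset K, ∀ᶠ a in l, ∃ k ∈ s, a ∈ T k := by
  classical
  by_contra hcon
  push Not at hcon
  let f : Finset K → Filter α := fun s => l ⊓ 𝓟 {a | ∀ k ∈ s, a ∉ T k}
  have hne : ∀ s, NeBot (f s) := by
    intro s
    exact frequently_mem_iff_neBot.1 (hcon s)
  have hanti : ∀ s t : Finset K, s ⊆ t → f t ≤ f s := by
    intro s t hst
    refine inf_le_inf_left _ (principal_mono.2 ?_)
    exact fun a ha k hk => ha k (hst hk)
  have hdir : Directed (· ≥ ·) f := fun s t =>
    ⟨s ∪ t, hanti _ _ Finset.subset_union_left, hanti _ _ Finset.subset_union_right⟩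
  have := iInf_neBot_of_directed' hdir hne
  let V := Ultrafilter.of (iInf f)
  have hV : ∀ s, (V : Filter α) ≤ f s := fun s => (Ultrafilter.of_le _).trans (iInf_le _ _)
  obtain ⟨k, hk⟩ := h V ((hV ∅).trans inf_le_left)
  have h2 : ∀ᶠ a in (V : Filter α), a ∉ T k := by
    have := ((hV {k}).trans inf_le_right) (mem_principal_self _)
    filter_upwards [this] with a ha
    exact ha k (Finset.mem_singleton_self k)
  obtain ⟨a, h3, h4⟩ := (h2.and hk).exists
  exact h3 h4

lemma select {E : Type*} [NormedAddCommGroup E] [NormedSpace ℝ E] [CompleteSpace E] {K : Type*} (s : Finset K) (y : K → ℝ → E)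
    (hy : ∀ k ∈ s, AnalyticAt ℝ (y k) 0) (z : ℝ → E) {ε0 : ℝ} (hε0 : 0 < ε0) (hz : ContinuousOn z (Set.Ioo 0 ε0))
    (hc : ∀ᶠ t in 𝓝[>] (0:ℝ), ∃ k ∈ s, z t = y k t) :
    ∃ k ∈ s, ∀ᶠ t in 𝓝[>] (0:ℝ), z t = y k t := by
  classical
  have hgt : 𝓝[>] (0:ℝ) ≤ 𝓝[≠] 0 := nhdsWithin_mono _ fun t ht => ne_of_gt ht
  have hpair : ∀ k ∈ s, ∀ k' ∈ s, ∃ b : Prop, ∀ᶠ t in 𝓝[>] (0:ℝ), (y k t = y k' t ↔ b) := by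
    intro k hk k' hk'
    rcases (hy k hk).eventually_eq_or_eventually_ne (hy k' hk') with h | h
    · exact ⟨True, by filter_upwards [h.filter_mono nhdsWithin_le_nhds] with t ht; simp [ht]⟩
    · exact ⟨False, by filter_upwards [h.filter_mono hgt] with t ht; simp [ht]⟩
  choose! b hb using hpair
  have hb' : ∀ᶠ t in 𝓝[>] (0:ℝ), ∀ k ∈ s, ∀ k' ∈ s, (y k t = y k' t ↔ b k k') := by
    rw [Finset.eventually_all]
    intro k hk
    rw [Finset.eventually_all]
    exact fun k' hk' => hb k hk k' hk'
  have hcont : ∀ᶠ t in 𝓝[>] (0:ℝ), ∀ k ∈ s, ContinuousAt (y k) t := by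
    rw [Finset.eventually_all]
    intro k hk
    exact ((hy k hk).eventually_analyticAt.mono fun t h => h.continuousAt).filter_mono nhdsWithin_le_nhds
  have hzc : ∀ᶠ t in 𝓝[>] (0:ℝ), ContinuousAt z t := by
    filter_upwards [Ioo_mem_nhdsGT hε0] with t ht
    exact hz.continuousAt (Ioo_mem_nhds ht.1 ht.2)
  obtain ⟨ε, hε, hall⟩ := (mem_nhdsGT_iff_exists_Ioo_subset).1 (((hb'.and hcont).and hzc).and hc)
  have hε : 0 < ε := hε
  have hpre : PreconnectedSpace (Set.Ioo (0:ℝ) ε) := Subtype.preconnectedSpace isPreconnected_Ioo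
  let t0 : Set.Ioo (0:ℝ) ε := ⟨ε/2, by constructor <;> linarith⟩
  obtain ⟨k0, hk0, ht0⟩ := (hall t0.2).2
  have hcz : Continuous (fun t : Set.Ioo (0:ℝ) ε => z t) := by
    rw [continuous_iff_continuousAt]
    intro t
    exact (hall t.2).1.2.comp continuousAt_subtype_val
  have hcy : ∀ k ∈ s, Continuous (fun t : Set.Ioo (0:ℝ) ε => y k t) := by
    intro k hk
    rw [continuous_iff_continuousAt]
    intro t
    exact ((hall t.2).1.1.2 k hk).comp continuousAt_subtype_val
  let A : K → Set (Set.Ioo (0:ℝ) ε) := fun k => {t | z t = y k t}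
  have hA : ∀ k ∈ s, IsClosed (A k) := fun k hk => isClosed_eq hcz (hcy k hk)
  have hcompl : (A k0)ᶜ = ⋃ k ∈ s.filter (fun k => ¬ b k k0), A k := by
    ext t
    simp only [Set.mem_compl_iff, Set.mem_iUnion, Finset.mem_filter, A, Set.mem_ofPred_eq]
    obtain ⟨⟨⟨e1, -⟩, -⟩, k1, hk1, e2⟩ := hall t.2
    constructor
    · intro hn
      refine ⟨k1, ⟨hk1, fun hbk => hn ?_⟩, e2⟩
      rw [e2]; exact (e1 k1 hk1 k0 hk0).2 hbk
    · rintro ⟨k, ⟨hk, hbk⟩, e3⟩ e4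
      exact hbk ((e1 k hk k0 hk0).1 (e3.symm.trans e4))
  have hop : IsOpen (A k0) := by
    rw [← isClosed_compl_iff, hcompl]
    refine Set.Finite.isClosed_biUnion (Finset.finite_toSet _) ?_
    intro k hk
    exact hA k (Finset.mem_filter.1 hk).1
  have huniv := IsClopen.eq_univ ⟨hA k0 hk0, hop⟩ ⟨t0, ht0⟩
  refine ⟨k0, hk0, ?_⟩
  filter_upwards [Ioo_mem_nhdsGT hε] with t ht
  have : (⟨t, ht⟩ : Set.Ioo (0:ℝ) ε) ∈ A k0 := by rw [huniv]; trivial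
  exact this

lemma final_abs {n : ℕ} {κ : Type*} [Finite κ] (F : κ → ℝ × (Fin n → ℝ) → ℝ) (hF : ∀ j p, AnalyticAt ℝ (F j) p)
    {μ0 : ℝ} (hμ0 : 0 < μ0) {x : ℝ → Fin n → ℝ} (hcont : ContinuousOn x (Set.Ioo 0 μ0))
    (hbdd : ∃ R, ∀ μ ∈ Set.Ioo 0 μ0, ‖x μ‖ ≤ R)
    (hsol : ∀ μ ∈ Set.Ioo 0 μ0, (∀ j, F j (μ, x μ) = 0) ∧
      ∀ᶠ y in 𝓝 (x μ), (∀ j, F j (μ, y) = 0) → y = x μ) :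
    ∃ ρ : ℕ, 0 < ρ ∧ ∃ ε > 0, ∃ y : ℝ → Fin n → ℝ, AnalyticOnNhd ℝ y (Set.Ioo (-ε) ε) ∧
      ∀ μ ∈ Set.Ioo 0 ε, μ ^ ρ < μ0 ∧ y μ = x (μ ^ ρ) := by
  classical
  have hU : ∀ U : Ultrafilter ℝ, (U : Filter ℝ) ≤ 𝓝[>] 0 →
      ∃ k : {k : ℕ × (ℝ → Fin n → ℝ) // 0 < k.1 ∧ AnalyticAt ℝ k.2 0},
        {μ : ℝ | x μ = k.1.2 (μ ^ ((k.1.1 : ℝ)⁻¹))} ∈ U := by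
    intro U hU
    have hIoo : ∀ᶠ μ in (U : Filter ℝ), μ ∈ Set.Ioo 0 μ0 := hU (Ioo_mem_nhdsGT hμ0)
    obtain ⟨R, hR⟩ := hbdd
    obtain ⟨a, -, ha⟩ := (isCompact_closedBall (0 : Fin n → ℝ) R).ultrafilter_le_nhds (U.map x) (by
      rw [le_principal_iff]
      show ∀ᶠ μ in (U : Filter ℝ), x μ ∈ Metric.closedBall (0 : Fin n → ℝ) R
      filter_upwards [hIoo] with μ hμ
      rw [mem_closedBall_zero_iff]
      exact hR μ hμ)
    have ha : Tendsto x U (𝓝 a) := ha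
    have htr : ∀ p, AnalyticAt ℝ (fun p : ℝ × (Fin n → ℝ) => (p.1, p.2 + a)) p := fun p =>
      analyticAt_fst.prod (analyticAt_snd.add analyticAt_const)
    obtain ⟨ρ, y, h1, h2, h3⟩ := curve0 hU (x := fun μ => x μ - a) (by simpa using ha.sub_const a)
      (fun j p => F j (p.1, p.2 + a)) (fun j => AnalyticAt.fun_comp (hF j _) (htr 0)) (by
        filter_upwards [hIoo] with μ hμ
        obtain ⟨e1, e2⟩ := hsol μ hμ
        refine ⟨by simpa using e1, ?_⟩
        have ht : Tendsto (fun y : Fin n → ℝ => y + a) (𝓝 (x μ - a)) (𝓝 (x μ)) := by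
          have : ContinuousAt (fun y : Fin n → ℝ => y + a) (x μ - a) := by fun_prop
          simpa [ContinuousAt] using this
        filter_upwards [ht.eventually e2] with y hy hy2
        exact eq_sub_of_add_eq (hy hy2))
    refine ⟨⟨(ρ, fun s => y s + a), h1, h2.add analyticAt_const⟩, ?_⟩
    filter_upwards [h3] with μ hμ
    exact sub_eq_iff_eq_add.1 hμ
  obtain ⟨s, hs⟩ := uf_cover _ _ hU
  set ρ := ∏ k ∈ s, k.1.1 with hρ
  have hρ0 : 0 < ρ := Finset.prod_pos fun k _ => k.2.1
  have hdvd : ∀ k ∈ s, k.1.1 * (ρ / k.1.1) = ρ := fun k hk => Nat.mul_div_cancel' (Finset.dvd_prod_of_mem _ hk)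
  have hdne : ∀ k ∈ s, ρ / k.1.1 ≠ 0 := fun k hk h => by
    have := hdvd k hk
    rw [h] at this; omega
  have hpw : Tendsto (fun t : ℝ => t ^ ρ) (𝓝[>] 0) (𝓝[>] 0) := by
    refine tendsto_nhdsWithin_iff.2 ⟨?_, ?_⟩
    · have : Tendsto (fun t : ℝ => t ^ ρ) (𝓝 0) (𝓝 0) := by
        have := (continuous_pow (M := ℝ) ρ).tendsto 0
        rwa [zero_pow hρ0.ne'] at this
      exact this.mono_left nhdsWithin_le_nhds
    · filter_upwards [self_mem_nhdsWithin] with t ht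
      exact pow_pos (show (0:ℝ) < t from ht) ρ
  obtain ⟨ε1, hε1, hsub⟩ := (mem_nhdsGT_iff_exists_Ioo_subset).1 (hpw (Ioo_mem_nhdsGT hμ0))
  have hε1 : 0 < ε1 := hε1
  obtain ⟨k, hk, hfin⟩ := select s (fun k t => k.1.2 (t ^ (ρ / k.1.1)))
    (fun k hk => acomp k.2.2 (analyticAt_id.pow _) (by simp [hdne k hk]))
    (fun t => x (t ^ ρ)) hε1 (hcont.comp (continuous_pow ρ).continuousOn hsub) (by
      filter_upwards [hpw.eventually hs, self_mem_nhdsWithin] with t ht ht0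
      obtain ⟨k, hk, e⟩ := ht
      refine ⟨k, hk, ?_⟩
      have e : x (t ^ ρ) = _ := e
      rw [e]
      congr 1
      have ht0 : 0 < t := ht0
      have h1 := hdvd k hk
      rw [← Real.pow_rpow_inv_natCast (pow_nonneg ht0.le (ρ / k.1.1)) k.2.1.ne', ← pow_mul, mul_comm (ρ / k.1.1), h1])
  have hya : AnalyticAt ℝ (fun t => k.1.2 (t ^ (ρ / k.1.1))) 0 :=
    acomp k.2.2 (analyticAt_id.pow _) (by simp [hdne k hk])
  obtain ⟨ε2, hε2, hball⟩ := Metric.eventually_nhds_iff_ball.1 hya.eventually_analyticAt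
  obtain ⟨ε3, hε3, hsub3⟩ := (mem_nhdsGT_iff_exists_Ioo_subset).1 hfin
  have hε3 : 0 < ε3 := hε3
  refine ⟨ρ, hρ0, min ε1 (min ε2 ε3), lt_min hε1 (lt_min hε2 hε3), fun t => k.1.2 (t ^ (ρ / k.1.1)), ?_, ?_⟩
  · intro t ht
    apply hball
    rw [Real.ball_eq_Ioo]
    have h2 : min ε1 (min ε2 ε3) ≤ ε2 := (min_le_right _ _).trans (min_le_left _ _)
    exact ⟨by linarith [ht.1], by linarith [ht.2]⟩
  · intro t ht
    have h1 : t < ε1 := ht.2.trans_le (min_le_left _ _)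
    have h3 : t < ε3 := ht.2.trans_le ((min_le_right _ _).trans (min_le_right _ _))
    exact ⟨(hsub ⟨ht.1, h1⟩).2, (hsub3 ⟨ht.1, h3⟩).symm⟩
end P9


/-- For globally real-analytic data `f, g_1,…,g_r : ℝ^n → ℝ`, a bounded
critical path `x(μ)` of the log-barrier function admits an analytic reparametrization: for
some positive integer `ρ`, the map `μ ↦ x(μ^ρ)` extends to a real-analytic map on `(−ε,ε)`. -/
theorem analytic_critical_path_analytic_reparam (n r : ℕ)
    (f : (Fin n → ℝ) → ℝ) (g : Fin r → (Fin n → ℝ) → ℝ)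
    (hf : AnalyticOnNhd ℝ f Set.univ) (hg : ∀ i, AnalyticOnNhd ℝ (g i) Set.univ)
    (μ0 : ℝ) (hμ0 : 0 < μ0)
    (x : ℝ → Fin n → ℝ) (hcont : ContinuousOn x (Set.Ioo 0 μ0))
    (hbdd : ∃ R : ℝ, ∀ μ ∈ Set.Ioo (0 : ℝ) μ0, ‖x μ‖ ≤ R)
    (hpath : ∀ μ ∈ Set.Ioo (0 : ℝ) μ0,
      (∀ i, 0 < g i (x μ)) ∧
      (∀ j, fderiv ℝ f (x μ) (Pi.single j 1) =
        μ * ∑ i, fderiv ℝ (g i) (x μ) (Pi.single j 1) / g i (x μ)) ∧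
      ∃ δ > (0 : ℝ), ∀ y : Fin n → ℝ,
        ((∀ i, 0 < g i y) ∧
          ∀ j, fderiv ℝ f y (Pi.single j 1) =
            μ * ∑ i, fderiv ℝ (g i) y (Pi.single j 1) / g i y) →
        dist y (x μ) < δ → y = x μ) :
    ∃ ρ : ℕ, 0 < ρ ∧ ∃ ε > (0 : ℝ), ∃ y : ℝ → Fin n → ℝ,
      AnalyticOnNhd ℝ y (Set.Ioo (-ε) ε) ∧
      ∀ μ ∈ Set.Ioo (0 : ℝ) ε, μ ^ ρ < μ0 ∧ y μ = x (μ ^ ρ) := by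
  classical
  have hfd : ∀ (h : (Fin n → ℝ) → ℝ), AnalyticOnNhd ℝ h Set.univ → ∀ (j : Fin n) (p : ℝ × (Fin n → ℝ)),
      AnalyticAt ℝ (fun p : ℝ × (Fin n → ℝ) => fderiv ℝ h p.2 (Pi.single j 1)) p := by
    intro h hh j p
    have h1 : AnalyticAt ℝ (fun y => fderiv ℝ h y (Pi.single j 1)) p.2 :=
      (ContinuousLinearMap.analyticAt
        (ContinuousLinearMap.apply ℝ ℝ (Pi.single j (1:ℝ) : Fin n → ℝ)) (fderiv ℝ h p.2)).fun_comp
        (f := fun y => fderiv ℝ h y) (hh p.2 trivial).fderiv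
    exact AnalyticAt.fun_comp (f := fun p : ℝ × (Fin n → ℝ) => p.2) h1 analyticAt_snd
  have hg2 : ∀ i (p : ℝ × (Fin n → ℝ)), AnalyticAt ℝ (fun p : ℝ × (Fin n → ℝ) => g i p.2) p :=
    fun i p => AnalyticAt.fun_comp (f := fun p : ℝ × (Fin n → ℝ) => p.2) (hg i p.2 trivial) analyticAt_snd
  let F : Fin n → ℝ × (Fin n → ℝ) → ℝ := fun j p =>
    fderiv ℝ f p.2 (Pi.single j 1) * ∏ i, g i p.2 -
      p.1 * ∑ i, fderiv ℝ (g i) p.2 (Pi.single j 1) * ∏ k ∈ Finset.univ.erase i, g k p.2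
  have hF : ∀ j p, AnalyticAt ℝ (F j) p := by
    intro j p
    refine ((hfd f hf j p).mul (Finset.analyticAt_fun_prod _ fun i _ => hg2 i p)).sub
      (analyticAt_fst.mul (Finset.analyticAt_fun_sum _ fun i _ =>
        (hfd (g i) (hg i) j p).mul (Finset.analyticAt_fun_prod _ fun i _ => hg2 i p)))
  have key : ∀ (μ : ℝ) (y : Fin n → ℝ) (j : Fin n), (∀ i, 0 < g i y) →
      (F j (μ, y) = 0 ↔ fderiv ℝ f y (Pi.single j 1) =
        μ * ∑ i, fderiv ℝ (g i) y (Pi.single j 1) / g i y) := by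
    intro μ y j hy
    have hP : 0 < ∏ i, g i y := Finset.prod_pos fun i _ => hy i
    have e : F j (μ, y) = (∏ i, g i y) * (fderiv ℝ f y (Pi.single j 1) -
        μ * ∑ i, fderiv ℝ (g i) y (Pi.single j 1) / g i y) := by
      have e2 : ∑ i, fderiv ℝ (g i) y (Pi.single j 1) * ∏ k ∈ Finset.univ.erase i, g k y =
          (∏ i, g i y) * ∑ i, fderiv ℝ (g i) y (Pi.single j 1) / g i y := by
        rw [Finset.mul_sum]
        refine Finset.sum_congr rfl fun i _ => ?_
        rw [← Finset.mul_prod_erase Finset.univ (fun k => g k y) (Finset.mem_univ i)]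
        have := (hy i).ne'
        field_simp
      show fderiv ℝ f y (Pi.single j 1) * ∏ i, g i y - μ * ∑ i, fderiv ℝ (g i) y (Pi.single j 1) *
        ∏ k ∈ Finset.univ.erase i, g k y = _
      rw [e2]; ring
    rw [e, mul_eq_zero, or_iff_right hP.ne', sub_eq_zero]
  refine final_abs F hF hμ0 hcont hbdd ?_
  intro μ hμ
  obtain ⟨h1, h2, δ, hδ, h3⟩ := hpath μ hμ
  refine ⟨fun j => (key μ (x μ) j h1).2 (h2 j), ?_⟩
  have hpos : ∀ᶠ y in nhds (x μ), ∀ i, 0 < g i y := by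
    rw [Filter.eventually_all]
    intro i
    exact (hg i (x μ) trivial).continuousAt.eventually_const_lt (h1 i)
  filter_upwards [hpos, Metric.ball_mem_nhds (x μ) hδ] with y hy hd hz
  exact h3 y ⟨hy, fun j => (key μ y j hy).1 (hz j)⟩ hd
end

section
/- Let f, g_1,…,g_r ∈ ℝ[X_1,…,X_n], let a > 0, and let x : (0,a) → ℝ^n be a critical path: x is continuous and for every μ ∈ (0,a), x(μ) satisfies g_i(x(μ)) > 0 for all i, ∇f(x(μ)) = μ·Σ_{i=1}^r ∇g_i(x(μ))/g_i(x(μ)), and x(μ) is an isolated point of the set of all such solutions. Then there exists a' ∈ (0,a] such that x is real-analytic on the interval (0,a'). (Real-number form of the proposition that a critical path is a Nash — hence, over ℝ, analytic — mapping for sufficiently small μ > 0.) -/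
open Polynomial in
lemma cp_analytic (P : ℝ[X][X]) (u : ℝ → ℝ) (μ0 : ℝ) (hu : ContinuousAt u μ0)
    (h0 : ∀ᶠ μ in nhds μ0, P.evalEval μ (u μ) = 0)
    (h1 : (derivative P).evalEval μ0 (u μ0) ≠ 0) : AnalyticAt ℝ u μ0 := by
  have hcd : ∀ Q : ℝ[X][X], ContDiff ℝ ⊤ (fun z : ℝ × ℝ => Q.evalEval z.1 z.2) := by
    intro Q
    induction Q using Polynomial.induction_on' with
    | add p q hp hq => simpa using hp.add hq
    | monomial k a =>
      simp only [evalEval, eval_monomial, eval_mul, eval_pow, eval_C]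
      have : ContDiff ℝ ⊤ (fun x : ℝ => a.eval x) := by
        simpa using Polynomial.contDiff_aeval (𝕜 := ℝ) a ⊤ 
      exact (this.comp contDiff_fst).mul (contDiff_snd.pow k)
  have hd : HasDerivAt (fun t => P.evalEval μ0 t) ((derivative P).evalEval μ0 (u μ0)) (u μ0) := by
    have h := (P.map (evalRingHom μ0)).hasDerivAt (u μ0)
    have e : ∀ (Q : ℝ[X][X]) t, (Q.map (evalRingHom μ0)).eval t = Q.evalEval μ0 t := by
      intro Q t
      rw [Polynomial.eval_map, ← coe_evalEvalRingHom, evalEvalRingHom_eq]; rfl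
    simpa only [derivative_map, e] using h
  let z0 : ℝ × ℝ := (μ0, u μ0)
  let Φ : ℝ × ℝ → ℝ × ℝ := fun z => (z.1, P.evalEval z.1 z.2)
  have hΦ : ContDiffAt ℝ ⊤ Φ z0 := (contDiff_fst.prodMk (hcd P)).contDiffAt
  have hP : DifferentiableAt ℝ (fun z : ℝ × ℝ => P.evalEval z.1 z.2) z0 :=
    (hcd P).contDiffAt.differentiableAt (by simp)
  obtain ⟨L, hL⟩ := hP
  have hL1 : L (0, 1) = (derivative P).evalEval μ0 (u μ0) := by
    have hc : HasDerivAt (fun t : ℝ => (μ0, t)) ((0 : ℝ), (1 : ℝ)) (u μ0) :=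
      (hasDerivAt_const _ _).prodMk (hasDerivAt_id _)
    exact (HasFDerivAt.comp_hasDerivAt (u μ0) (hl := hL) hc).unique hd
  let L' : ℝ × ℝ →L[ℝ] ℝ × ℝ := (ContinuousLinearMap.fst ℝ ℝ ℝ).prod L
  have hL' : HasFDerivAt Φ L' z0 := hasFDerivAt_fst.prodMk hL
  have hLsplit : ∀ v : ℝ × ℝ, L v = v.1 * L (1, 0) + v.2 * L (0, 1) := by
    intro v
    have : v = v.1 • ((1 : ℝ), (0 : ℝ)) + v.2 • ((0 : ℝ), (1 : ℝ)) := by ext <;> simp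
    conv_lhs => rw [this]
    rw [map_add, map_smul, map_smul]; rfl
  have hinj : Function.Injective L' := by
    rw [injective_iff_map_eq_zero]
    intro v hv
    have hv1 : v.1 = 0 := congrArg Prod.fst hv
    have hv2 : L v = 0 := congrArg Prod.snd hv
    rw [hLsplit, hv1, hL1] at hv2
    ext
    · exact hv1
    · simpa [h1] using hv2
  let e : (ℝ × ℝ) ≃L[ℝ] (ℝ × ℝ) :=
    (LinearEquiv.ofInjectiveEndo (L' : ℝ × ℝ →ₗ[ℝ] ℝ × ℝ) hinj).toContinuousLinearEquiv
  have he : (e : ℝ × ℝ →L[ℝ] ℝ × ℝ) = L' := by ext <;> rfl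
  have hL'' : HasFDerivAt Φ (e : ℝ × ℝ →L[ℝ] ℝ × ℝ) z0 := by rw [he]; exact hL'
  have hinv := hΦ.to_localInverse hL'' (by simp)
  have hst := hΦ.hasStrictFDerivAt' hL'' (by simp)
  have hleft := hst.eventually_left_inverse
  have hz0 : Φ z0 = (μ0, 0) := by
    simp only [Φ, z0]; rw [h0.self_of_nhds]
  have hcu : Filter.Tendsto (fun μ => (μ, u μ)) (nhds μ0) (nhds z0) :=
    (continuousAt_id.prodMk hu)
  rw [hz0] at hinv
  have hA : AnalyticAt ℝ (hΦ.localInverse hL'' (by simp)) (μ0, 0) := hinv.analyticAt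
  have hB : AnalyticAt ℝ (fun μ : ℝ => (μ, (0 : ℝ))) μ0 := analyticAt_id.prod analyticAt_const
  have hC := (analyticAt_snd.comp (AnalyticAt.fun_comp hA hB) : AnalyticAt ℝ _ μ0)
  refine hC.congr ?_
  filter_upwards [hcu.eventually hleft, h0] with μ h2 h3
  simp only [Φ, h3] at h2
  exact congrArg Prod.snd h2

open Polynomial in
lemma cp_lead (p : ℝ[X][X][X]) (hp : p ≠ 0) : ∃ P : ℝ[X][X], P ≠ 0 ∧
    ∀ (μ t0 : ℝ) (t : ℝ → ℝ), Filter.Tendsto t Filter.atTop (nhds t0) →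
    (∀ᶠ δ in Filter.atTop, eval₂ (eval₂RingHom (evalRingHom μ) δ) (t δ) p = 0) →
    P.evalEval μ t0 = 0 := by
  let W : ℝ[X][X][X] := Bivariate.swap p
  have hW : W ≠ 0 := by simpa [W] using hp
  refine ⟨W.leadingCoeff, leadingCoeff_ne_zero.2 hW, ?_⟩
  intro μ t0 t ht hz
  have hswap : ∀ δ s : ℝ, eval₂ (eval₂RingHom (evalRingHom μ) δ) s p
      = eval₂ (eval₂RingHom (evalRingHom μ) s) δ W := by
    intro δ s
    have : (eval₂RingHom (eval₂RingHom (evalRingHom μ) s) δ).comp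
        ((Bivariate.swap (R := ℝ[X]) : ℝ[X][X][X] →ₐ[ℝ[X]] ℝ[X][X][X]) : ℝ[X][X][X] →+* ℝ[X][X][X])
        = eval₂RingHom (eval₂RingHom (evalRingHom μ) δ) s := by
      ext <;> simp [Bivariate.swap_apply]
    exact (RingHom.congr_fun this p).symm
  have hev : ∀ (Q : ℝ[X][X]) (s : ℝ), eval₂RingHom (evalRingHom μ) s Q = Q.evalEval μ s := by
    intro Q s
    rw [← coe_evalEvalRingHom, evalEvalRingHom_eq]
  have hcts : ∀ Q : ℝ[X][X], Continuous fun s => Q.evalEval μ s := by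
    intro Q
    simp_rw [← hev, coe_eval₂RingHom, ← eval_map]
    exact Polynomial.continuous _
  set N := W.natDegree with hN
  have hlim : Filter.Tendsto (fun δ : ℝ => ∑ k ∈ Finset.range (N + 1),
      (W.coeff k).evalEval μ (t δ) * (δ ^ k / δ ^ N)) Filter.atTop
      (nhds (∑ k ∈ Finset.range (N + 1),
        (W.coeff k).evalEval μ t0 * (if k = N then 1 else 0))) := by
    refine tendsto_finsetSum _ fun k hk => ?_
    refine (((hcts _).tendsto t0).comp ht).mul ?_
    split_ifs with h
    · subst h
      refine tendsto_const_nhds.congr' ?_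
      filter_upwards [Filter.eventually_gt_atTop 0] with δ hδ
      field_simp
    · exact tendsto_pow_div_pow_atTop_zero (by
        have := Finset.mem_range.1 hk
        omega)
  have hzero : ∀ᶠ δ : ℝ in Filter.atTop, ∑ k ∈ Finset.range (N + 1),
      (W.coeff k).evalEval μ (t δ) * (δ ^ k / δ ^ N) = 0 := by
    filter_upwards [hz] with δ hδ
    rw [hswap, eval₂_eq_sum_range] at hδ
    simp_rw [hev] at hδ
    simp_rw [← mul_div_assoc]
    rw [← Finset.sum_div, hδ, zero_div]
  have := tendsto_nhds_unique (hlim.congr' hzero) tendsto_const_nhds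
  have h5 : (W.coeff N).evalEval μ t0 = 0 := by
    simpa [Finset.sum_range_succ, Finset.sum_ite_eq] using this
  exact h5

open Polynomial in
lemma cp_germ (u : ℝ → ℝ) (P : ℝ[X][X]) (hP0 : P ≠ 0)
    (hP : ∀ᶠ μ in nhdsWithin 0 (Set.Ioi 0), P.evalEval μ (u μ) = 0) :
    ∃ M : ℝ[X][X], ∀ᶠ μ in nhdsWithin (0 : ℝ) (Set.Ioi 0), M.evalEval μ (u μ) = 0 ∧
      (derivative M).evalEval μ (u μ) ≠ 0 := by
  let l : Filter ℝ := nhdsWithin 0 (Set.Ioi 0)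
  let B := Filter.Germ l ℝ
  let π : ℝ[X] →+* (ℝ → ℝ) := RingHom.pi fun μ => evalRingHom μ
  let φ : ℝ[X] →+* B := (Filter.Germ.coeRingHom l).comp π
  have hφ : ∀ Q : ℝ[X][X], eval₂ φ ((u : ℝ → ℝ) : B) Q
      = ((fun μ => Q.evalEval μ (u μ) : ℝ → ℝ) : B) := by
    intro Q
    have h1 := (hom_eval₂ Q π (Filter.Germ.coeRingHom l) u).symm
    refine h1.trans ?_
    have : eval₂ π u Q = fun μ => Q.evalEval μ (u μ) := by
      funext μ
      have := hom_eval₂ Q π (Pi.evalRingHom (fun _ => ℝ) μ) u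
      refine this.trans ?_
      rw [← coe_evalEvalRingHom, evalEvalRingHom_eq]; rfl
    rw [this]; rfl
  have hunit : ∀ p : ℝ[X], p ≠ 0 → ∀ᶠ μ in l, p.eval μ ≠ 0 := by
    intro p hp
    have hfin : {μ | p.eval μ = 0}.Finite := by
      simpa [IsRoot] using p.finite_setOfPred_isRoot hp
    have h2 : ∀ᶠ μ in nhdsWithin (0 : ℝ) {0}ᶜ, p.eval μ ≠ 0 := by
      have := hfin.isClosed
      have h3 : ({μ | p.eval μ = 0} \ {0}).Finite := hfin.sdiff
      have h4 : ({μ | p.eval μ = 0} \ {0})ᶜ ∈ nhds (0 : ℝ) :=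
        h3.isClosed.isOpen_compl.mem_nhds (by simp)
      filter_upwards [mem_nhdsWithin_of_mem_nhds h4, self_mem_nhdsWithin] with μ h5 h6 h7
      exact h5 ⟨h7, h6⟩
    exact h2.filter_mono (nhdsWithin_mono _ fun y (hy : 0 < y) => ne_of_gt hy)
  have hisU : ∀ s : nonZeroDivisors ℝ[X], IsUnit (φ s) := by
    intro s
    have h1 := hunit s (nonZeroDivisors.coe_ne_zero s)
    refine IsUnit.of_mul_eq_one (((fun μ => ((s : ℝ[X]).eval μ)⁻¹) : ℝ → ℝ) : B) ?_
    refine Filter.Germ.coe_eq.2 ?_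
    filter_upwards [h1] with μ h
    exact mul_inv_cancel₀ h
  let K := FractionRing ℝ[X]
  let ψ : K →+* B := IsLocalization.lift hisU
  have hψ : ψ.comp (algebraMap ℝ[X] K) = φ := IsLocalization.lift_comp hisU
  let _ : Algebra K B := ψ.toAlgebra
  have hred : IsReduced B := by
    refine ⟨fun b hb => ?_⟩
    obtain ⟨k, hk⟩ := hb
    induction b using Filter.Germ.inductionOn with
    | _ f =>
    have hk' : ((f ^ k : ℝ → ℝ) : B) = ((0 : ℝ → ℝ) : B) := hk
    refine Filter.Germ.coe_eq.2 ?_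
    filter_upwards [Filter.Germ.coe_eq.1 hk'] with μ hμ
    exact eq_zero_of_pow_eq_zero (n := k) (by simpa using hμ)
  have hae : ∀ Q : ℝ[X][X], aeval ((u : ℝ → ℝ) : B) (Q.map (algebraMap ℝ[X] K))
      = ((fun μ => Q.evalEval μ (u μ) : ℝ → ℝ) : B) := by
    intro Q
    rw [← hφ, aeval_def, eval₂_map]
    congr 1
  have halg : IsIntegral K ((u : ℝ → ℝ) : B) := by
    refine (isAlgebraic_iff_isIntegral).1 ⟨P.map (algebraMap ℝ[X] K), ?_, ?_⟩
    · rwa [Ne, Polynomial.map_eq_zero_iff (IsFractionRing.injective _ _)]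
    · rw [hae]
      exact Filter.Germ.coe_eq.2 hP
  set m := minpoly K ((u : ℝ → ℝ) : B) with hm
  have hm0 : m ≠ 0 := minpoly.ne_zero halg
  have hsep : m.Separable := PerfectField.separable_iff_squarefree.2
    ((minpoly.isRadical K _).squarefree hm0)
  obtain ⟨c, d, hcd⟩ := hsep
  obtain ⟨b, hb⟩ := IsLocalization.integerNormalization_map_to_map (nonZeroDivisors ℝ[X]) m
  set M := IsLocalization.integerNormalization (nonZeroDivisors ℝ[X]) m
  have hbm : M.map (algebraMap ℝ[X] K) = C (algebraMap ℝ[X] K b) * m := by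
    rw [hb, ← smul_eq_C_mul, algebraMap_smul]
  have hM0 : ((fun μ => M.evalEval μ (u μ) : ℝ → ℝ) : B) = 0 := by
    rw [← hae, hbm, map_mul, minpoly.aeval, mul_zero]
  have hM1 : IsUnit ((fun μ => (derivative M).evalEval μ (u μ) : ℝ → ℝ) : B) := by
    rw [← hae, ← derivative_map, hbm, derivative_C_mul, map_mul]
    refine IsUnit.mul ?_ ?_
    · rw [aeval_C]
      have : algebraMap K B (algebraMap ℝ[X] K b) = φ b := RingHom.congr_fun hψ b
      rw [this]; exact hisU b
    · have := congrArg (aeval ((u : ℝ → ℝ) : B)) hcd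
      rw [map_add, map_mul, map_mul, minpoly.aeval, mul_zero, zero_add, map_one] at this
      exact IsUnit.of_mul_eq_one _ ((mul_comm _ _).trans this)
  refine ⟨M, ?_⟩
  obtain ⟨v, hv⟩ := hM1.exists_right_inv
  induction v using Filter.Germ.inductionOn with
  | _ w =>
  filter_upwards [Filter.Germ.coe_eq.1 hM0, Filter.Germ.coe_eq.1 hv] with μ h1 h2
  refine ⟨h1, fun h3 => ?_⟩
  simp [h3] at h2

section
open MvPolynomial

lemma cp_int {R A : Type*} [CommRing R] [CommRing A] [Algebra R A] {n : ℕ} (y : Fin n → A)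
    (D : ℕ) (h : Fin n → MvPolynomial (Fin n) R) (hd : ∀ i, (h i).totalDegree < D)
    (hy : ∀ i, y i ^ D = aeval y (h i)) (j : Fin n) : IsIntegral R (y j) := by
  classical
  let M : Submodule R A := Submodule.span R
    (Set.range fun β : Fin n → Fin D => ∏ i, y i ^ (β i : ℕ))
  have key : ∀ N : ℕ, ∀ α : Fin n → ℕ, ∑ i, α i = N → ∏ i, y i ^ α i ∈ M := by
    intro N
    induction N using Nat.strong_induction_on with
    | _ N ih =>
    intro α hα
    by_cases hlt : ∀ i, α i < D
    · exact Submodule.subset_span ⟨fun i => ⟨α i, hlt i⟩, rfl⟩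
    · push Not at hlt
      obtain ⟨i0, hi0⟩ := hlt
      let γ : Fin n → ℕ := fun i => if i = i0 then α i - D else α i
      have hαγ : ∀ i, α i = γ i + if i = i0 then D else 0 := by
        intro i
        by_cases hi : i = i0
        · subst hi; simp [γ]; omega
        · simp [γ, hi]
      have h1 : ∏ i, y i ^ α i = (∏ i, y i ^ γ i) * y i0 ^ D := by
        simp_rw [hαγ, pow_add, Finset.prod_mul_distrib]
        congr 1
        rw [Finset.prod_eq_single i0] <;> simp +contextual
      have hs : ∑ i, γ i + D = N := by
        rw [← hα]
        simp_rw [hαγ, Finset.sum_add_distrib]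
        simp
      rw [h1, hy, aeval_def, eval₂_eq', Finset.mul_sum]
      refine Submodule.sum_mem _ fun d hdm => ?_
      have h2 : (∏ i, y i ^ γ i) * (algebraMap R A (coeff d (h i0)) * ∏ i, y i ^ d i)
          = (coeff d (h i0)) • ∏ i, y i ^ (γ i + d i) := by
        simp_rw [pow_add, Finset.prod_mul_distrib, Algebra.smul_def]
        ring
      rw [h2]
      refine Submodule.smul_mem _ _ (ih _ ?_ _ rfl)
      have h3 := le_totalDegree hdm
      rw [Finsupp.sum_fintype _ _ (by simp)] at h3
      have h4 := hd i0
      rw [Finset.sum_add_distrib]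
      omega
  have hM : (aeval (R := R) y).range.toSubmodule ≤ M := by
    rintro _ ⟨p, rfl⟩
    simp only [AlgHom.toRingHom_eq_coe, RingHom.coe_coe, aeval_def, eval₂_eq']
    refine Submodule.sum_mem _ fun d _ => ?_
    rw [← Algebra.smul_def]
    exact Submodule.smul_mem _ _ (key _ _ rfl)
  have hM' : M ≤ (aeval (R := R) y).range.toSubmodule := by
    refine Submodule.span_le.2 ?_
    rintro _ ⟨β, rfl⟩
    exact ⟨∏ i, X i ^ (β i : ℕ), by simp⟩
  refine IsIntegral.of_mem_of_fg (aeval (R := R) y).range ?_ _ ⟨X j, by simp⟩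
  rw [le_antisymm hM hM']
  exact Submodule.fg_span (Set.finite_range _)

lemma cp_deriv {n : ℕ} (G : MvPolynomial (Fin n) ℝ) (y : Fin n → ℝ) (i : Fin n) :
    HasDerivAt (fun t => eval (Function.update y i t) G) (eval y (pderiv i G)) (y i) := by
  induction G using MvPolynomial.induction_on with
  | C a => simpa using hasDerivAt_const _ _
  | add p q hp hq => simpa using hp.fun_add hq
  | mul_X p k hp =>
    have hk : HasDerivAt (fun t => Function.update y i t k) (eval y (pderiv i (X k))) (y i) := by
      by_cases h : k = i
      · subst h; simpa using hasDerivAt_id' (y k)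
      · simpa [pderiv_X_of_ne h, Function.update_of_ne h] using hasDerivAt_const _ _
    have := hp.mul hk
    simp only [Function.update_eq_self] at this
    simp only [Derivation.leibniz, map_mul, eval_X, map_add, smul_eq_mul]
    convert! this using 1
    ring

lemma cp_min {n : ℕ} (q : MvPolynomial (Fin n) ℝ) (x0 : Fin n → ℝ) (ρ : ℝ) (hρ : 0 < ρ)
    (hq0 : eval x0 q = 0) (hnn : ∀ y, 0 ≤ eval y q)
    (hpos : ∀ y, dist y x0 ≤ ρ → eval y q = 0 → y = x0) (m : ℕ) :
    ∃ z : ℝ → Fin n → ℝ, Filter.Tendsto z Filter.atTop (nhds x0) ∧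
      ∀ᶠ δ in Filter.atTop, ∀ i, (z δ i) ^ (2 * m + 1) = - δ * eval (z δ) (pderiv i q) := by
  classical
  let c : ℝ := (2 * m + 2 : ℝ)⁻¹
  let E : MvPolynomial (Fin n) ℝ := ∑ i, C c * X i ^ (2 * m + 2)
  let G : ℝ → MvPolynomial (Fin n) ℝ := fun δ => C δ * q + E
  have hc : 0 < c := by positivity
  have hE : ∀ y, 0 ≤ eval y E := by
    intro y
    simp only [E, map_sum, map_mul, eval_C, map_pow, eval_X]
    refine Finset.sum_nonneg fun i _ => mul_nonneg hc.le ?_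
    exact Even.pow_nonneg ⟨m + 1, by ring⟩ _
  have hG : ∀ δ y, eval y (G δ) = δ * eval y q + eval y E := by intro δ y; simp [G]
  have hdG : ∀ δ y i, eval y (pderiv i (G δ)) = δ * eval y (pderiv i q) + y i ^ (2 * m + 1) := by
    intro δ y i
    have : eval y (pderiv i E) = y i ^ (2 * m + 1) := by
      simp only [E, map_sum, Derivation.leibniz, Derivation.leibniz_pow, pderiv_C]
      rw [Finset.sum_eq_single i]
      · simp
        simp only [c]
        field_simp
      · intro b _ hb
        simp [pderiv_X_of_ne hb]
      · simp
    simp [G, this]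
  have hcomp : IsCompact (Metric.closedBall x0 ρ) := isCompact_closedBall _ _
  have hne : (Metric.closedBall x0 ρ).Nonempty := ⟨x0, by simp [hρ.le]⟩
  have hcon : ∀ p : MvPolynomial (Fin n) ℝ, Continuous fun y => eval y p :=
    fun p => MvPolynomial.continuous_eval p
  choose z hz hzmin using fun δ : ℝ =>
    hcomp.exists_isMinOn hne (hcon (G δ)).continuousOn
  have hbd : ∀ δ, δ * eval (z δ) q ≤ eval x0 E := by
    intro δ
    have h1 : eval (z δ) (G δ) ≤ eval x0 (G δ) := hzmin δ (by simp [hρ.le])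
    rw [hG, hG, hq0] at h1
    have := hE (z δ)
    linarith
  have hlim : Filter.Tendsto z Filter.atTop (nhds x0) := by
    rw [Metric.tendsto_nhds]
    intro ε hε
    let K := Metric.closedBall x0 ρ ∩ {y | ε ≤ dist y x0}
    have hK : IsCompact K := hcomp.inter_right
      (isClosed_le continuous_const (continuous_id.dist continuous_const))
    by_cases hKn : K.Nonempty
    · obtain ⟨k, hk, hkmin⟩ := hK.exists_isMinOn hKn (hcon q).continuousOn
      have hkpos : 0 < eval k q := by
        refine lt_of_le_of_ne (hnn k) fun h => ?_
        have := hpos k hk.1 h.symm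
        have h2 : ε ≤ dist k x0 := hk.2
        rw [this, dist_self] at h2
        linarith
      filter_upwards [Filter.eventually_gt_atTop (eval x0 E / eval k q),
        Filter.eventually_gt_atTop 0] with δ h1 h2
      by_contra hcon2
      have h3 : eval k q ≤ eval (z δ) q := hkmin ⟨hz δ, not_lt.1 hcon2⟩
      rw [div_lt_iff₀ hkpos] at h1
      have := hbd δ
      nlinarith
    · filter_upwards with δ
      by_contra hcon2
      exact hKn ⟨z δ, hz δ, not_lt.1 hcon2⟩
  refine ⟨z, hlim, ?_⟩
  filter_upwards [hlim (Metric.ball_mem_nhds x0 hρ)] with δ hδ i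
  have hloc : IsLocalMin (fun y => eval y (G δ)) (z δ) := by
    filter_upwards [Metric.isOpen_ball.mem_nhds hδ] with y hy
    exact hzmin δ (Metric.ball_subset_closedBall hy)
  have hloc2 : IsLocalMin (fun t => eval (Function.update (z δ) i t) (G δ)) (z δ i) := by
    have hct : Filter.Tendsto (fun t => Function.update (z δ) i t) (nhds (z δ i)) (nhds (z δ)) := by
      have : Continuous fun t => Function.update (z δ) i t := by fun_prop
      simpa using this.tendsto (z δ i)
    have := hct.eventually hloc
    filter_upwards [this] with t ht
    simpa using ht
  have := hloc2.hasDerivAt_eq_zero (cp_deriv (G δ) (z δ) i)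
  rw [hdG] at this
  linarith

end

open Polynomial in
lemma cp_alg {n : ℕ} (Q : MvPolynomial (Fin n) ℝ[X]) (j : Fin n) : ∃ P : ℝ[X][X], P ≠ 0 ∧
    ∀ (μ : ℝ) (x0 : Fin n → ℝ) (ρ : ℝ), 0 < ρ →
      MvPolynomial.eval x0 (MvPolynomial.map (evalRingHom μ) Q) = 0 →
      (∀ y, 0 ≤ MvPolynomial.eval y (MvPolynomial.map (evalRingHom μ) Q)) →
      (∀ y, dist y x0 ≤ ρ → MvPolynomial.eval y (MvPolynomial.map (evalRingHom μ) Q) = 0 → y = x0) →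
      P.evalEval μ (x0 j) = 0 := by
  let h : Fin n → MvPolynomial (Fin n) ℝ[X][X] := fun i =>
    MvPolynomial.C (-X) * MvPolynomial.map C (MvPolynomial.pderiv i Q)
  let m := ∑ i, (h i).totalDegree
  let D := 2 * m + 1
  let S := {s : ℝ × ℝ × (Fin n → ℝ) // ∀ i, s.2.2 i ^ D = - s.2.1 *
    MvPolynomial.eval s.2.2 (MvPolynomial.pderiv i (MvPolynomial.map (evalRingHom s.1) Q))}
  let π : ℝ[X][X] →+* (S → ℝ) := RingHom.pi fun s => eval₂RingHom (evalRingHom s.1.1) s.1.2.1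
  let _ : Algebra ℝ[X][X] (S → ℝ) := π.toAlgebra
  let y : Fin n → S → ℝ := fun i s => s.1.2.2 i
  have hd : ∀ i, (h i).totalDegree < D := by
    intro i
    have := Finset.single_le_sum (f := fun i => (h i).totalDegree) (fun _ _ => Nat.zero_le _)
      (Finset.mem_univ i)
    simp only [D, m]
    omega
  have hy : ∀ i, y i ^ D = MvPolynomial.aeval y (h i) := by
    intro i
    funext s
    have h1 : (MvPolynomial.aeval y (h i)) s = MvPolynomial.eval₂
        ((Pi.evalRingHom (fun _ => ℝ) s).comp π) (fun i => y i s) (h i) := by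
      rw [MvPolynomial.aeval_def]
      exact MvPolynomial.eval₂_comp_left (Pi.evalRingHom (fun _ => ℝ) s) π y (h i)
    rw [h1]
    refine (s.2 i).trans ?_
    rw [MvPolynomial.eval₂_mul, MvPolynomial.eval₂_C, MvPolynomial.eval₂_map,
      MvPolynomial.pderiv_map, MvPolynomial.eval_map]
    congr 1
    · change _ = eval₂ (evalRingHom s.1.1) s.1.2.1 (-X)
      simp
    · congr 1
      refine RingHom.ext fun q => ?_
      change _ = eval₂ (evalRingHom s.1.1) s.1.2.1 (C q)
      simp
  obtain ⟨p, hpm, hp⟩ := cp_int y D h hd hy j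
  obtain ⟨P, hP0, hP⟩ := cp_lead p hpm.ne_zero
  refine ⟨P, hP0, ?_⟩
  intro μ x0 ρ hρ h0 hnn hiso
  obtain ⟨z, hz, hcrit⟩ := cp_min _ x0 ρ hρ h0 hnn hiso m
  refine hP μ (x0 j) (fun δ => z δ j) (((continuous_apply j).tendsto x0).comp hz) ?_
  filter_upwards [hcrit] with δ hδ
  have h2 := congrFun hp ⟨(μ, δ, z δ), hδ⟩
  have h3 := hom_eval₂ p π (Pi.evalRingHom (fun _ => ℝ) (⟨(μ, δ, z δ), hδ⟩ : S)) (y j)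
  exact h3.symm.trans h2

open MvPolynomial

/-- A critical path of the log-barrier function of a polynomial
optimization problem is real-analytic on `(0,a')` for some sufficiently small `a' ∈ (0,a]`. -/
theorem critical_path_analytic_near_zero (n r : ℕ) (f : MvPolynomial (Fin n) ℝ)
    (g : Fin r → MvPolynomial (Fin n) ℝ) (a : ℝ) (ha : 0 < a)
    (x : ℝ → Fin n → ℝ) (hcont : ContinuousOn x (Set.Ioo 0 a))
    (hpath : ∀ μ ∈ Set.Ioo (0 : ℝ) a,
      (∀ i, 0 < eval (x μ) (g i)) ∧
      (∀ j, eval (x μ) (pderiv j f) =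
        μ * ∑ i, eval (x μ) (pderiv j (g i)) / eval (x μ) (g i)) ∧
      ∃ δ > (0 : ℝ), ∀ y : Fin n → ℝ,
        ((∀ i, 0 < eval y (g i)) ∧
          ∀ j, eval y (pderiv j f) = μ * ∑ i, eval y (pderiv j (g i)) / eval y (g i)) →
        dist y (x μ) < δ → y = x μ) :
    ∃ a' : ℝ, 0 < a' ∧ a' ≤ a ∧ AnalyticOnNhd ℝ x (Set.Ioo 0 a') := by
  classical
  let F : Fin n → MvPolynomial (Fin n) (Polynomial ℝ) := fun j =>
    map Polynomial.C (pderiv j f * ∏ i, g i) - C Polynomial.X *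
      map Polynomial.C (∑ i, pderiv j (g i) * ∏ k ∈ Finset.univ.erase i, g k)
  let Q : MvPolynomial (Fin n) (Polynomial ℝ) := ∑ j, F j ^ 2
  have hF : ∀ (μ : ℝ) y j, eval y (map (Polynomial.evalRingHom μ) (F j)) =
      eval y (pderiv j f) * (∏ i, eval y (g i)) - μ *
        ∑ i, eval y (pderiv j (g i)) * ∏ k ∈ Finset.univ.erase i, eval y (g k) := by
    intro μ y j
    have hid : (Polynomial.evalRingHom μ).comp Polynomial.C = RingHom.id ℝ := by ext; simp
    simp only [F, map_sub, map_mul, map_C, MvPolynomial.map_map, hid, MvPolynomial.map_id]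
    simp
  have hF2 : ∀ (μ : ℝ) y, (∀ i, 0 < eval y (g i)) → ∀ j,
      (eval y (map (Polynomial.evalRingHom μ) (F j)) = 0 ↔
      eval y (pderiv j f) = μ * ∑ i, eval y (pderiv j (g i)) / eval y (g i)) := by
    intro μ y hg j
    have hprod : 0 < ∏ i, eval y (g i) := Finset.prod_pos fun i _ => hg i
    have hs : ∑ i, eval y (pderiv j (g i)) * ∏ k ∈ Finset.univ.erase i, eval y (g k)
        = (∑ i, eval y (pderiv j (g i)) / eval y (g i)) * ∏ i, eval y (g i) := by
      rw [Finset.sum_mul]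
      refine Finset.sum_congr rfl fun i _ => ?_
      rw [← Finset.mul_prod_erase Finset.univ (fun k => eval y (g k)) (Finset.mem_univ i)]
      have := (hg i).ne'
      field_simp
    rw [hF, hs, ← mul_assoc, ← sub_mul, mul_eq_zero, or_iff_left hprod.ne', sub_eq_zero]
  have hQ : ∀ (μ : ℝ) y, eval y (map (Polynomial.evalRingHom μ) Q) =
      ∑ j, (eval y (map (Polynomial.evalRingHom μ) (F j))) ^ 2 := by
    intro μ y; simp [Q]
  have hQ0 : ∀ (μ : ℝ) y, 0 ≤ eval y (map (Polynomial.evalRingHom μ) Q) := by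
    intro μ y; rw [hQ]; positivity
  have hQz : ∀ (μ : ℝ) y, eval y (map (Polynomial.evalRingHom μ) Q) = 0 ↔
      ∀ j, eval y (map (Polynomial.evalRingHom μ) (F j)) = 0 := by
    intro μ y
    rw [hQ, Finset.sum_eq_zero_iff_of_nonneg (fun _ _ => sq_nonneg _)]
    simp
  have hIoo : ∀ᶠ μ in nhdsWithin (0 : ℝ) (Set.Ioi 0), μ ∈ Set.Ioo 0 a := Ioo_mem_nhdsGT ha
  have hmain : ∀ j, ∀ᶠ μ in nhdsWithin (0 : ℝ) (Set.Ioi 0), AnalyticAt ℝ (fun μ => x μ j) μ := by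
    intro j
    obtain ⟨P, hP0, hP⟩ := cp_alg Q j
    have hPx : ∀ μ ∈ Set.Ioo 0 a, P.evalEval μ (x μ j) = 0 := by
      intro μ hμ
      obtain ⟨hg, hcrit, δ, hδ, hiso⟩ := hpath μ hμ
      have hopen : ∀ᶠ y in nhds (x μ), ∀ i, 0 < eval y (g i) := by
        rw [Filter.eventually_all]
        intro i
        exact (MvPolynomial.continuous_eval (g i)).continuousAt.eventually (lt_mem_nhds (hg i))
      obtain ⟨ε, hε, hball⟩ := Metric.eventually_nhds_iff.1 hopen
      refine hP μ (x μ) (min δ ε / 2) (by positivity) ?_ (hQ0 μ) ?_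
      · rw [hQz]; intro k; rw [hF2 μ _ hg]; exact hcrit k
      · intro y hy hy0
        have hm : 0 < min δ ε := lt_min hδ hε
        have h1 : dist y (x μ) < min δ ε := by linarith
        have hgy := hball (lt_of_lt_of_le h1 (min_le_right _ _))
        refine hiso y ⟨hgy, fun k => ?_⟩ (lt_of_lt_of_le h1 (min_le_left _ _))
        rw [← hF2 μ _ hgy]
        exact (hQz μ y).1 hy0 k
    obtain ⟨M, hM⟩ := cp_germ (fun μ => x μ j) P hP0 (hIoo.mono hPx)
    obtain ⟨b, hb, hbM⟩ := mem_nhdsGT_iff_exists_Ioo_subset.1 (hM.and hIoo)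
    filter_upwards [Ioo_mem_nhdsGT hb] with μ hμ
    refine cp_analytic M _ μ ?_ ?_ (hbM hμ).1.2
    · have h1 : ContinuousAt x μ := hcont.continuousAt (isOpen_Ioo.mem_nhds (hbM hμ).2)
      exact (continuous_apply j).continuousAt.comp h1
    · filter_upwards [isOpen_Ioo.mem_nhds hμ] with ν hν
      exact (hbM hν).1.1
  obtain ⟨b, hb, hbM⟩ := mem_nhdsGT_iff_exists_Ioo_subset.1 (Filter.eventually_all.2 hmain)
  have hb' : 0 < b := hb
  refine ⟨min b a, lt_min hb' ha, min_le_right _ _, ?_⟩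
  intro μ hμ
  exact AnalyticAt.pi fun j => hbM ⟨hμ.1, lt_of_lt_of_le hμ.2 (min_le_left _ _)⟩ j
end

section
/- Let F, P ∈ ℝ[X_1,…,X_n] with P nonconstant. Assume: (i) the top-degree homogeneous component of P has no real zero other than the origin; (ii) there exists x_0 ∈ ℝ^n with P(x_0) = 0 and ∇P(x_0) ≠ 0; and (iii) there exists c ∈ ℂ such that the set of complex projective KKT points of F on {P = c} is finite (as a subset of ℙ^n(ℂ) × ℙ^1(ℂ)). Then there exist ε > 0, r > 0, and a finite set E ⊆ ℝ such that for every ξ ∈ (0,ε) ∖ E, the set of critical points {x ∈ ℝ^n : P(x) = ξ and there exists u ∈ ℝ with ∇F(x) = u·∇P(x)} is nonempty, finite, and contained in the closed ball of radius r about the origin. (Real-number form of the corollary combining boundedness, existence, and finiteness of critical points of F on the perturbed hypersurface {P = ξ}.) -/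
open MvPolynomial

/-- The homogenization `Q^H ∈ ℂ[X_0,…,X_n]` of `Q ∈ ℂ[X_1,…,X_n]`: the unique homogeneous
polynomial of degree `deg Q` with `Q^H(1,X_1,…,X_n) = Q` (and `0^H = 0`). -/
noncomputable def homogenizeC {n : ℕ} (Q : MvPolynomial (Fin n) ℂ) :
    MvPolynomial (Fin (n + 1)) ℂ :=
  ∑ m ∈ Q.support,
    monomial
      (Finsupp.mapDomain Fin.succ m +
        Finsupp.single (0 : Fin (n + 1)) (Q.totalDegree - m.sum fun _ e => e))
      (coeff m Q)

/-- A real polynomial viewed as a complex polynomial. -/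
noncomputable def toComplex {n : ℕ} (Q : MvPolynomial (Fin n) ℝ) : MvPolynomial (Fin n) ℂ :=
  map (algebraMap ℝ ℂ) Q

/-- The bi-homogeneous polynomial
`H_j = U_0·X_0^{m_j−a_j}·(∂F/∂X_j)^H − U_1·X_0^{m_j−b_j}·(∂P/∂X_j)^H` in
`ℂ[X_0,…,X_n,U_0,U_1]` (variables indexed by `Fin (n+1) ⊕ Fin 2`). -/
noncomputable def kktH {n : ℕ} (F P : MvPolynomial (Fin n) ℝ) (j : Fin n) :
    MvPolynomial (Fin (n + 1) ⊕ Fin 2) ℂ :=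
  X (Sum.inr 0) *
      X (Sum.inl 0) ^ (max (pderiv j F).totalDegree (pderiv j P).totalDegree -
        (pderiv j F).totalDegree) *
      rename Sum.inl (homogenizeC (toComplex (pderiv j F))) -
    X (Sum.inr 1) *
      X (Sum.inl 0) ^ (max (pderiv j F).totalDegree (pderiv j P).totalDegree -
        (pderiv j P).totalDegree) *
      rename Sum.inl (homogenizeC (toComplex (pderiv j P)))

/-- The homogeneous polynomial `H_0 = P^H − c·X_0^{deg P}` in `ℂ[X_0,…,X_n,U_0,U_1]`. -/
noncomputable def kktH0 {n : ℕ} (P : MvPolynomial (Fin n) ℝ) (c : ℂ) :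
    MvPolynomial (Fin (n + 1) ⊕ Fin 2) ℂ :=
  rename Sum.inl (homogenizeC (toComplex P)) - C c * X (Sum.inl 0) ^ P.totalDegree

/-- The set of complex projective KKT points of `F` on `{P = c}`, as a subset of
`ℙ^n(ℂ) × ℙ^1(ℂ)`. -/
def projKKT {n : ℕ} (F P : MvPolynomial (Fin n) ℝ) (c : ℂ) :
    Set (Projectivization ℂ (Fin (n + 1) → ℂ) × Projectivization ℂ (Fin 2 → ℂ)) :=
  {p | ∃ (x : Fin (n + 1) → ℂ) (u : Fin 2 → ℂ) (hx : x ≠ 0) (hu : u ≠ 0),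
    p = (Projectivization.mk ℂ x hx, Projectivization.mk ℂ u hu) ∧
    (∀ j : Fin n, eval (Sum.elim x u) (kktH F P j) = 0) ∧
    eval (Sum.elim x u) (kktH0 P c) = 0}

/-- The set of Lagrange critical points of `F` on the level set `{P = ξ}`. -/
def critSet {n : ℕ} (F P : MvPolynomial (Fin n) ℝ) (ξ : ℝ) : Set (Fin n → ℝ) :=
  {x | eval x P = ξ ∧ ∃ u : ℝ, ∀ j, eval x (pderiv j F) = u * eval x (pderiv j P)}


theorem strictFD {n : ℕ} (p : MvPolynomial (Fin n) ℝ) (x : Fin n → ℝ) :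
    HasStrictFDerivAt (fun y : Fin n → ℝ => eval y p)
      (∑ j, (eval x (pderiv j p)) • (ContinuousLinearMap.proj j : (Fin n → ℝ) →L[ℝ] ℝ)) x := by
  induction p using MvPolynomial.induction_on with
  | C a => 
    simp only [eval_C, pderiv_C, map_zero, zero_smul, Finset.sum_const_zero]
    exact hasStrictFDerivAt_const _ _
  | add p q hp hq =>
    simp only [map_add, add_smul, Finset.sum_add_distrib]
    exact hp.add hq
  | mul_X p i hp =>
    have h := hp.mul (ContinuousLinearMap.proj (R := ℝ) (φ := fun _ : Fin n => ℝ) i).hasStrictFDerivAt (x := x)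
    simp only [map_mul, eval_X]
    refine h.congr_fderiv ?_
    ext v
    simp [pderiv_X, Pi.single_apply, Finset.sum_add_distrib, add_mul, Finset.mul_sum]
    simp [apply_ite, Finset.sum_ite_eq, ite_mul]
    congr 1
    funext j
    ring

theorem contEval {n : ℕ} (p : MvPolynomial (Fin n) ℝ) : Continuous (fun y : Fin n → ℝ => eval y p) :=
  MvPolynomial.continuous_eval p

theorem evalHomSmul {n k : ℕ} {Q : MvPolynomial (Fin n) ℝ} (hQ : Q.IsHomogeneous k)
    (c : ℝ) (x : Fin n → ℝ) : eval (c • x) Q = c ^ k * eval x Q := by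
  rw [eval_eq', eval_eq', Finset.mul_sum]
  refine Finset.sum_congr rfl fun m hm => ?_
  have h := hQ (mem_support_iff.1 hm)
  have h2 : ∑ i, m i = k := by
    rw [← h, Finsupp.weight_apply, Finsupp.sum_fintype] <;> simp
  simp only [Pi.smul_apply, smul_eq_mul, mul_pow, Finset.prod_mul_distrib]
  rw [Finset.prod_pow_eq_pow_sum, h2]
  ring

theorem bddLevel {n : ℕ} (P : MvPolynomial (Fin n) ℝ)
    (hP : 0 < P.totalDegree)
    (hinf : ∀ y : Fin n → ℝ, y ≠ 0 → eval y (homogeneousComponent P.totalDegree P) ≠ 0) :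
    ∃ r > (0 : ℝ), ∀ x : Fin n → ℝ, eval x P ∈ Set.Icc (0:ℝ) 1 → ‖x‖ ≤ r := by
  set d := P.totalDegree with hd
  let h : ℝ × (Fin n → ℝ) × ℝ → ℝ := fun z =>
    (∑ k ∈ Finset.range (d+1), z.1^(d-k) * eval z.2.1 (homogeneousComponent k P)) - z.2.2 * z.1^d
  have hc : Continuous h := by
    refine Continuous.sub (continuous_finsetSum _ fun k _ => ?_) (by fun_prop)
    exact (continuous_fst.pow _).mul ((contEval _).comp (by fun_prop))
  let S : Set (ℝ × (Fin n → ℝ) × ℝ) := (Set.Icc 0 1 ×ˢ Metric.sphere 0 1 ×ˢ Set.Icc 0 1) ∩ h ⁻¹' {0}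
  have hS : IsCompact S := by
    refine IsCompact.inter_right ?_ (isClosed_singleton.preimage hc)
    exact isCompact_Icc.prod ((isCompact_sphere _ _).prod isCompact_Icc)
  have hpos : ∀ z ∈ S, 0 < z.1 := by
    rintro ⟨s, y, ξ⟩ ⟨⟨⟨h0, h1⟩, hy, h2⟩, h3⟩
    rcases h0.lt_or_eq with h0 | h0
    · exact h0
    exfalso
    simp only at h0
    subst h0
    have hy1 : ‖y‖ = 1 := by simpa using hy
    apply hinf y (by rintro rfl; simp at hy1)
    have h3 : h (0, y, ξ) = 0 := h3
    simp only [h] at h3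
    rw [Finset.sum_range_succ, Finset.sum_eq_zero] at h3
    · simpa [hP.ne'] using h3
    · intro k hk
      have : d - k ≠ 0 := by have := Finset.mem_range.1 hk; omega
      simp [this]
  have key : ∀ x : Fin n → ℝ, eval x P ∈ Set.Icc (0:ℝ) 1 → 1 ≤ ‖x‖ → 
      (‖x‖⁻¹, ‖x‖⁻¹ • x, eval x P) ∈ S := by
    intro x hx h1
    have hx0 : ‖x‖ ≠ 0 := by linarith
    refine ⟨⟨⟨by positivity, inv_le_one_of_one_le₀ h1⟩, ?_, hx⟩, ?_⟩
    · simp [norm_smul, hx0]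
    · change h _ = 0
      simp only [h]
      rw [sub_eq_zero]
      conv_rhs => rw [← MvPolynomial.sum_homogeneousComponent P]
      rw [map_sum, Finset.sum_mul]
      refine Finset.sum_congr rfl fun k hk => ?_
      have hk : k ≤ d := by have := Finset.mem_range.1 hk; omega
      have : eval (‖x‖⁻¹ • x) (homogeneousComponent k P) = ‖x‖⁻¹ ^ k * eval x (homogeneousComponent k P) := by
        exact evalHomSmul (homogeneousComponent_isHomogeneous k P) _ _
      rw [this, ← mul_assoc, ← pow_add, Nat.sub_add_cancel hk, mul_comm]
  rcases S.eq_empty_or_nonempty with hE | hne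
  · refine ⟨1, one_pos, fun x hx => ?_⟩
    by_contra hlt
    have := key x hx (by linarith)
    rw [hE] at this; exact this
  · obtain ⟨z, hz, hmin⟩ := hS.exists_isMinOn hne continuous_fst.continuousOn
    have hz0 := hpos z hz
    refine ⟨max 1 z.1⁻¹, by positivity, fun x hx => ?_⟩
    rcases le_total ‖x‖ 1 with h1 | h1
    · exact h1.trans (le_max_left _ _)
    · have := hmin (key x hx h1)
      simp only [Set.mem_ofPred_eq] at this
      refine le_trans ?_ (le_max_right _ _)
      rw [le_inv_comm₀ (by linarith) hz0]
      exact this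

theorem dualTaylor {k K : Type} [Field k] [Field K] [Algebra k K] {n : ℕ}
    (φ : K →ₐ[k] TrivSqZeroExt K K) (hφ : ∀ a, (φ a).fst = a) (x : Fin n → K)
    (P : MvPolynomial (Fin n) k) :
    (φ (aeval x P)).snd = ∑ j, aeval x (pderiv j P) * (φ (x j)).snd := by
  induction P using MvPolynomial.induction_on with
  | C a => 
    have : φ (algebraMap k K a) = algebraMap k _ a := φ.commutes a
    simp only [aeval_C, this, pderiv_C, map_zero, zero_mul, Finset.sum_const_zero]
    rfl
  | add p q hp hq =>
    simp [hp, hq, add_mul, Finset.sum_add_distrib]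
  | mul_X p i hp =>
    simp [hp, hφ, pderiv_X, Pi.single_apply, Finset.sum_add_distrib, add_mul, Finset.mul_sum]
    simp [apply_ite, Finset.sum_ite_eq, ite_mul]
    rw [Finset.sum_mul]
    refine Finset.sum_congr rfl fun j _ => ?_
    ring

theorem lift_gen {k K B : Type} [Field k] [CharZero k] [Field K] [Algebra k K] [Algebra.EssFiniteType k K]
    [CommRing B] [Algebra k B] (f₀ : B →ₐ[k] K) (hf₀ : Function.Surjective f₀)
    (hnil₀ : IsNilpotent (RingHom.ker (f₀ : B →+* K))) (q : B) (p : K) (hq : f₀ q = p)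
    (hp : Transcendental k p) : 
    ∃ φ : K →ₐ[k] B, (∀ a, f₀ (φ a) = a) ∧ φ p = q := by
  let R := Polynomial k
  let _ : Algebra R K := (Polynomial.aeval p).toAlgebra
  have _ : IsScalarTower k R K := IsScalarTower.of_algebraMap_eq fun x => by
    simp [RingHom.algebraMap_toAlgebra, R]
  have hinj : Function.Injective (algebraMap R K) := transcendental_iff_injective.1 hp
  have : FaithfulSMul R K := (faithfulSMul_iff_algebraMap_injective R K).2 hinj
  let M := FractionRing R
  let _ : Algebra M K := FractionRing.liftAlgebra R K
  have : IsScalarTower R M K := inferInstance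
  have : CharZero M := charZero_of_injective_algebraMap (R := k) (A := M) (algebraMap k M).injective
  have : Algebra.EssFiniteType R K := Algebra.EssFiniteType.of_comp k R K
  have : Algebra.EssFiniteType M K := Algebra.EssFiniteType.of_comp R M K
  have : Algebra.FormallySmooth M K := inferInstance
  have : Algebra.FormallyEtale R M := Algebra.FormallyEtale.of_isLocalization (nonZeroDivisors R)
  have : Algebra.FormallySmooth R K := Algebra.FormallySmooth.comp R M K
  let _ : Algebra R B := (Polynomial.aeval (R := k) q).toAlgebra
  have _ : IsScalarTower k R B := IsScalarTower.of_algebraMap_eq fun x => by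
    simp [RingHom.algebraMap_toAlgebra, R]
  let f : B →ₐ[R] K := { f₀ with
    commutes' := fun r => by
      change f₀ (Polynomial.aeval q r) = Polynomial.aeval p r
      rw [← Polynomial.aeval_algHom_apply, hq] }
  have hf : Function.Surjective f := hf₀
  have hnil : IsNilpotent (RingHom.ker (f : B →+* K)) := hnil₀
  let g := Algebra.FormallySmooth.liftOfSurjective (AlgHom.id R K) f hf hnil
  have hg : ∀ a, f (g a) = a := Algebra.FormallySmooth.liftOfSurjective_apply (AlgHom.id R K) f hf hnil
  refine ⟨g.restrictScalars k, hg, ?_⟩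
  have : g (algebraMap R K Polynomial.X) = algebraMap R B Polynomial.X := g.commutes _
  have h1 : algebraMap R K Polynomial.X = p := by simp [RingHom.algebraMap_toAlgebra, R]
  have h2 : algebraMap R B Polynomial.X = q := by simp [RingHom.algebraMap_toAlgebra, R]
  rw [h1, h2] at this
  exact this

theorem lift_dual {k K : Type} [Field k] [CharZero k] [Field K] [Algebra k K] [Algebra.EssFiniteType k K]
    (p : K) (hp : Transcendental k p) : 
    ∃ φ : K →ₐ[k] TrivSqZeroExt K K, (∀ a, (φ a).fst = a) ∧ (φ p).snd = 1 := by
  obtain ⟨φ, h1, h2⟩ := lift_gen (k := k) (TrivSqZeroExt.fstHom k K K) 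
    (fun a => ⟨TrivSqZeroExt.inl a, rfl⟩) (by
      refine ⟨2, ?_⟩
      rw [pow_two, Ideal.zero_eq_bot, eq_bot_iff, Ideal.mul_le]
      intro a ha b hb
      have ha : a.fst = 0 := ha
      have hb : b.fst = 0 := hb
      rw [Ideal.mem_bot]
      ext <;> simp [ha, hb]) (TrivSqZeroExt.inl p + TrivSqZeroExt.inr 1) p (by simp) hp
  refine ⟨φ, h1, ?_⟩
  rw [h2]
  simp

theorem sard {n : ℕ} (P : MvPolynomial (Fin n) ℝ) : ∃ E : Set ℝ, E.Finite ∧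
    ∀ x : Fin n → ℝ, (∀ j, eval x (pderiv j P) = 0) → eval x P ∈ E := by
  let I : Ideal (MvPolynomial (Fin n) ℝ) := Ideal.span (Set.range fun j => pderiv j P)
  have hfin := I.finite_minimalPrimes_of_isNoetherianRing
  have key : ∀ 𝔭 ∈ I.minimalPrimes, ∃ g : Polynomial ℝ, g ≠ 0 ∧ Polynomial.aeval P g ∈ 𝔭 := by
    intro 𝔭 h𝔭
    have hpr : 𝔭.IsPrime := h𝔭.1.1
    let K := FractionRing (MvPolynomial (Fin n) ℝ ⧸ 𝔭)
    have : Algebra.EssFiniteType ℝ K := 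
      Algebra.EssFiniteType.comp ℝ (MvPolynomial (Fin n) ℝ ⧸ 𝔭) K
    let π : MvPolynomial (Fin n) ℝ →ₐ[ℝ] K := 
      (IsScalarTower.toAlgHom ℝ (MvPolynomial (Fin n) ℝ ⧸ 𝔭) K).comp (Ideal.Quotient.mkₐ ℝ 𝔭)
    have hπ : ∀ a, π a = 0 ↔ a ∈ 𝔭 := by
      intro a
      simp [π, Ideal.Quotient.eq_zero_iff_mem]
    have hae : ∀ a, aeval (fun j => π (X j)) a = π a := by
      intro a
      have : aeval (fun j => π (X j)) = π := by ext; simp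
      rw [this]
    have : IsAlgebraic ℝ (π P) := by
      by_contra htr
      obtain ⟨φ, h1, h2⟩ := lift_dual (π P) htr
      rw [← hae, dualTaylor φ h1, Finset.sum_eq_zero] at h2
      · exact zero_ne_one h2
      intro j _
      rw [hae, (hπ _).2, zero_mul]
      exact h𝔭.1.2 (Ideal.subset_span ⟨j, rfl⟩)
    obtain ⟨g, h0, hg⟩ := this
    refine ⟨g, h0, ?_⟩
    rw [← hπ, ← Polynomial.aeval_algHom_apply, hg]
  choose! g hg0 hg using key
  refine ⟨⋃ 𝔭 ∈ I.minimalPrimes, {ξ | (g 𝔭).IsRoot ξ}, hfin.biUnion fun 𝔭 h => 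
    Polynomial.finite_setOfPred_isRoot (hg0 𝔭 h), fun x hx => ?_⟩
  have hker : (RingHom.ker (eval x)).IsPrime := RingHom.ker_isPrime _
  have hle : I ≤ RingHom.ker (eval x) := by
    rw [Ideal.span_le]
    rintro _ ⟨j, rfl⟩
    exact hx j
  obtain ⟨𝔭, h𝔭, hl⟩ := Ideal.exists_minimalPrimes_le hle
  simp only [Set.mem_iUnion]
  refine ⟨𝔭, h𝔭, ?_⟩
  have := hl (hg 𝔭 h𝔭)
  rw [RingHom.mem_ker] at this
  change (g 𝔭).eval _ = 0
  rw [← this]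
  change _ = (aeval x : _ →ₐ[ℝ] ℝ) _
  rw [← Polynomial.aeval_algHom_apply]
  simp [Polynomial.aeval_def, Polynomial.eval₂_eq_eval_map]
theorem toComplex_totalDegree {n : ℕ} (Q : MvPolynomial (Fin n) ℝ) :
    (toComplex Q).totalDegree = Q.totalDegree := by
  unfold toComplex
  simp only [totalDegree]
  rw [support_map_of_injective _ (algebraMap ℝ ℂ).injective]

theorem homEval {n : ℕ} {L : Type} [Field L] [Algebra ℂ L] (Q : MvPolynomial (Fin n) ℂ)
    (Y : Fin (n + 1) → L) (x : Fin n → L) (hY : ∀ i : Fin n, Y i.succ = Y 0 * x i) :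
    aeval Y (homogenizeC Q) = Y 0 ^ Q.totalDegree * aeval x Q := by
  unfold homogenizeC
  rw [map_sum, aeval_def, eval₂_eq, Finset.mul_sum]
  refine Finset.sum_congr rfl fun m hm => ?_
  have hle : (m.sum fun _ e => e) ≤ Q.totalDegree := le_totalDegree hm
  rw [aeval_monomial, Finsupp.prod_add_index' (by simp) (by intros; rw [pow_add]),
    Finsupp.prod_single_index (by simp), Finsupp.prod_mapDomain_index (by simp) (by intros; rw [pow_add])]
  have : (m.prod fun i k => Y i.succ ^ k) = Y 0 ^ (m.sum fun _ e => e) * ∏ i ∈ m.support, x i ^ m i := by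
    simp only [hY, mul_pow, Finsupp.prod, Finsupp.sum, Finset.prod_mul_distrib, Finset.prod_pow_eq_pow_sum]
  rw [this]
  conv_rhs => rw [← Nat.sub_add_cancel hle, pow_add]
  ring

theorem kktH_eval {n : ℕ} {L : Type} [Field L] [Algebra ℂ L] (F P : MvPolynomial (Fin n) ℝ)
    (Y : Fin (n + 1) → L) (x : Fin n → L) (hY : ∀ i : Fin n, Y i.succ = Y 0 * x i)
    (w : Fin 2 → L) (u : L) (hw : w 1 = w 0 * u) (j : Fin n)
    (h : aeval x (toComplex (pderiv j F)) = u * aeval x (toComplex (pderiv j P))) :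
    aeval (Sum.elim Y w) (kktH F P j) = 0 := by
  have e : ∀ Q : MvPolynomial (Fin (n + 1)) ℂ,
      aeval (Sum.elim Y w) (rename (Sum.inl : _ → Fin (n+1) ⊕ Fin 2) Q) = aeval Y Q := by
    intro Q; rw [aeval_rename]; rfl
  unfold kktH
  simp only [map_sub, map_mul, map_pow, aeval_X, e, Sum.elim_inl, Sum.elim_inr]
  rw [homEval _ Y x hY, homEval _ Y x hY, toComplex_totalDegree, toComplex_totalDegree, h, hw]
  set a := (pderiv j F).totalDegree
  set b := (pderiv j P).totalDegree
  have ha : Y 0 ^ (max a b) = Y 0 ^ (max a b - a) * Y 0 ^ a := by 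
    rw [← pow_add, Nat.sub_add_cancel (le_max_left _ _)]
  have hb : Y 0 ^ (max a b) = Y 0 ^ (max a b - b) * Y 0 ^ b := by 
    rw [← pow_add, Nat.sub_add_cancel (le_max_right _ _)]
  linear_combination (-w 0 * u * aeval x (toComplex (pderiv j P))) * (ha - hb)

theorem kktH0_eval {n : ℕ} {L : Type} [Field L] [Algebra ℂ L] (P : MvPolynomial (Fin n) ℝ) (c : ℂ)
    (Y : Fin (n + 1) → L) (x : Fin n → L) (hY : ∀ i : Fin n, Y i.succ = Y 0 * x i)
    (w : Fin 2 → L) :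
    aeval (Sum.elim Y w) (kktH0 P c) = Y 0 ^ P.totalDegree * (aeval x (toComplex P) - algebraMap ℂ L c) := by
  have e : ∀ Q : MvPolynomial (Fin (n + 1)) ℂ,
      aeval (Sum.elim Y w) (rename (Sum.inl : _ → Fin (n+1) ⊕ Fin 2) Q) = aeval Y Q := by
    intro Q; rw [aeval_rename]; rfl
  unfold kktH0
  simp only [map_sub, map_mul, map_pow, aeval_X, e, Sum.elim_inl, aeval_C]
  rw [homEval _ Y x hY, toComplex_totalDegree]
  ring

theorem null_point {σ : Type} [Finite σ] {L : Type} [Field L] [Algebra ℂ L] (V : ValuationSubring L)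
    (hC : ∀ a : ℂ, algebraMap ℂ L a ∈ V) (Y : σ → L) (hY : ∀ i, Y i ∈ V)
    (S : Set (MvPolynomial σ ℂ)) (hS : ∀ p ∈ S, aeval Y p ∈ V.nonunits) :
    ∃ z : σ → ℂ, ∀ p ∈ S, eval z p = 0 := by
  let ι : ℂ →+* V := (algebraMap ℂ L).codRestrict V hC
  let θ₀ : MvPolynomial σ ℂ →+* V := eval₂Hom ι (fun i => ⟨Y i, hY i⟩)
  have h0 : ∀ p, (θ₀ p : L) = aeval Y p := by
    intro p
    have : (V.subtype.comp θ₀) = (aeval Y : MvPolynomial σ ℂ →ₐ[ℂ] L).toRingHom := by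
      refine MvPolynomial.ringHom_ext (fun r => ?_) (fun i => ?_)
      · simp [θ₀, ι]
      · simp [θ₀]
    exact congrArg (fun f => f p) this
  let θ := (IsLocalRing.residue V).comp θ₀
  have hle : Ideal.span S ≤ RingHom.ker θ := by
    rw [Ideal.span_le]
    intro p hp
    have := hS p hp
    rw [← h0] at this
    change IsLocalRing.residue V (θ₀ p) = 0
    rw [IsLocalRing.residue_eq_zero_iff]
    exact ValuationSubring.coe_mem_nonunits_iff.1 this
  have hne : Ideal.span S ≠ ⊤ := fun h => 
    RingHom.ker_ne_top θ (top_le_iff.1 (h ▸ hle))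
  obtain ⟨M, hM, hSM⟩ := Ideal.exists_le_maximal _ hne
  obtain ⟨z, hz⟩ := isMaximal_iff_eq_vanishingIdeal_singleton.1 hM
  refine ⟨z, fun p hp => ?_⟩
  have := hSM (Ideal.subset_span hp)
  rw [hz, mem_vanishingIdeal_singleton_iff] at this
  simpa using this

theorem exists_val {n : ℕ} {L : Type} [Field L] [Algebra ℂ L] (x : Fin n → L) (t p f g : L) (c : ℂ)
    (d : ℕ) (i : Fin n) 
    (hind : AlgebraicIndependent ℂ (Sum.elim (fun _ : Unit => t) ![p, x i]))
    (hf : f = t ^ d * (p - algebraMap ℂ L c)) :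
    ∃ V : ValuationSubring L, (∀ a : ℂ, algebraMap ℂ L a ∈ V) ∧ f ∈ V ∧ g ∈ V ∧ 
      (t ∉ V ∨ t * x i ∉ V) := by
  let A := Algebra.adjoin ℂ ({f, g} : Set L)
  have h1 : ¬ (IsAlgebraic A t ∧ IsAlgebraic A (t * x i)) := by
    rintro ⟨ht, htx⟩
    have ht0 : t ≠ 0 := hind.ne_zero (Sum.inl ())
    have hfa : IsAlgebraic A f := isAlgebraic_algebraMap (⟨f, Algebra.subset_adjoin (by simp)⟩ : A)
    have hca : IsAlgebraic A (algebraMap ℂ L c) := isAlgebraic_algebraMap (⟨_, A.algebraMap_mem c⟩ : A)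
    have hx : IsAlgebraic A (x i) := by
      have := htx.mul ht.inv
      rwa [mul_comm t, mul_assoc, mul_inv_cancel₀ ht0, mul_one] at this
    have hp : IsAlgebraic A p := by
      have := (hfa.mul (ht.pow d).inv).add hca
      rw [hf] at this
      rwa [mul_comm (t ^ d), mul_assoc, mul_inv_cancel₀ (pow_ne_zero d ht0), mul_one, sub_add_cancel] at this
    let M := AlgebraicIndependent.matroid ℂ L
    have hI : M.Indep (Set.range (Sum.elim (fun _ : Unit => t) ![p, x i])) := by
      rw [AlgebraicIndependent.matroid_indep_iff]
      exact hind.to_subtype_range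
    have hsub : (Set.range (Sum.elim (fun _ : Unit => t) ![p, x i])) ⊆ M.closure {f, g} := by
      rw [AlgebraicIndependent.matroid_closure_eq]
      rintro _ ⟨k, rfl⟩
      change IsAlgebraic A _
      rcases k with k | k
      · exact ht
      · fin_cases k
        · exact hp
        · exact hx
    have h3 := M.eRk_mono hsub
    rw [M.eRk_closure_eq, hI.eRk_eq_encard, ← Set.image_univ, hind.injective.encard_image] at h3
    have h4 := h3.trans ((M.eRk_le_encard _).trans (Set.encard_insert_le {g} f))
    simp [Set.encard_univ] at h4
    norm_num at h4
  have h2 : ∃ y : L, (y = t ∨ y = t * x i) ∧ ¬ IsIntegral A y := by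
    by_contra! hcon
    exact h1 ⟨(hcon t (Or.inl rfl)).isAlgebraic, (hcon _ (Or.inr rfl)).isAlgebraic⟩
  obtain ⟨y, hy, hni⟩ := h2
  obtain ⟨V, hV, hyV⟩ := Subring.exists_le_valuationSubring_of_isIntegrallyClosedIn (x := y)
    (R := (integralClosure A L).toSubring) hni
  have hA : ∀ a ∈ A, a ∈ V := fun a ha => hV (isIntegral_algebraMap (x := (⟨a, ha⟩ : A)))
  refine ⟨V, fun a => hA _ (A.algebraMap_mem a), hA _ (Algebra.subset_adjoin (by simp)), 
    hA _ (Algebra.subset_adjoin (by simp)), ?_⟩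
  rcases hy with rfl | rfl
  · exact Or.inl hyV
  · exact Or.inr hyV

theorem core {n : ℕ} {L : Type} [Field L] [Algebra ℂ L] (F P : MvPolynomial (Fin n) ℝ)
    (hP : 0 < P.totalDegree) (x : Fin n → L) (u t : L) (i : Fin n) (c : ℂ)
    (h : ∀ j, aeval x (toComplex (pderiv j F)) = u * aeval x (toComplex (pderiv j P)))
    (hind : AlgebraicIndependent ℂ (Sum.elim (fun _ : Unit => t) ![aeval x (toComplex P), x i]))
    (hfin : (projKKT F P c).Finite) : False := by
  have : Finite (projKKT F P c) := hfin
  obtain ⟨ℓ, hℓ⟩ := Module.exists_dual_forall_apply_ne_zero (K := ℂ) 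
    (fun q : projKKT F P c => q.1.1.rep) (fun q => q.1.1.rep_nonzero)
  let lp : MvPolynomial (Fin (n+1) ⊕ Fin 2) ℂ := ∑ i, C (ℓ (Pi.single i 1)) * X (Sum.inl i)
  let x₁ : Fin (n+1) → L := Fin.cons 1 x
  let g : L := ∑ i, algebraMap ℂ L (ℓ (Pi.single i 1)) * (t * x₁ i)
  set p := aeval x (toComplex P) with hp
  set d := P.totalDegree with hd
  obtain ⟨V, hC, hfV, hgV, htV⟩ := exists_val x t p (t ^ d * (p - algebraMap ℂ L c)) g c d i hind rfl
  have hbad : ∃ k, t * x₁ k ∉ V := by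
    rcases htV with h | h
    · exact ⟨0, by simpa [x₁] using h⟩
    · exact ⟨i.succ, by simpa [x₁] using h⟩
  obtain ⟨m, hm⟩ := Finite.exists_max (fun k => V.valuation (t * x₁ k))
  have hm1 : 1 < V.valuation (t * x₁ m) := by
    obtain ⟨k, hk⟩ := hbad
    rw [← V.valuation_le_one_iff, not_le] at hk
    exact hk.trans_le (hm k)
  set r := t * x₁ m with hr
  have hr0 : r ≠ 0 := by
    intro h0
    rw [h0] at hm1
    simp at hm1
  have hrinv : V.valuation r⁻¹ < 1 := by
    rw [map_inv₀]; exact inv_lt_one_of_one_lt₀ hm1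
  let Y : Fin (n+1) → L := fun k => t * x₁ k * r⁻¹
  have hYV : ∀ k, Y k ∈ V := by
    intro k
    rw [← V.valuation_le_one_iff]
    simp only [Y, map_mul _ _ r⁻¹, map_inv₀]
    exact mul_inv_le_one_of_le₀ (hm k) zero_le
  have hYm : Y m = 1 := mul_inv_cancel₀ hr0
  have hY0 : ∀ k : Fin n, Y k.succ = Y 0 * x k := by
    intro k; simp [Y, x₁]; ring
  obtain ⟨w, e, hwV, hwe, hwu⟩ : ∃ (w : Fin 2 → L) (e : Fin 2), (∀ k, w k ∈ V) ∧ w e = 1 ∧ w 1 = w 0 * u := by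
    by_cases hu : u ∈ V
    · refine ⟨![1, u], 0, ?_, rfl, by simp⟩
      intro k; fin_cases k
      · exact V.one_mem
      · exact hu
    · have hu0 : u ≠ 0 := by rintro rfl; exact hu V.zero_mem
      refine ⟨![u⁻¹, 1], 1, ?_, rfl, by simp [hu0]⟩
      intro k; fin_cases k
      · exact (V.mem_or_inv_mem u).resolve_left hu
      · exact V.one_mem
  obtain ⟨z, hz⟩ := null_point V hC (Sum.elim Y w) 
    (by rintro (k | k); exacts [hYV k, hwV k])
    (Set.range (kktH F P) ∪ {kktH0 P c, lp, X (Sum.inl m) - 1, X (Sum.inr e) - 1}) (by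
      rintro q (⟨j, rfl⟩ | rfl | rfl | rfl | rfl)
      · rw [kktH_eval F P Y x hY0 w u hwu j (h j)]
        exact V.nonunits.zero_mem
      · rw [kktH0_eval P c Y x hY0 w, ValuationSubring.mem_nonunits_iff]
        have : Y 0 ^ P.totalDegree * (aeval x (toComplex P) - algebraMap ℂ L c) = 
            (t ^ d * (p - algebraMap ℂ L c)) * (r⁻¹) ^ d := by
          simp [Y, x₁, mul_pow, ← hp, ← hd]; ring
        rw [this, map_mul, map_pow]
        refine lt_of_le_of_lt (mul_le_of_le_one_left' ((V.valuation_le_one_iff _).2 hfV)) ?_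
        exact pow_lt_one₀ zero_le hrinv hP.ne'
      · have : aeval (Sum.elim Y w) lp = g * r⁻¹ := by
          simp only [lp, map_sum, map_mul, aeval_C, aeval_X, Sum.elim_inl, g, Finset.sum_mul, Y]
          refine Finset.sum_congr rfl fun k _ => by ring
        rw [this, ValuationSubring.mem_nonunits_iff, map_mul]
        exact lt_of_le_of_lt (mul_le_of_le_one_left' ((V.valuation_le_one_iff _).2 hgV)) hrinv
      · simp only [map_sub, aeval_X, map_one, Sum.elim_inl, hYm, sub_self]
        exact V.nonunits.zero_mem
      · simp only [map_sub, aeval_X, map_one, Sum.elim_inr, hwe, sub_self]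
        exact V.nonunits.zero_mem)
  have z1 : ∀ j, eval z (kktH F P j) = 0 := fun j => hz _ (Or.inl ⟨j, rfl⟩)
  have z2 : eval z (kktH0 P c) = 0 := hz _ (by simp)
  have z3 : eval z lp = 0 := hz _ (by simp)
  have z4 : z (Sum.inl m) = 1 := by
    have := hz (X (Sum.inl m) - 1) (by simp)
    simpa [sub_eq_zero] using this
  have z5 : z (Sum.inr e) = 1 := by
    have := hz (X (Sum.inr e) - 1) (by simp)
    simpa [sub_eq_zero] using this
  let x' : Fin (n+1) → ℂ := fun k => z (Sum.inl k)
  let u' : Fin 2 → ℂ := fun k => z (Sum.inr k)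
  have hzz : Sum.elim x' u' = z := by ext (k | k) <;> rfl
  have hx' : x' ≠ 0 := fun h0 => by
    have := congrFun h0 m; simp [x', z4] at this
  have hu' : u' ≠ 0 := fun h0 => by
    have := congrFun h0 e; simp [u', z5] at this
  let q : projKKT F P c := ⟨(Projectivization.mk ℂ x' hx', Projectivization.mk ℂ u' hu'), 
    x', u', hx', hu', rfl, by rw [hzz]; exact z1, by rw [hzz]; exact z2⟩
  apply hℓ q
  obtain ⟨a, ha⟩ := Projectivization.exists_smul_eq_mk_rep ℂ x' hx'
  change ℓ (Projectivization.mk ℂ x' hx').rep = 0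
  have hlx : ℓ x' = 0 := by
    rw [← z3, LinearMap.pi_apply_eq_sum_univ ℓ x']
    simp only [lp, map_sum, map_mul, eval_C, eval_X, smul_eq_mul]
    refine Finset.sum_congr rfl fun k _ => ?_
    rw [mul_comm]
    congr 2
    ext l; simp [Pi.single_apply, eq_comm]
  rw [← ha, Units.smul_def, map_smul, hlx, smul_zero]

theorem two_var (G : MvPolynomial (Fin 2) ℂ) (hG : G ≠ 0) :
    ∃ E : Set ℂ, E.Finite ∧ ∀ ξ ∉ E, {s : ℂ | eval ![ξ, s] G = 0}.Finite := by
  obtain ⟨ab, hab⟩ : ∃ ab, eval ab G ≠ 0 := by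
    by_contra! h
    exact hG (MvPolynomial.funext fun x => by simpa using h x)
  let a := ab 0
  let b := ab 1
  have hab : eval ![a, b] G ≠ 0 := by
    have : ![a, b] = ab := by ext k; fin_cases k <;> rfl
    rwa [this]
  let g₁ : Polynomial ℂ := aeval ![Polynomial.X, Polynomial.C b] G
  have h1 : ∀ ξ, g₁.eval ξ = eval ![ξ, b] G := by
    intro ξ
    have : ((Polynomial.aeval ξ : _ →ₐ[ℂ] ℂ).comp (aeval ![Polynomial.X, Polynomial.C b])) = 
        (aeval ![ξ, b] : MvPolynomial (Fin 2) ℂ →ₐ[ℂ] ℂ) := by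
      ext k; fin_cases k <;> simp
    have := DFunLike.congr_fun this G
    simpa [g₁, Polynomial.aeval_def, Polynomial.eval₂_eq_eval_map, MvPolynomial.aeval_eq_eval] using this
  have h2 : ∀ ξ s, (aeval ![Polynomial.C ξ, Polynomial.X] G : Polynomial ℂ).eval s = eval ![ξ, s] G := by
    intro ξ s
    have : ((Polynomial.aeval s : _ →ₐ[ℂ] ℂ).comp (aeval ![Polynomial.C ξ, Polynomial.X])) = 
        (aeval ![ξ, s] : MvPolynomial (Fin 2) ℂ →ₐ[ℂ] ℂ) := by
      ext k; fin_cases k <;> simp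
    have := DFunLike.congr_fun this G
    simpa [Polynomial.aeval_def, Polynomial.eval₂_eq_eval_map, MvPolynomial.aeval_eq_eval] using this
  have hg₁ : g₁ ≠ 0 := fun h => hab (by rw [← h1, h, Polynomial.eval_zero])
  refine ⟨{ξ | g₁.IsRoot ξ}, Polynomial.finite_setOfPred_isRoot hg₁, fun ξ hξ => ?_⟩
  have hne : (aeval ![Polynomial.C ξ, Polynomial.X] G : Polynomial ℂ) ≠ 0 := by
    intro h
    apply hξ
    change g₁.eval ξ = 0
    rw [h1, ← h2, h, Polynomial.eval_zero]
  refine (Polynomial.finite_setOfPred_isRoot hne).subset fun s hs => ?_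
  change Polynomial.eval _ _ = 0
  rw [h2]; exact hs

theorem crit_fin {n : ℕ} (F P : MvPolynomial (Fin n) ℝ) (hP : 0 < P.totalDegree)
    (hfin : ∃ c : ℂ, (projKKT F P c).Finite) :
    ∃ E : Set ℝ, E.Finite ∧ ∀ ξ ∉ E, (critSet F P ξ).Finite := by
  obtain ⟨c, hc⟩ := hfin
  let A := MvPolynomial (Option (Fin n)) ℂ
  let ρ : MvPolynomial (Fin n) ℝ → A := fun Q => rename some (toComplex Q)
  let I : Ideal A := Ideal.span (Set.range fun j => ρ (pderiv j F) - X none * ρ (pderiv j P))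
  have hmin := I.finite_minimalPrimes_of_isNoetherianRing
  have key : ∀ 𝔭 ∈ I.minimalPrimes, ∀ i : Fin n, ∃ G : MvPolynomial (Fin 2) ℂ, G ≠ 0 ∧ 
      aeval ![ρ P, X (some i)] G ∈ 𝔭 := by
    intro 𝔭 h𝔭 i
    have hpr : 𝔭.IsPrime := h𝔭.1.1
    let K := FractionRing (A ⧸ 𝔭)
    let π : A →ₐ[ℂ] K := 
      (IsScalarTower.toAlgHom ℂ (A ⧸ 𝔭) K).comp (Ideal.Quotient.mkₐ ℂ 𝔭)
    have hπ : ∀ a, π a = 0 ↔ a ∈ 𝔭 := by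
      intro a
      simp [π, Ideal.Quotient.eq_zero_iff_mem]
    by_contra! hcon
    have hind : AlgebraicIndependent ℂ ![π (ρ P), π (X (some i))] := by
      rw [algebraicIndependent_iff]
      intro G hG
      by_contra hG0
      apply hcon G hG0
      rw [← hπ, ← hG]
      have : π.comp (aeval ![ρ P, X (some i)]) = aeval ![π (ρ P), π (X (some i))] := by
        ext k; fin_cases k <;> simp
      exact DFunLike.congr_fun this G
    let L := FractionRing (Polynomial K)
    let t : L := algebraMap (Polynomial K) L Polynomial.X
    have ht : AlgebraicIndependent K (fun _ : Unit => t) := by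
      rw [algebraicIndependent_unique_type_iff]
      exact (transcendental_algebraMap_iff (IsFractionRing.injective (Polynomial K) L)).2 
        (Polynomial.transcendental_X K)
    have hind2 := hind.sumElim_comp ht
    let Ψ : A →ₐ[ℂ] L := (IsScalarTower.toAlgHom ℂ K L).comp π
    let x : Fin n → L := fun j => Ψ (X (some j))
    have hx : ∀ Q, aeval x (toComplex Q) = Ψ (ρ Q) := by
      intro Q
      have : aeval x = Ψ.comp (rename some) := by
        ext k; simp [x]
        exact congrArg Ψ (rename_X some k).symm
      rw [this]; rfl
    refine core F P hP x (Ψ (X none)) t i c ?_ ?_ hc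
    · intro j
      rw [hx, hx, ← map_mul, ← sub_eq_zero, ← map_sub]
      change algebraMap K L (π _) = 0
      rw [(hπ _).2, map_zero]
      exact h𝔭.1.2 (Ideal.subset_span ⟨j, rfl⟩)
    · have e : ![aeval x (toComplex P), x i] = (algebraMap K L) ∘ ![π (ρ P), π (X (some i))] := by
        rw [hx]
        ext k; fin_cases k <;> rfl
      rw [e]; exact hind2
  choose! G hG0 hG using key
  have h2 : ∀ 𝔭 ∈ I.minimalPrimes, ∀ i : Fin n, ∃ E : Set ℂ, E.Finite ∧ 
      ∀ ξ ∉ E, {s : ℂ | eval ![ξ, s] (G 𝔭 i) = 0}.Finite := fun 𝔭 h𝔭 i => two_var _ (hG0 𝔭 h𝔭 i)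
  choose! E hE hE2 using h2
  refine ⟨(fun r : ℝ => (r : ℂ)) ⁻¹' (⋃ 𝔭 ∈ I.minimalPrimes, ⋃ i, E 𝔭 i), ?_, ?_⟩
  · refine Set.Finite.preimage Complex.ofReal_injective.injOn ?_
    exact hmin.biUnion fun 𝔭 h => Set.finite_iUnion fun i => hE 𝔭 h i
  · intro ξ hξ
    have hfi : ∀ i : Fin n, ((fun r : ℝ => (r : ℂ)) ⁻¹' 
        (⋃ 𝔭 ∈ I.minimalPrimes, {s : ℂ | eval ![(ξ : ℂ), s] (G 𝔭 i) = 0})).Finite := by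
      intro i
      refine Set.Finite.preimage Complex.ofReal_injective.injOn ?_
      refine hmin.biUnion fun 𝔭 h => hE2 𝔭 h i _ fun hmem => hξ ?_
      simp only [Set.mem_preimage, Set.mem_iUnion]
      exact ⟨𝔭, h, i, hmem⟩
    refine (Set.Finite.pi' hfi).subset ?_
    rintro x ⟨hx, u, hu⟩ i
    let y : Option (Fin n) → ℂ := fun o => o.elim (u : ℂ) (fun j => (x j : ℂ))
    have hy : ∀ Q, eval y (ρ Q) = ((eval x Q : ℝ) : ℂ) := by
      intro Q
      simp only [ρ, toComplex, eval_rename, eval_map]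
      have : (y ∘ some) = fun j => algebraMap ℝ ℂ (x j) := rfl
      rw [this]
      exact (MvPolynomial.eval₂_comp_left (algebraMap ℝ ℂ) (RingHom.id ℝ) x Q).symm
    have hker : (RingHom.ker (eval y)).IsPrime := RingHom.ker_isPrime _
    have hle : I ≤ RingHom.ker (eval y) := by
      rw [Ideal.span_le]
      rintro _ ⟨j, rfl⟩
      change eval y _ = 0
      rw [map_sub, map_mul, hy, hy, hu, eval_X]
      simp [y]
    obtain ⟨𝔭, h𝔭, hl⟩ := Ideal.exists_minimalPrimes_le hle
    simp only [Set.mem_preimage, Set.mem_iUnion]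
    refine ⟨𝔭, h𝔭, ?_⟩
    have h3 : eval y (aeval ![ρ P, X (some i)] (G 𝔭 i)) = 0 := hl (hG 𝔭 h𝔭 i)
    have h4 : (aeval y : A →ₐ[ℂ] ℂ).comp (aeval ![ρ P, X (some i)]) = aeval ![(ξ : ℂ), (x i : ℂ)] := by
      ext k; fin_cases k
      · simpa [MvPolynomial.aeval_eq_eval, hx] using hy P
      · simp [y]
    have h5 := DFunLike.congr_fun h4 (G 𝔭 i)
    change eval _ _ = 0
    rw [← h3]
    exact h5.symm

/-- If the top-degree homogeneous component of `P` has no nonzero real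
zero, `P` has a real zero with nonvanishing gradient, and for some `c ∈ ℂ` the set of complex
projective KKT points of `F` on `{P = c}` is finite, then for all sufficiently small `ξ > 0`
outside a finite set `E`, the set of critical points of `F` on `{P = ξ}` is nonempty, finite,
and contained in a fixed closed ball. -/
theorem crit_nonempty_finite_bounded (n : ℕ) (F P : MvPolynomial (Fin n) ℝ)
    (hP : 0 < P.totalDegree)
    (hinf : ∀ y : Fin n → ℝ, y ≠ 0 → eval y (homogeneousComponent P.totalDegree P) ≠ 0)
    (hx0 : ∃ x0 : Fin n → ℝ, eval x0 P = 0 ∧ (fun j => eval x0 (pderiv j P)) ≠ 0)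
    (hfin : ∃ c : ℂ, (projKKT F P c).Finite) :
    ∃ ε > (0 : ℝ), ∃ r > (0 : ℝ), ∃ E : Set ℝ, E.Finite ∧
      ∀ ξ ∈ Set.Ioo (0 : ℝ) ε, ξ ∉ E →
        (critSet F P ξ).Nonempty ∧ (critSet F P ξ).Finite ∧
        critSet F P ξ ⊆ Metric.closedBall 0 r := by
  obtain ⟨E₁, hE₁, hsard⟩ := sard P
  obtain ⟨E₂, hE₂, hcf⟩ := crit_fin F P hP hfin
  obtain ⟨r, hr, hbd⟩ := bddLevel P hP hinf
  obtain ⟨x0, h0, hgrad⟩ := hx0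
  have hex : ∃ y, 0 < eval y P := by
    by_contra! hcon
    have hmax : IsLocalMax (fun y : Fin n → ℝ => eval y P) x0 := by
      refine Filter.Eventually.of_forall fun y => ?_
      simp only [h0]; exact hcon y
    have hz := hmax.hasFDerivAt_eq_zero (strictFD P x0).hasFDerivAt
    apply hgrad
    funext j
    have := DFunLike.congr_fun hz (Pi.single j 1)
    simpa [Pi.single_apply] using this
  obtain ⟨y, hy⟩ := hex
  refine ⟨min 1 (eval y P), lt_min one_pos hy, r, hr, E₁ ∪ E₂, hE₁.union hE₂, fun ξ hξ hE => ?_⟩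
  have hξ0 : 0 < ξ := hξ.1
  have hξ1 : ξ < 1 := hξ.2.trans_le (min_le_left _ _)
  have hξy : ξ < eval y P := hξ.2.trans_le (min_le_right _ _)
  have hbound : ∀ x, eval x P = ξ → x ∈ Metric.closedBall (0 : Fin n → ℝ) r := by
    intro x hx
    rw [mem_closedBall_zero_iff]
    exact hbd x ⟨by rw [hx]; exact hξ0.le, by rw [hx]; exact hξ1.le⟩
  refine ⟨?_, hcf ξ (fun h => hE (Or.inr h)), fun x hx => hbound x hx.1⟩
  let S : Set (Fin n → ℝ) := {x | eval x P = ξ}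
  have hSc : IsCompact S := by
    refine (isCompact_closedBall (0 : Fin n → ℝ) r).of_isClosed_subset ?_ hbound
    exact isClosed_eq (contEval P) continuous_const
  have hSn : S.Nonempty := by
    obtain ⟨z, hz⟩ := mem_range_of_exists_le_of_exists_ge (contEval P) 
      ⟨x0, by rw [h0]; exact hξ0.le⟩ ⟨y, hξy.le⟩
    exact ⟨z, hz⟩
  obtain ⟨x, hxS, hmin⟩ := hSc.exists_isMinOn hSn (contEval F).continuousOn
  have hxP : eval x P = ξ := hxS
  have hext : IsLocalExtrOn (fun y : Fin n → ℝ => eval y F) {z | eval z P = eval x P} x := by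
    rw [hxP]
    exact (hmin.localize).isExtr
  obtain ⟨a, b, hab, hl⟩ := hext.exists_multipliers_of_hasStrictFDerivAt_1d (strictFD P x) (strictFD F x)
  have hj : ∀ j, a * eval x (pderiv j P) + b * eval x (pderiv j F) = 0 := by
    intro j
    have := DFunLike.congr_fun hl (Pi.single j 1)
    simpa [Pi.single_apply] using this
  have hb : b ≠ 0 := by
    rintro rfl
    have ha : a ≠ 0 := by rintro rfl; exact hab rfl
    apply hE
    left
    rw [← hxP]
    refine hsard x fun j => ?_
    simpa [ha] using hj j
  refine ⟨x, hxP, -a / b, fun j => ?_⟩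
  field_simp
  linear_combination hj j
end
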